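/- If G is a graph in obs(P1) that is not isomorphic to any of the 33 graphs in O, then G is biconnected. -/

import Mathlib

open SimpleGraph

/-- `H` is a minor of `G` (branch-set definition): there is a family of connected, nonempty,
pairwise disjoint branch sets in `G`, indexed by the vertices of `H`, such that vertices
adjacent in `H` have an edge of `G` between their branch sets. -/
def IsMinorOf {W V : Type} (H : SimpleGraph W) (G : SimpleGraph V) : Prop :=
  ∃ f : W → Set V,
    (∀ w, (G.induce (f w)).Connected) ∧
    (∀ ⦃w w' : W⦄, w ≠ w' → Disjoint (f w) (f w')) ∧
    (∀ ⦃w w' : W⦄, H.Adj w w' → ∃ a ∈ f w, ∃ b ∈ f w', G.Adj a b)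

/-- A pseudoforest: every connected component contains at most one cycle, i.e. any two
cycles lying in the same connected component have the same edge set. -/
def Pseudoforest {V : Type} (G : SimpleGraph V) : Prop :=
  ∀ ⦃u v : V⦄ (c : G.Walk u u) (c' : G.Walk v v),
    c.IsCycle → c'.IsCycle → G.Reachable u v → ∀ e, e ∈ c.edges ↔ e ∈ c'.edges

/-- An apex-pseudoforest: removing at most one vertex yields a pseudoforest. -/
def ApexPseudoforest {V : Type} (G : SimpleGraph V) : Prop :=
  ∃ s : Set V, s.Subsingleton ∧ Pseudoforest (G.induce sᶜ)

/-- `G` is a minor-obstruction for the class of apex-pseudoforests: `G` is not an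
apex-pseudoforest but every proper minor of `G` is. -/
def ObsApexPseudoforest {V : Type} (G : SimpleGraph V) : Prop :=
  ¬ ApexPseudoforest G ∧
    ∀ (W : Type) [Finite W] (H : SimpleGraph W),
      IsMinorOf H G → IsEmpty (H ≃g G) → ApexPseudoforest H

/-- `G` is `k`-connected: between any two distinct vertices `u ≠ v` there exist `k`
pairwise distinct `(u,v)`-paths, any two of which share no vertices other than `u,v`. -/
def KConnected {V : Type} (k : ℕ) (G : SimpleGraph V) : Prop :=
  ∀ ⦃u v : V⦄, u ≠ v → ∃ P : Fin k → G.Walk u v,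
    Function.Injective P ∧ (∀ i, (P i).IsPath) ∧
      ∀ i j, i ≠ j → ∀ x, x ∈ (P i).support → x ∈ (P j).support → x = u ∨ x = v

/-- The simple graph on `Fin n` with the given list of (0-indexed) edges. -/
def mkGraph (n : ℕ) (E : List (ℕ × ℕ)) : SimpleGraph (Fin n) :=
  SimpleGraph.fromRel fun a b => ((a : ℕ), (b : ℕ)) ∈ E

/-- Obstruction 1: two disjoint diamonds. -/
def O1 : SimpleGraph (Fin 8) :=
  mkGraph 8 [(0,1),(0,2),(0,3),(1,2),(1,3),(4,5),(4,6),(4,7),(5,6),(5,7)]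
/-- Obstruction 2: two disjoint butterflies. -/
def O2 : SimpleGraph (Fin 10) :=
  mkGraph 10 [(0,1),(0,2),(1,2),(0,3),(0,4),(3,4),(5,6),(5,7),(6,7),(5,8),(5,9),(8,9)]
/-- Obstruction 3: a diamond plus a butterfly. -/
def O3 : SimpleGraph (Fin 9) :=
  mkGraph 9 [(0,1),(0,2),(0,3),(1,2),(1,3),(4,5),(4,6),(5,6),(4,7),(4,8),(7,8)]
def O4 : SimpleGraph (Fin 8) :=
  mkGraph 8 [(0,1),(0,2),(1,2),(2,3),(2,4),(3,4),(3,5),(4,5),(5,6),(5,7),(6,7)]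
def O5 : SimpleGraph (Fin 8) :=
  mkGraph 8 [(0,1),(0,2),(1,2),(2,3),(2,4),(3,4),(3,5),(4,6),(5,6),(5,7),(6,7)]
def O6 : SimpleGraph (Fin 8) :=
  mkGraph 8 [(0,1),(0,2),(1,2),(2,3),(2,4),(3,4),(3,5),(4,5),(3,6),(5,6),(4,7),(5,7)]
def O7 : SimpleGraph (Fin 7) :=
  mkGraph 7 [(0,1),(0,6),(1,6),(2,3),(2,4),(2,5),(3,4),(3,5),(4,6),(5,6)]
def O8 : SimpleGraph (Fin 7) :=
  mkGraph 7 [(0,1),(0,2),(1,2),(2,3),(2,4),(2,5),(3,4),(3,5),(4,5),(4,6),(5,6)]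
def O9 : SimpleGraph (Fin 9) :=
  mkGraph 9 [(0,1),(0,2),(1,2),(2,3),(2,4),(3,4),(3,5),(4,5),(2,6),(4,6),(2,7),(3,7),(3,8),(4,8)]
def O10 : SimpleGraph (Fin 9) :=
  mkGraph 9 [(0,1),(1,2),(2,3),(3,0),(0,4),(1,4),(1,5),(2,5),(2,6),(3,6),(0,7),(0,8),(7,8)]
def O11 : SimpleGraph (Fin 9) :=
  mkGraph 9 [(0,1),(0,2),(1,2),(3,4),(3,5),(4,5),(6,7),(6,8),(7,8),(2,3),(1,8),(4,8)]
def O12 : SimpleGraph (Fin 9) :=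
  mkGraph 9 [(0,1),(0,2),(1,2),(3,4),(3,5),(4,5),(6,7),(6,8),(7,8),(2,3),(2,7),(3,6)]
def O13 : SimpleGraph (Fin 9) :=
  mkGraph 9 [(0,1),(0,2),(1,2),(3,4),(3,5),(4,5),(6,7),(6,8),(7,8),(2,3),(2,8),(3,8)]
def O14 : SimpleGraph (Fin 8) :=
  mkGraph 8 [(0,1),(0,2),(1,2),(1,4),(2,3),(2,4),(3,4),(3,5),(4,5),(1,6),(1,7),(6,7)]
def O15 : SimpleGraph (Fin 9) :=
  mkGraph 9 [(0,1),(0,2),(1,2),(2,3),(2,4),(3,4),(4,5),(4,6),(5,6),(6,7),(6,8),(7,8),(2,6)]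
def O16 : SimpleGraph (Fin 6) :=
  mkGraph 6 [(0,2),(0,3),(0,4),(0,5),(1,2),(1,3),(1,4),(1,5),(2,3),(4,5)]
def O17 : SimpleGraph (Fin 6) :=
  mkGraph 6 [(0,1),(1,3),(3,2),(2,0),(4,0),(4,1),(4,2),(4,3),(5,0),(5,1)]
def O18 : SimpleGraph (Fin 8) :=
  mkGraph 8 [(0,1),(1,2),(2,3),(3,0),(4,0),(4,1),(5,1),(5,2),(6,2),(6,3),(7,3),(7,0)]
def O19 : SimpleGraph (Fin 7) :=
  mkGraph 7 [(0,2),(0,3),(1,2),(1,3),(2,3),(0,4),(4,1),(5,0),(5,4),(6,4),(6,1)]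
def O20 : SimpleGraph (Fin 6) :=
  mkGraph 6 [(1,2),(1,4),(1,5),(2,4),(2,5),(4,5),(0,1),(0,4),(2,3),(3,5)]
def O21 : SimpleGraph (Fin 7) :=
  mkGraph 7 [(0,1),(0,3),(0,4),(1,3),(1,4),(3,5),(4,5),(1,2),(2,4),(3,6),(5,6)]
def O22 : SimpleGraph (Fin 8) :=
  mkGraph 8 [(0,1),(0,3),(1,4),(3,4),(1,2),(2,4),(7,0),(7,3),(5,7),(5,0),(6,7),(6,3)]
def O23 : SimpleGraph (Fin 7) :=
  mkGraph 7 [(2,3),(2,4),(2,6),(3,4),(3,6),(4,6),(5,3),(5,4),(0,2),(0,3),(1,2),(1,4)]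
def O24 : SimpleGraph (Fin 7) :=
  mkGraph 7 [(0,1),(0,2),(1,2),(1,3),(2,4),(3,5),(3,6),(4,5),(4,6),(5,6)]
def O25 : SimpleGraph (Fin 8) :=
  mkGraph 8 [(0,1),(0,3),(1,3),(1,2),(1,5),(2,5),(1,7),(2,7),(3,4),(4,5),(3,5),(3,6),(5,6)]
def O26 : SimpleGraph (Fin 9) :=
  mkGraph 9 [(2,3),(2,4),(3,4),(5,3),(5,4),(8,3),(8,4),(0,2),(0,3),(7,2),(7,3),(1,2),(1,4),(6,2),(6,4)]
def O27 : SimpleGraph (Fin 8) :=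
  mkGraph 8 [(0,2),(1,2),(0,3),(2,3),(1,6),(2,6),(3,4),(6,7),(4,5),(5,7),(3,7),(4,7)]
def O28 : SimpleGraph (Fin 7) :=
  mkGraph 7 [(0,1),(0,2),(1,2),(1,3),(1,5),(3,5),(3,4),(3,6),(4,6),(2,5),(5,6)]
def O29 : SimpleGraph (Fin 9) :=
  mkGraph 9 [(0,1),(0,2),(1,2),(3,4),(3,5),(4,5),(6,7),(6,8),(7,8),(2,3),(1,7),(4,6)]
def O30 : SimpleGraph (Fin 8) :=
  mkGraph 8 [(0,1),(0,2),(1,2),(3,4),(3,5),(4,5),(6,7),(1,6),(4,6),(0,7),(5,7)]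
/-- Obstruction 31: the prism. -/
def O31 : SimpleGraph (Fin 6) :=
  mkGraph 6 [(0,1),(0,2),(1,2),(3,4),(3,5),(4,5),(0,3),(1,4),(2,5)]
/-- Obstruction 32: `K₃,₃`. -/
def O32 : SimpleGraph (Fin 6) :=
  mkGraph 6 [(0,3),(0,4),(0,5),(1,3),(1,4),(1,5),(2,3),(2,4),(2,5)]
/-- Obstruction 33: `K₅` minus one edge. -/
def O33 : SimpleGraph (Fin 5) :=
  mkGraph 5 [(0,1),(0,2),(0,3),(0,4),(1,2),(1,3),(1,4),(2,3),(2,4)]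

/-- The list `O` of the 33 obstructions. -/
def OList : List ((n : ℕ) × SimpleGraph (Fin n)) :=
  [⟨8, O1⟩, ⟨10, O2⟩, ⟨9, O3⟩, ⟨8, O4⟩, ⟨8, O5⟩, ⟨8, O6⟩, ⟨7, O7⟩, ⟨7, O8⟩, ⟨9, O9⟩,
   ⟨9, O10⟩, ⟨9, O11⟩, ⟨9, O12⟩, ⟨9, O13⟩, ⟨8, O14⟩, ⟨9, O15⟩, ⟨6, O16⟩, ⟨6, O17⟩,
   ⟨8, O18⟩, ⟨7, O19⟩, ⟨6, O20⟩, ⟨7, O21⟩, ⟨8, O22⟩, ⟨7, O23⟩, ⟨7, O24⟩, ⟨8, O25⟩,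
   ⟨9, O26⟩, ⟨8, O27⟩, ⟨7, O28⟩, ⟨9, O29⟩, ⟨8, O30⟩, ⟨6, O31⟩, ⟨6, O32⟩, ⟨5, O33⟩]

/-- `G` is isomorphic to one of the 33 graphs in `O`. -/
def InO {V : Type} (G : SimpleGraph V) : Prop :=
  ∃ H ∈ OList, Nonempty (G ≃g H.2)


/-- `f` orients every edge of `G` inside `S` away from one of its endpoints, so that every vertex
has out-degree at most one. -/
def Orients {V : Type} (G : SimpleGraph V) (S : Set V) (f : V → V) : Prop :=
  ∀ a ∈ S, ∀ b ∈ S, G.Adj a b → f a = b ∨ f b = a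

/-- The edges of `G` inside `S` can be oriented with out-degree at most one. -/
def Orientable {V : Type} (G : SimpleGraph V) (S : Set V) : Prop :=
  ∃ f, Orients G S f

section Pseudoforest

variable {V : Type} {G : SimpleGraph V}

lemma mem_edges_iff_of_isCycle {f : V → V} (hf : Orients G Set.univ f) {u : V}
    {c : G.Walk u u} (hc : c.IsCycle) :
    (∀ e, e ∈ c.edges ↔ ∃ v ∈ c.support, s(v, f v) = e) ∧
      ∀ a ∈ c.support, ∀ b ∈ c.support, s(a, f a) = s(b, f b) → a = b := by
  classical
  have h1 : c.edges.toFinset.card = c.length := by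
    rw [List.toFinset_card_of_nodup hc.edges_nodup, Walk.length_edges]
  have h2 : c.support.toFinset.card = c.length := by
    have : c.support.toFinset = c.support.tail.toFinset := by
      ext x
      simp only [List.mem_toFinset]
      constructor
      · intro hx
        rcases Walk.mem_support_iff c |>.1 hx with rfl | hx
        · exact Walk.end_mem_tail_support hc.not_nil
        · exact hx
      · exact List.mem_of_mem_tail
    rw [this, List.toFinset_card_of_nodup hc.support_nodup]
    simp
  have h3 : c.edges.toFinset ⊆ c.support.toFinset.image (fun v => s(v, f v)) := by
    intro e he
    simp only [List.mem_toFinset, Finset.mem_image] at he ⊢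
    induction e with
    | _ a b =>
      rcases hf a trivial b trivial (c.adj_of_mem_edges he) with h | h
      · exact ⟨a, c.fst_mem_support_of_mem_edges he, by rw [h]⟩
      · exact ⟨b, c.snd_mem_support_of_mem_edges he, by rw [h, Sym2.eq_swap]⟩
  have h4 : (c.support.toFinset.image (fun v => s(v, f v))).card ≤ c.support.toFinset.card :=
    Finset.card_image_le
  have h5 := Finset.eq_of_subset_of_card_le h3 (by omega)
  refine ⟨fun e => ?_, fun a ha b hb hab => ?_⟩
  · have := Finset.ext_iff.1 h5 e
    simpa using this
  · have h6 : Set.InjOn (fun v => s(v, f v)) (c.support.toFinset : Set V) := by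
      apply Finset.injOn_of_card_image_eq
      rw [← h5]; omega
    exact h6 (by simpa using ha) (by simpa using hb) hab

lemma support_subset_of_isCycle [Finite V] {f : V → V} (hf : Orients G Set.univ f) {u v w : V}
    {c : G.Walk u u} {c' : G.Walk v v} (hc : c.IsCycle) (hc' : c'.IsCycle)
    (hw : w ∈ c.support) (hw' : w ∈ c'.support) : ∀ x ∈ c.support, x ∈ c'.support := by
  classical
  obtain ⟨he, hi⟩ := mem_edges_iff_of_isCycle hf hc
  obtain ⟨he', -⟩ := mem_edges_iff_of_isCycle hf hc'
  have hcl : ∀ x ∈ c.support, f x ∈ c.support := fun x hx =>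
    c.snd_mem_support_of_mem_edges ((he _).2 ⟨x, hx, rfl⟩)
  have hcl' : ∀ x ∈ c'.support, f x ∈ c'.support := fun x hx =>
    c'.snd_mem_support_of_mem_edges ((he' _).2 ⟨x, hx, rfl⟩)
  have hinj : ∀ a ∈ c.support, ∀ b ∈ c.support, f a = f b → a = b := by
    intro a ha b hb hab
    by_contra hne
    have hm := hcl a ha
    have h2 := hc.ncard_neighborSet_toSubgraph_eq_two hm
    have e1 : s(a, f a) ∈ c.edges := (he _).2 ⟨a, ha, rfl⟩
    have e2 : s(b, f a) ∈ c.edges := (he _).2 ⟨b, hb, by rw [hab]⟩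
    have e3 : s(f a, f (f a)) ∈ c.edges := (he _).2 ⟨_, hm, rfl⟩
    have n1 : f (f a) ≠ a := fun h => c.adj_of_mem_edges e1 |>.ne <|
      hi a ha (f a) hm (by rw [h, Sym2.eq_swap])
    have n2 : f (f a) ≠ b := fun h => c.adj_of_mem_edges e2 |>.ne <|
      hi b hb (f a) hm (by rw [h, ← hab, Sym2.eq_swap])
    have hsub : ({a, b, f (f a)} : Set V) ⊆ c.toSubgraph.neighborSet (f a) := by
      rintro x (rfl | rfl | rfl)
      · simpa [Subgraph.mem_neighborSet, Walk.adj_toSubgraph_iff_mem_edges, Sym2.eq_swap] using e1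
      · simpa [Subgraph.mem_neighborSet, Walk.adj_toSubgraph_iff_mem_edges, Sym2.eq_swap] using e2
      · simpa [Subgraph.mem_neighborSet, Walk.adj_toSubgraph_iff_mem_edges] using e3
    have h3 := Set.ncard_le_ncard hsub (Set.toFinite _)
    rw [h2, Set.ncard_eq_toFinset_card'] at h3
    simp [hne, Ne.symm n1, Ne.symm n2] at h3
  intro x hx
  by_contra hx'
  obtain ⟨d, hd, hd1, hd2⟩ := ((c.rotate w hw).takeUntil x (by simpa using hx)).exists_boundary_dart
    {z | z ∈ c'.support} hw' hx'
  have hdc : d.edge ∈ c.edges := by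
    have h1 := Walk.darts_takeUntil_subset_darts _ _ hd
    have h2 := (c.rotate_darts w hw).mem_iff.1 h1
    exact List.mem_map_of_mem h2
  have hs1 : d.fst ∈ c.support := c.fst_mem_support_of_mem_edges hdc
  have hs2 : d.snd ∈ c.support := c.snd_mem_support_of_mem_edges hdc
  simp only [Set.mem_ofPred_eq] at hd1 hd2
  rcases hf _ trivial _ trivial d.adj with h | h
  · exact hd2 (h ▸ hcl' _ hd1)
  · let S : Set V := {z | z ∈ c.support ∧ z ∈ c'.support}
    have hm : Set.MapsTo f S S := fun z hz => ⟨hcl z hz.1, hcl' z hz.2⟩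
    have hin : Set.InjOn f S := fun a ha b hb hab => hinj a ha.1 b hb.1 hab
    have hsur : f '' S = S := Set.eq_of_subset_of_ncard_le hm.image_subset
      (by rw [hin.ncard_image]) (Set.toFinite S)
    obtain ⟨z, hz, hzf⟩ : d.fst ∈ f '' S := by rw [hsur]; exact ⟨hs1, hd1⟩
    exact hd2 (hinj z hz.1 _ hs2 (hzf.trans h.symm) ▸ hz.2)

lemma pseudoforest_of_orients [Finite V] {f : V → V} (hf : Orients G Set.univ f) :
    Pseudoforest G := by
  intro u v c c' hc hc' huv e
  obtain ⟨he, -⟩ := mem_edges_iff_of_isCycle hf hc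
  obtain ⟨he', -⟩ := mem_edges_iff_of_isCycle hf hc'
  have hcl : ∀ x ∈ c.support, f x ∈ c.support := fun x hx =>
    c.snd_mem_support_of_mem_edges ((he _).2 ⟨x, hx, rfl⟩)
  have hcl' : ∀ x ∈ c'.support, f x ∈ c'.support := fun x hx =>
    c'.snd_mem_support_of_mem_edges ((he' _).2 ⟨x, hx, rfl⟩)
  have hmeet : ∃ i j, f^[i] u = f^[j] v := by
    obtain ⟨p⟩ := huv
    clear hc hc' hcl hcl' he he'
    clear c c'
    induction p with
    | nil => exact ⟨0, 0, rfl⟩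
    | @cons a b d hab p ih =>
      obtain ⟨i, j, hij⟩ := ih
      rcases hf a trivial b trivial hab with h | h
      · exact ⟨i + 1, j, by rw [Function.iterate_succ_apply, h, hij]⟩
      · cases i with
        | zero => exact ⟨0, j + 1, by
            rw [Function.iterate_succ_apply', ← hij]; exact h.symm⟩
        | succ i => exact ⟨i, j, by rw [← hij, Function.iterate_succ_apply, h]⟩
  obtain ⟨i, j, hij⟩ := hmeet
  have hi : f^[i] u ∈ c.support := by
    clear hij
    induction i with
    | zero => exact c.start_mem_support
    | succ i ih => rw [Function.iterate_succ_apply']; exact hcl _ ih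
  have hj : f^[j] v ∈ c'.support := by
    clear hij
    induction j with
    | zero => exact c'.start_mem_support
    | succ i ih => rw [Function.iterate_succ_apply']; exact hcl' _ ih
  have s1 := support_subset_of_isCycle hf hc hc' hi (hij ▸ hj)
  have s2 := support_subset_of_isCycle hf hc' hc hj (hij ▸ hi)
  rw [he, he']
  exact ⟨fun ⟨x, hx, h⟩ => ⟨x, s1 x hx, h⟩, fun ⟨x, hx, h⟩ => ⟨x, s2 x hx, h⟩⟩

lemma exists_orients_of_pseudoforest (hG : Pseudoforest G) : Orientable G Set.univ := by
  classical
  have hth : ∀ K : G.ConnectedComponent, ∃ t h : V, G.connectedComponentMk t = K ∧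
      ∀ u (c : G.Walk u u), c.IsCycle → G.connectedComponentMk u = K → s(t, h) ∈ c.edges := by
    intro K
    by_cases hK : ∃ u, ∃ c : G.Walk u u, c.IsCycle ∧ G.connectedComponentMk u = K
    · obtain ⟨u, c, hc, hu⟩ := hK
      have hm : s(u, c.snd) ∈ c.edges := c.mk_start_snd_mem_edges hc.not_nil
      refine ⟨u, c.snd, hu, fun v c' hc' hv => ?_⟩
      exact (hG c c' hc hc' (ConnectedComponent.exact (hu.trans hv.symm)) _).1 hm
    · obtain ⟨u, hu⟩ := K.exists_rep
      exact ⟨u, u, hu, fun v c hc hv => absurd ⟨v, c, hc, hv⟩ hK⟩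
  choose t h ht hh using hth
  let G' := G.deleteEdges {e | ∃ K, e = s(t K, h K)}
  have hle : G' ≤ G := G.deleteEdges_le _
  have hac : G'.IsAcyclic := by
    intro u c hc
    have h1 := hh _ u (c.mapLe hle) ((Walk.isCycle_mapLe hle).2 hc) rfl
    rw [Walk.edges_mapLe_eq_edges] at h1
    have h2 := c.adj_of_mem_edges h1
    rw [deleteEdges_adj] at h2
    exact h2.2 ⟨_, rfl⟩
  let κ := G.connectedComponentMk
  let r : V → V := fun v =>
    if G'.Reachable v (t (κ v)) then t (κ v) else (G'.connectedComponentMk v).out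
  have hr : ∀ v, G'.Reachable v (r v) := by
    intro v
    by_cases hv : G'.Reachable v (t (κ v))
    · simp only [r, if_pos hv]; exact hv
    · simp only [r, if_neg hv]
      exact (ConnectedComponent.exact (Quot.out_eq _)).symm
  have hrr : ∀ a b, G'.Adj a b → r a = r b := by
    intro a b hab
    have e1 : κ a = κ b := ConnectedComponent.sound (hle hab).reachable
    have e2 : G'.connectedComponentMk a = G'.connectedComponentMk b :=
      ConnectedComponent.sound hab.reachable
    have e3 : G'.Reachable a (t (κ b)) ↔ G'.Reachable b (t (κ b)) :=
      ⟨fun h => hab.reachable.symm.trans h, fun h => hab.reachable.trans h⟩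
    simp only [r, e1, e2, e3]
  have hp : ∀ v, ∃ p : G'.Walk v (r v), p.IsPath := fun v => (hr v).exists_isPath
  choose p hp using hp
  refine ⟨fun v => if v = r v then h (κ v) else (p v).snd, fun a _ b _ hab => ?_⟩
  by_cases hab' : G'.Adj a b
  · have key : ∀ a b, G'.Adj a b → b ∈ (p a).support →
        (if a = r a then h (κ a) else (p a).snd) = b := by
      intro a b hab hb
      have hne : a ≠ r a := by
        intro hra
        have : ∀ x (w : G'.Walk a x), w.IsPath → a = x → b ∈ w.support → False := by
          rintro x w hw rfl hb
          rw [(Walk.isPath_iff_nil.1 hw).eq_nil] at hb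
          simp at hb
          exact hab.ne hb.symm
        exact this _ _ (hp a) hra hb
      rw [if_neg hne]
      exact (hac.eq_snd_of_adj_start (hp a) hab hb).symm
    by_cases hb : b ∈ (p a).support
    · exact Or.inl (key a b hab' hb)
    · refine Or.inr (key b a hab'.symm ?_)
      simpa using hac.mem_support_of_ne_mem_support_of_adj_of_isPath (hp b).reverse
        ((Walk.isPath_copy _ rfl (hrr a b hab')).2 (hp a)).reverse hab'.symm (by simpa using hb)
  · have : ∃ K, s(a, b) = s(t K, h K) := by
      by_contra hc
      exact hab' ((deleteEdges_adj ..).2 ⟨hab, hc⟩)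
    obtain ⟨K, hK⟩ := this
    have hrt : r (t K) = t K := by
      simp only [r, κ, ht]
      rw [if_pos (Reachable.refl _)]
    have hft : (if t K = r (t K) then h (κ (t K)) else (p (t K)).snd) = h K := by
      rw [if_pos hrt.symm]; simp only [κ, ht]
    rcases Sym2.eq_iff.1 hK with ⟨rfl, rfl⟩ | ⟨rfl, rfl⟩
    · exact Or.inl hft
    · exact Or.inr hft

end Pseudoforest


section Orientations

variable {V : Type} {G : SimpleGraph V} {S : Set V}

lemma Orients.mono {T : Set V} {f : V → V} (h : Orients G T f) (hST : S ⊆ T) : Orients G S f :=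
  fun a ha b hb => h a (hST ha) b (hST hb)

lemma Orientable.mono {T : Set V} (h : Orientable G T) (hST : S ⊆ T) : Orientable G S :=
  let ⟨f, hf⟩ := h; ⟨f, hf.mono hST⟩

lemma orientable_induce_univ : Orientable (G.induce S) Set.univ ↔ Orientable G S := by
  classical
  constructor
  · rintro ⟨f, hf⟩
    refine ⟨fun a => if h : a ∈ S then f ⟨a, h⟩ else a, fun a ha b hb hab => ?_⟩
    rcases hf ⟨a, ha⟩ trivial ⟨b, hb⟩ trivial hab with h | h
    · left; simp [ha, h]
    · right; simp [hb, h]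
  · rintro ⟨f, hf⟩
    refine ⟨fun a => if h : f a ∈ S then ⟨f a, h⟩ else a, fun a _ b _ hab => ?_⟩
    rcases hf a a.2 b b.2 hab with h | h
    · left; simp [h]
    · right; simp [h]

lemma pseudoforest_induce_iff [Finite V] : Pseudoforest (G.induce S) ↔ Orientable G S := by
  rw [← orientable_induce_univ]
  exact ⟨exists_orients_of_pseudoforest, fun ⟨_, h⟩ => pseudoforest_of_orients h⟩

lemma apexPseudoforest_iff [Finite V] [Nonempty V] :
    ApexPseudoforest G ↔ ∃ y, Orientable G {y}ᶜ := by
  simp only [ApexPseudoforest, pseudoforest_induce_iff]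
  constructor
  · rintro ⟨s, hs, h⟩
    rcases hs.eq_empty_or_singleton with rfl | ⟨y, rfl⟩
    · exact ⟨Classical.arbitrary V, h.mono (by simp)⟩
    · exact ⟨y, h⟩
  · rintro ⟨y, h⟩
    exact ⟨{y}, Set.subsingleton_singleton, h⟩

end Orientations

section Certificates

lemma not_orients_of_overfull {n : ℕ} {E : List (ℕ × ℕ)} {S : List ℕ} {f : Fin n → Fin n}
    (hn : ∀ p ∈ E, p.1 < n ∧ p.2 < n ∧ p.1 ≠ p.2)
    (h : S.length < ((E.filter fun p => p.1 ∈ S ∧ p.2 ∈ S).map fun p => s(p.1, p.2)).dedup.length) :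
    ¬ Orients (mkGraph n E) {v | (v : ℕ) ∈ S} f := by
  intro hf
  rw [← List.card_toFinset] at h
  refine (h.trans_le' (List.toFinset_card_le S)).not_ge ?_
  let g : ℕ → Sym2 ℕ := fun v => s(v, if h : v < n then f ⟨v, h⟩ else 0)
  refine (Finset.card_le_card (t := S.toFinset.image g) ?_).trans Finset.card_image_le
  intro e he
  simp only [List.mem_toFinset, List.mem_map, List.mem_filter, decide_eq_true_eq] at he
  obtain ⟨p, ⟨hpE, h1, h2⟩, rfl⟩ := he
  obtain ⟨b1, b2, b3⟩ := hn p hpE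
  have hadj : (mkGraph n E).Adj ⟨p.1, b1⟩ ⟨p.2, b2⟩ := by
    rw [mkGraph, fromRel_adj]
    exact ⟨by simpa using b3, Or.inl hpE⟩
  simp only [Finset.mem_image, List.mem_toFinset]
  rcases hf _ h1 _ h2 hadj with h | h
  · exact ⟨p.1, h1, by simp [g, b1, h]⟩
  · exact ⟨p.2, h2, by simp only [g, b2, dif_pos, h]; exact Sym2.eq_swap⟩

lemma not_apexPseudoforest_mkGraph {n : ℕ} [NeZero n] {E : List (ℕ × ℕ)} (C : List (List ℕ))
    (hn : ∀ p ∈ E, p.1 < n ∧ p.2 < n ∧ p.1 ≠ p.2)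
    (h : ∀ S ∈ C, S.length <
      ((E.filter fun p => p.1 ∈ S ∧ p.2 ∈ S).map fun p => s(p.1, p.2)).dedup.length)
    (hC : ∀ y < n, ∃ S ∈ C, y ∉ S) :
    ¬ ApexPseudoforest (mkGraph n E) := by
  rw [apexPseudoforest_iff]
  rintro ⟨y, f, hf⟩
  obtain ⟨S, hS, hy⟩ := hC y y.2
  exact not_orients_of_overfull hn (h S hS)
    (hf.mono fun v hv => by rintro rfl; exact hy hv)

lemma not_apexPseudoforest_O1 : ¬ ApexPseudoforest O1 :=
  not_apexPseudoforest_mkGraph [[0, 1, 2, 3], [4, 5, 6, 7]] (by decide) (by decide) (by decide)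

lemma not_apexPseudoforest_O2 : ¬ ApexPseudoforest O2 :=
  not_apexPseudoforest_mkGraph [[0, 1, 2, 3, 4], [5, 6, 7, 8, 9]] (by decide) (by decide) (by decide)

lemma not_apexPseudoforest_O3 : ¬ ApexPseudoforest O3 :=
  not_apexPseudoforest_mkGraph [[0, 1, 2, 3], [4, 5, 6, 7, 8]] (by decide) (by decide) (by decide)

lemma not_apexPseudoforest_O4 : ¬ ApexPseudoforest O4 :=
  not_apexPseudoforest_mkGraph [[0, 1, 2, 3, 4], [0, 1, 2, 3, 5, 6, 7], [0, 1, 2, 4, 5, 6, 7], [3, 4, 5, 6, 7]] (by decide) (by decide) (by decide)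

lemma not_apexPseudoforest_O5 : ¬ ApexPseudoforest O5 :=
  not_apexPseudoforest_mkGraph [[0, 1, 2, 3, 4], [0, 1, 2, 3, 5, 6, 7], [0, 1, 2, 4, 5, 6, 7], [3, 4, 5, 6, 7]] (by decide) (by decide) (by decide)

lemma not_apexPseudoforest_O6 : ¬ ApexPseudoforest O6 :=
  not_apexPseudoforest_mkGraph [[0, 1, 2, 3, 4], [0, 1, 2, 3, 5, 6], [3, 4, 5, 6], [0, 1, 2, 4, 5, 7]] (by decide) (by decide) (by decide)

lemma not_apexPseudoforest_O7 : ¬ ApexPseudoforest O7 :=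
  not_apexPseudoforest_mkGraph [[2, 3, 4, 5], [0, 1, 2, 3, 4, 6], [0, 1, 2, 3, 5, 6], [0, 1, 2, 4, 5, 6], [0, 1, 3, 4, 5, 6]] (by decide) (by decide) (by decide)

lemma not_apexPseudoforest_O8 : ¬ ApexPseudoforest O8 :=
  not_apexPseudoforest_mkGraph [[0, 1, 2, 3, 4], [0, 1, 2, 3, 5], [0, 1, 2, 4, 5], [3, 4, 5, 6]] (by decide) (by decide) (by decide)

lemma not_apexPseudoforest_O9 : ¬ ApexPseudoforest O9 :=
  not_apexPseudoforest_mkGraph [[0, 1, 2, 4, 6], [0, 1, 2, 3, 7], [3, 4, 5, 8]] (by decide) (by decide) (by decide)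

lemma not_apexPseudoforest_O10 : ¬ ApexPseudoforest O10 :=
  not_apexPseudoforest_mkGraph [[1, 2, 3, 5, 6], [0, 1, 4, 7, 8], [0, 2, 3, 6, 7, 8]] (by decide) (by decide) (by decide)

lemma not_apexPseudoforest_O11 : ¬ ApexPseudoforest O11 :=
  not_apexPseudoforest_mkGraph [[0, 1, 2, 3, 4, 5], [0, 1, 2, 6, 7, 8], [3, 4, 5, 6, 7, 8]] (by decide) (by decide) (by decide)

lemma not_apexPseudoforest_O12 : ¬ ApexPseudoforest O12 :=
  not_apexPseudoforest_mkGraph [[0, 1, 2, 3, 4, 5], [0, 1, 2, 6, 7, 8], [3, 4, 5, 6, 7, 8]] (by decide) (by decide) (by decide)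

lemma not_apexPseudoforest_O13 : ¬ ApexPseudoforest O13 :=
  not_apexPseudoforest_mkGraph [[0, 1, 2, 3, 4, 5], [0, 1, 2, 6, 7, 8], [3, 4, 5, 6, 7, 8]] (by decide) (by decide) (by decide)

lemma not_apexPseudoforest_O14 : ¬ ApexPseudoforest O14 :=
  not_apexPseudoforest_mkGraph [[2, 3, 4, 5], [0, 1, 2, 6, 7], [1, 3, 4, 5, 6, 7]] (by decide) (by decide) (by decide)

lemma not_apexPseudoforest_O15 : ¬ ApexPseudoforest O15 :=
  not_apexPseudoforest_mkGraph [[0, 1, 2, 3, 4], [0, 1, 2, 6, 7, 8], [4, 5, 6, 7, 8]] (by decide) (by decide) (by decide)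

end Certificates

section Minors

variable {U V W : Type}

lemma connected_induce_iff_reachable {G : SimpleGraph V} {S : Set V} : (G.induce S).Connected ↔
    S.Nonempty ∧ ∀ a (ha : a ∈ S) b (hb : b ∈ S), (G.induce S).Reachable ⟨a, ha⟩ ⟨b, hb⟩ := by
  rw [connected_iff, Set.nonempty_coe_sort, and_comm]
  exact and_congr_right fun _ => ⟨fun h a ha b hb => h _ _, fun h a b => h a a.2 b b.2⟩

lemma IsMinorOf.trans {H : SimpleGraph U} {K : SimpleGraph W} {G : SimpleGraph V}
    (h1 : IsMinorOf H K) (h2 : IsMinorOf K G) : IsMinorOf H G := by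
  obtain ⟨f, f1, f2, f3⟩ := h1
  obtain ⟨g, g1, g2, g3⟩ := h2
  have hmono : ∀ u, ∀ w ∈ f u, g w ⊆ ⋃ w ∈ f u, g w := fun u w hw =>
    Set.subset_biUnion_of_mem hw
  refine ⟨fun u => ⋃ w ∈ f u, g w, fun u => ?_, fun u u' huu => ?_, fun u u' huu => ?_⟩
  · have h1 := (connected_induce_iff_reachable.1 (f1 u))
    have hin : ∀ w (hw : w ∈ f u) a (ha : a ∈ g w) b (hb : b ∈ g w),
        (G.induce (⋃ w ∈ f u, g w)).Reachable ⟨a, hmono u w hw ha⟩ ⟨b, hmono u w hw hb⟩ :=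
      fun w hw a ha b hb => ((connected_induce_iff_reachable.1 (g1 w)).2 a ha b hb).map
        (induceHomOfLE G (hmono u w hw)).toHom
    rw [connected_induce_iff_reachable]
    constructor
    · obtain ⟨w, hw⟩ := h1.1
      obtain ⟨a, ha⟩ := (connected_induce_iff_reachable.1 (g1 w)).1
      exact ⟨a, hmono u w hw ha⟩
    · have key : ∀ x y : f u, (K.induce (f u)).Walk x y → ∀ a (ha : a ∈ g x) b (hb : b ∈ g y),
          (G.induce (⋃ w ∈ f u, g w)).Reachable ⟨a, hmono u x x.2 ha⟩ ⟨b, hmono u y y.2 hb⟩ := by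
        intro x y p
        induction p with
        | nil => exact fun a ha b hb => hin _ (Subtype.coe_prop _) a ha b hb
        | @cons x z y hxz _ ih =>
          intro a ha b hb
          obtain ⟨s, hs, t, ht, hst⟩ := g3 hxz
          have h3 : (G.induce (⋃ w ∈ f u, g w)).Adj ⟨s, hmono u x x.2 hs⟩
            ⟨t, hmono u z z.2 ht⟩ := hst
          exact ((hin x x.2 a ha s hs).trans h3.reachable).trans (ih t ht b hb)
      intro a ha b hb
      obtain ⟨x, hx, hax⟩ := Set.mem_iUnion₂.1 ha
      obtain ⟨y, hy, hby⟩ := Set.mem_iUnion₂.1 hb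
      obtain ⟨p⟩ := h1.2 x hx y hy
      exact key _ _ p a hax b hby
  · simp only [Set.disjoint_iUnion_left, Set.disjoint_iUnion_right]
    intro w hw w' hw'
    refine g2 ?_
    rintro rfl
    exact Set.disjoint_left.1 (f2 huu) hw' hw
  · obtain ⟨w, hw, w', hw', hww⟩ := f3 huu
    obtain ⟨a, ha, b, hb, hab⟩ := g3 hww
    exact ⟨a, hmono _ _ hw ha, b, hmono _ _ hw' hb, hab⟩

lemma connected_induce_singleton (G : SimpleGraph V) (v : V) : (G.induce {v}).Connected := by
  rw [connected_induce_iff_reachable]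
  exact ⟨⟨v, rfl⟩, by rintro a rfl b rfl; rfl⟩

lemma connected_induce_pair {G : SimpleGraph V} {u v : V} (h : G.Adj u v) :
    (G.induce {u, v}).Connected := by
  rw [connected_induce_iff_reachable]
  have h1 : (G.induce {u, v}).Adj ⟨u, by simp⟩ ⟨v, by simp⟩ := h
  refine ⟨⟨u, by simp⟩, ?_⟩
  rintro a (rfl | rfl) b (rfl | rfl)
  · rfl
  · exact h1.reachable
  · exact h1.symm.reachable
  · rfl

lemma IsMinorOf.of_injective {H : SimpleGraph W} {G : SimpleGraph V} (f : W → V)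
    (hf : Function.Injective f) (h : ∀ a b, H.Adj a b → G.Adj (f a) (f b)) : IsMinorOf H G :=
  ⟨fun w => {f w}, fun _ => connected_induce_singleton G _,
    fun w w' hww => by simpa using hf.ne hww, fun w w' hww => ⟨_, rfl, _, rfl, h _ _ hww⟩⟩

/-- The graph obtained from `G` by contracting the pair `u`, `v` to the vertex `u`. -/
def contract (G : SimpleGraph V) (u v : V) : SimpleGraph {w // w ≠ v} where
  Adj a b := a ≠ b ∧ (G.Adj a b ∨ (a : V) = u ∧ G.Adj v b ∨ (b : V) = u ∧ G.Adj v a)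
  symm := ⟨fun a b h => ⟨h.1.symm, by
    rcases h.2 with h | h | h
    · exact Or.inl h.symm
    · exact Or.inr (Or.inr h)
    · exact Or.inr (Or.inl h)⟩⟩
  loopless := ⟨fun _ h => h.1 rfl⟩

lemma isMinorOf_contract {G : SimpleGraph V} {u v : V} (h : G.Adj u v) :
    IsMinorOf (contract G u v) G := by
  classical
  have hcongr : ∀ S T : Set V, S = T → (G.induce T).Connected → (G.induce S).Connected := by
    rintro S _ rfl h
    exact h
  refine ⟨fun w => if (w : V) = u then {u, v} else {(w : V)}, fun w => ?_, fun w w' hww => ?_,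
    fun w w' hww => ?_⟩
  · by_cases hw : (w : V) = u
    · exact hcongr _ _ (if_pos hw) (connected_induce_pair h)
    · exact hcongr _ _ (if_neg hw) (connected_induce_singleton G _)
  · have h0 : (w : V) ≠ w' := fun hh => hww (Subtype.ext hh)
    have := w.2
    have := w'.2
    dsimp only
    split_ifs with h1 h2 h2
    · exact absurd (h1.trans h2.symm) h0
    · rw [Set.disjoint_singleton_right]
      simp [h2, w'.2]
    · rw [Set.disjoint_singleton_left]
      simp [h1, w.2]
    · simpa using h0
  · have hself : ∀ z : {w // w ≠ v}, (z : V) ∈ (if (z : V) = u then {u, v} else {(z : V)} : Set V) := by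
      intro z
      split_ifs with hz
      · simp [hz]
      · rfl
    rcases hww.2 with h1 | ⟨h1, h2⟩ | ⟨h1, h2⟩
    · exact ⟨_, hself w, _, hself w', h1⟩
    · exact ⟨v, by simp [h1], _, hself w', h2⟩
    · exact ⟨_, hself w, v, by simp [h1], h2.symm⟩

end Minors

/-- The properties of obstructions for apex-pseudoforests that are used in the structural
analysis; pseudoforests are described by orientations with out-degree at most one. -/
structure Critical {V : Type} (G : SimpleGraph V) : Prop where
  not_orientable : ∀ y, ¬ Orientable G {y}ᶜ
  of_lt : ∀ G' < G, ∃ y, Orientable G' {y}ᶜ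
  delete_vertex : ∀ v, ∃ y ≠ v, Orientable G {y, v}ᶜ
  contract_edge : ∀ u v, G.Adj u v → ∃ y ≠ v, ∃ f : V → V, ∀ a b, a ≠ v → a ≠ y → b ≠ v → b ≠ y →
    a ≠ b → (G.Adj a b ∨ a = u ∧ G.Adj v b ∨ b = u ∧ G.Adj v a) → f a = b ∨ f b = a
  not_minor : ∀ H ∈ OList.take 15, ¬ IsMinorOf H.2 G

section Critical

variable {V : Type} {G : SimpleGraph V}

lemma nonempty_of_not_apexPseudoforest (h : ¬ ApexPseudoforest G) : Nonempty V := by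
  by_contra hV
  rw [not_nonempty_iff] at hV
  exact h ⟨∅, Set.subsingleton_empty, fun u => (hV.false u.1).elim⟩

lemma isEmpty_iso_of_lt [Finite V] {G' : SimpleGraph V} (h : G' < G) : IsEmpty (G' ≃g G) := by
  classical
  have := Fintype.ofFinite V
  refine ⟨fun e => ?_⟩
  have h1 := e.card_edgeFinset_eq
  have h2 : G'.edgeFinset ⊂ G.edgeFinset := edgeFinset_ssubset_edgeFinset.2 h
  exact (Finset.card_lt_card h2).ne h1

lemma isEmpty_iso_of_ne [Finite V] {v : V} (H : SimpleGraph {w // w ≠ v}) : IsEmpty (H ≃g G) := by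
  refine ⟨fun e => ?_⟩
  obtain ⟨w, hw⟩ := ((Finite.injective_iff_surjective_of_equiv e.toEquiv).1
    (Subtype.val_injective : Function.Injective (Subtype.val : {w // w ≠ v} → V))) v
  exact w.2 hw

lemma exists_orients_of_subtype {v : V} {H : SimpleGraph {w // w ≠ v}} {y : {w // w ≠ v}}
    (h : Orientable H {y}ᶜ) : ∃ f : V → V, ∀ a b : {w // w ≠ v}, (a : V) ≠ y → (b : V) ≠ y →
      H.Adj a b → f a = b ∨ f b = a := by
  classical
  obtain ⟨f, hf⟩ := h
  refine ⟨fun a => if h : a ≠ v then f ⟨a, h⟩ else a, fun a b ha hb hab => ?_⟩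
  rcases hf a (by simpa [Subtype.ext_iff] using ha) b (by simpa [Subtype.ext_iff] using hb) hab
    with h | h
  · left; simp [a.2, h]
  · right; simp [b.2, h]

lemma ObsApexPseudoforest.critical [Finite V] (h1 : ObsApexPseudoforest G) (h2 : ¬ InO G) :
    Critical G := by
  have hne := nonempty_of_not_apexPseudoforest h1.1
  have hno : ∀ y, ¬ Orientable G {y}ᶜ := fun y hy => h1.1 (apexPseudoforest_iff.2 ⟨y, hy⟩)
  refine ⟨hno, fun G' hG' => ?_, fun v => ?_, fun u v huv => ?_, ?_⟩
  · exact apexPseudoforest_iff.1 (h1.2 V G' (IsMinorOf.of_injective id Function.injective_id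
      fun a b hab => hG'.le hab) (isEmpty_iso_of_lt hG'))
  · have hne' : Nonempty {w // w ≠ v} := by
      by_contra hcon
      refine hno v ⟨id, fun a ha => ?_⟩
      exact (hcon ⟨a, ha⟩).elim
    obtain ⟨y, hy⟩ := apexPseudoforest_iff.1 (h1.2 {w // w ≠ v} (G.induce {w | w ≠ v})
      (IsMinorOf.of_injective _ Subtype.val_injective fun a b hab => hab) (isEmpty_iso_of_ne _))
    obtain ⟨f, hf⟩ := exists_orients_of_subtype hy
    refine ⟨y, y.2, f, fun a ha b hb hab => ?_⟩
    simp only [Set.mem_compl_iff, Set.mem_insert_iff, Set.mem_singleton_iff, not_or] at ha hb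
    exact hf ⟨a, ha.2⟩ ⟨b, hb.2⟩ ha.1 hb.1 hab
  · have hne' : Nonempty {w // w ≠ v} := ⟨⟨u, huv.ne⟩⟩
    obtain ⟨y, hy⟩ := apexPseudoforest_iff.1 (h1.2 {w // w ≠ v} _
      (isMinorOf_contract huv) (isEmpty_iso_of_ne _))
    obtain ⟨f, hf⟩ := exists_orients_of_subtype hy
    refine ⟨y, y.2, f, fun a b ha hay hb hby hne hab => ?_⟩
    exact hf ⟨a, ha⟩ ⟨b, hb⟩ hay hby ⟨by simpa using hne, hab⟩
  · have key : ∀ H ∈ OList, ¬ ApexPseudoforest H.2 → ¬ IsMinorOf H.2 G := by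
      intro H hH hna hm
      have h3 := h1.2 (Fin H.1) H.2 hm
      rw [imp_iff_not hna, not_isEmpty_iff] at h3
      obtain ⟨e⟩ := h3
      exact h2 ⟨H, hH, ⟨e.symm⟩⟩
    have hall : ∀ H ∈ OList.take 15, ¬ ApexPseudoforest H.2 := by
      simp only [OList, List.take, List.forall_mem_cons]
      exact ⟨not_apexPseudoforest_O1, not_apexPseudoforest_O2, not_apexPseudoforest_O3,
        not_apexPseudoforest_O4, not_apexPseudoforest_O5, not_apexPseudoforest_O6,
        not_apexPseudoforest_O7, not_apexPseudoforest_O8, not_apexPseudoforest_O9,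
        not_apexPseudoforest_O10, not_apexPseudoforest_O11, not_apexPseudoforest_O12,
        not_apexPseudoforest_O13, not_apexPseudoforest_O14, not_apexPseudoforest_O15, by simp⟩
    exact fun H hH => key H (List.mem_of_mem_take hH) (hall H hH)

end Critical

section Orientations

variable {V : Type} {G : SimpleGraph V} {S : Set V}

lemma orientable_of_contract {u v : V} (huv : G.Adj u v) (hcom : ∀ w, G.Adj u w → ¬ G.Adj v w)
    (hu : u ∈ S) {f : V → V}
    (hf : ∀ a ∈ S, ∀ b ∈ S, a ≠ v → b ≠ v → a ≠ b →
      (G.Adj a b ∨ a = u ∧ G.Adj v b ∨ b = u ∧ G.Adj v a) → f a = b ∨ f b = a) :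
    Orientable G S := by
  classical
  let g : V → V := fun a =>
    if a = u then (if G.Adj v (f u) then v else f u)
    else if a = v then (if G.Adj v (f u) then f u else u)
    else if f a = u ∧ G.Adj a v then v else f a
  have hvu : v ≠ u := huv.ne'
  have h1 : ∀ b ∈ S, G.Adj u b → g u = b ∨ g b = u := by
    intro b hb hub
    by_cases hbv : b = v
    · subst hbv
      by_cases hh : G.Adj b (f u)
      · left; simp [g, hh]
      · right; simp [g, hh, hvu]
    · have hbn := hcom b hub
      rcases hf u hu b hb huv.ne hbv hub.ne (Or.inl hub) with h | h
      · left; simp [g, h, hbn]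
      · right; simp [g, hub.ne', hbv, h, G.adj_comm b v, hbn]
  have h2 : ∀ b ∈ S, G.Adj v b → g v = b ∨ g b = v := by
    intro b hb hvb
    by_cases hbu : b = u
    · subst hbu
      by_cases hh : G.Adj v (f b)
      · right; simp [g, hh]
      · left; simp [g, hh, hvu]
    · rcases hf u hu b hb huv.ne hvb.ne' (Ne.symm hbu) (Or.inr (Or.inl ⟨rfl, hvb⟩)) with h | h
      · left; simp [g, h, hvb, hvu]
      · right; simp [g, hbu, hvb.ne', h, hvb.symm]
  refine ⟨g, fun a ha b hb hab => ?_⟩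
  by_cases hau : a = u
  · subst hau; exact h1 b hb hab
  by_cases hbu : b = u
  · subst hbu; exact (h1 a ha hab.symm).symm
  by_cases hav : a = v
  · subst hav; exact h2 b hb hab
  by_cases hbv : b = v
  · subst hbv; exact (h2 a ha hab.symm).symm
  rcases hf a ha b hb hav hbv hab.ne (Or.inl hab) with h | h
  · left; simp [g, hau, hav, h, hbu]
  · right; simp [g, hbu, hbv, h, hau]

lemma Orientable.insert_leaf (h : Orientable G S) {v w : V} (hv : ∀ b ∈ S, G.Adj v b → b = w) :
    Orientable G (insert v S) := by
  classical
  obtain ⟨f, hf⟩ := h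
  by_cases hvS : v ∈ S
  · exact ⟨f, by rwa [Set.insert_eq_of_mem hvS]⟩
  have hne : ∀ a ∈ S, a ≠ v := by rintro a ha rfl; exact hvS ha
  refine ⟨Function.update f v w, ?_⟩
  rintro a (rfl | ha) b (rfl | hb) hab
  · exact (hab.ne rfl).elim
  · left; simp [hv b hb hab]
  · right; simp [hv a ha hab.symm]
  · simpa [hne a ha, hne b hb] using hf a ha b hb hab

/-- The out-arc of `v` is not needed by the orientation `f` of `S`. -/
def Dead (G : SimpleGraph V) (S : Set V) (f : V → V) (v : V) : Prop :=
  (v ∈ S → f v ∈ S → G.Adj v (f v) → f (f v) = v)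

lemma Orients.exists_fixed {f : V → V} (hf : Orients G S f) (n : ℕ) :
    ∀ c, Dead G S f (f^[n] c) → ∃ g, Orients G S g ∧ g c = c := by
  classical
  induction n with
  | zero =>
    intro c hc
    refine ⟨Function.update f c c, fun a ha b hb hab => ?_, by simp⟩
    by_cases hac : a = c
    · subst hac
      have hba : b ≠ a := hab.ne'
      right
      rw [Function.update_of_ne hba]
      rcases hf a ha b hb hab with h | h
      · subst h; exact hc ha hb hab
      · exact h
    · by_cases hbc : b = c
      · subst hbc
        left
        rw [Function.update_of_ne hac]
        rcases hf a ha b hb hab with h | h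
        · exact h
        · subst h; exact hc hb ha hab.symm
      · simpa [hac, hbc] using hf a ha b hb hab
  | succ n ih =>
    intro c hc
    by_cases hcl : c ∈ S ∧ f c ∈ S ∧ G.Adj c (f c)
    · obtain ⟨h1, h2, h3⟩ := hcl
      obtain ⟨g, hg, hgf⟩ := ih (f c) (by simpa using hc)
      have hgc : g c = f c := by
        rcases hg c h1 _ h2 h3 with h | h
        · exact h
        · exact (h3.ne (h.symm.trans hgf)).elim
      refine ⟨Function.update (Function.update g (f c) c) c c, fun a ha b hb hab => ?_, by simp⟩
      by_cases hac : a = c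
      · subst hac
        right
        rw [Function.update_of_ne hab.ne']
        by_cases hb' : b = f a
        · subst hb'; simp
        · rw [Function.update_of_ne hb']
          exact (hg a ha b hb hab).resolve_left fun h => hb' (h.symm.trans hgc)
      · by_cases hbc : b = c
        · subst hbc
          left
          rw [Function.update_of_ne hac]
          by_cases ha' : a = f b
          · subst ha'; simp
          · rw [Function.update_of_ne ha']
            exact (hg a ha b hb hab).resolve_right fun h => ha' (h.symm.trans hgc)
        · rw [Function.update_of_ne hac, Function.update_of_ne hbc]
          have hfix : ∀ a ∈ S, ∀ b ∈ S, G.Adj a b → g a = b → a ≠ f c := by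
            rintro a ha b hb hab h rfl
            exact hab.ne (hgf.symm.trans h)
          rcases hg a ha b hb hab with h | h
          · left; rw [Function.update_of_ne (hfix a ha b hb hab h), h]
          · right; rw [Function.update_of_ne (hfix b hb a ha hab.symm h), h]
    · refine ⟨Function.update f c c, fun a ha b hb hab => ?_, by simp⟩
      by_cases hac : a = c
      · subst hac
        right
        rw [Function.update_of_ne hab.ne']
        refine (hf a ha b hb hab).resolve_left ?_
        rintro rfl
        exact hcl ⟨ha, hb, hab⟩
      · by_cases hbc : b = c
        · subst hbc
          left
          rw [Function.update_of_ne hac]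
          refine (hf a ha b hb hab).resolve_right ?_
          rintro rfl
          exact hcl ⟨hb, ha, hab.symm⟩
        · simpa [hac, hbc] using hf a ha b hb hab

end Orientations

section DiamondButterfly

instance {n : ℕ} {E : List (ℕ × ℕ)} : DecidableRel (mkGraph n E).Adj := by
  unfold mkGraph; infer_instance

/-- The diamond. -/
abbrev diamond : SimpleGraph (Fin 4) := mkGraph 4 [(0,1),(0,2),(0,3),(1,2),(1,3)]

/-- The butterfly. -/
abbrev butterfly : SimpleGraph (Fin 5) := mkGraph 5 [(0,1),(0,2),(1,2),(0,3),(0,4),(3,4)]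

lemma orientable_univ_of_triangle {V : Type} {G : SimpleGraph V} {a b c : V}
    (ha : ∀ d, G.Adj a d → d = b ∨ d = c) (hb : ∀ d, G.Adj b d → d = a ∨ d = c)
    (hc : ∀ d, G.Adj c d → d = a ∨ d = b) (h : Orientable G {a, b, c}ᶜ) :
    Orientable G Set.univ := by
  classical
  obtain ⟨f, hf⟩ := h
  refine ⟨fun x => if x = a then b else if x = b then c else if x = c then a else f x,
    fun x _ y _ hxy => ?_⟩
  have := hf x
  have := hf y
  simp only [Set.mem_compl_iff, Set.mem_insert_iff, Set.mem_singleton_iff] at *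
  have := hxy.symm
  have := hxy.ne
  grind

theorem diamond_or_butterfly_of_not_orientable (n : ℕ) : ∀ (V : Type) [Finite V]
    (G : SimpleGraph V), Nat.card V ≤ n → ¬ Orientable G Set.univ →
      IsMinorOf diamond G ∨ IsMinorOf butterfly G := by
  induction n with
  | zero =>
    intro V _ G hV hG
    have : IsEmpty V := by
      rcases Nat.card_eq_zero.1 (Nat.le_zero.1 hV) with h | h
      · exact h
      · exact absurd ‹Finite V› (not_finite_iff_infinite.2 h)
    exact (hG ⟨id, fun a => this.elim a⟩).elim
  | succ n ih =>
    intro V _ G hV hG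
    have hcard : ∀ T : Set V, T ≠ Set.univ → Nat.card T ≤ n := by
      intro T hT
      have := Set.ncard_lt_card hT
      rw [Nat.card_coe_set_eq]
      omega
    have hedge : ∀ u v, G.Adj u v → (∀ w, G.Adj u w → ¬ G.Adj v w) →
        IsMinorOf diamond G ∨ IsMinorOf butterfly G := by
      intro u v huv hcom
      have h1 : ¬ Orientable (contract G u v) Set.univ := by
        rintro ⟨f, hf⟩
        classical
        refine hG (orientable_of_contract huv hcom (Set.mem_univ u)
          (f := fun a => if h : a ≠ v then f ⟨a, h⟩ else a) ?_)
        intro a _ b _ ha hb hab h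
        rcases hf ⟨a, ha⟩ trivial ⟨b, hb⟩ trivial ⟨by simpa using hab, h⟩ with h | h
        · left; simp [ha, h]
        · right; simp [hb, h]
      have h2 := ih {w // w ≠ v} (contract G u v)
        (hcard {w | w ≠ v} fun h => (h ▸ Set.mem_univ v : v ∈ {w | w ≠ v}) rfl) h1
      exact h2.imp (·.trans (isMinorOf_contract huv)) (·.trans (isMinorOf_contract huv))
    by_contra hcon
    have htri : ∀ u v, G.Adj u v → ∃ w, G.Adj u w ∧ G.Adj v w := by
      intro u v huv
      by_contra! hc
      exact hcon (hedge u v huv hc)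
    have hout : ∀ a b c d, G.Adj a b → G.Adj a c → G.Adj b c → G.Adj a d → d = b ∨ d = c := by
      intro a b c d hab hac hbc had
      by_contra! hd
      obtain ⟨e, hae, hde⟩ := htri a d had
      apply hcon
      by_cases heb : e = b
      · subst heb
        left
        refine IsMinorOf.of_injective ![a, e, c, d] ?_ ?_
        · have := hab.ne; have := hac.ne; have := hbc.ne; have := had.ne
          simp [Fin.forall_fin_succ, Function.Injective]
          grind
        · have := hde.symm
          have := hbc.symm
          simp [Fin.forall_fin_succ, diamond, mkGraph, *, adj_comm]
      by_cases hec : e = c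
      · subst hec
        left
        refine IsMinorOf.of_injective ![a, e, b, d] ?_ ?_
        · have := hab.ne; have := hac.ne; have := hbc.ne; have := had.ne
          simp [Fin.forall_fin_succ, Function.Injective]
          grind
        · have := hde.symm
          simp [Fin.forall_fin_succ, diamond, mkGraph, *, adj_comm]
      · right
        refine IsMinorOf.of_injective ![a, b, c, d, e] ?_ ?_
        · have := hab.ne; have := hac.ne; have := hbc.ne; have := had.ne; have := hde.ne
          have := hae.ne
          simp [Fin.forall_fin_succ, Function.Injective]
          grind
        · simp [Fin.forall_fin_succ, butterfly, mkGraph, *, adj_comm]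
    by_cases hE : ∃ a b, G.Adj a b
    · obtain ⟨a, b, hab⟩ := hE
      obtain ⟨c, hac, hbc⟩ := htri a b hab
      have h1 : ¬ Orientable (G.induce {a, b, c}ᶜ) Set.univ := by
        rw [orientable_induce_univ]
        refine fun h => hG (orientable_univ_of_triangle (hout a b c · hab hac hbc)
          (hout b a c · hab.symm hbc hac) (hout c a b · hac.symm hbc.symm hab) h)
      have h2 := ih _ (G.induce {a, b, c}ᶜ) (hcard _ fun h => by
        have : a ∈ ({a, b, c} : Set V)ᶜ := h ▸ Set.mem_univ a
        simp at this) h1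
      have h3 : IsMinorOf (G.induce {a, b, c}ᶜ) G :=
        IsMinorOf.of_injective _ Subtype.val_injective fun a b hab => hab
      exact hcon (h2.imp (·.trans h3) (·.trans h3))
    · exact hG ⟨id, fun a _ b _ hab => (hE ⟨a, b, hab⟩).elim⟩

lemma IsMinorOf.sum {U U' W W' : Type} {H : SimpleGraph U} {H' : SimpleGraph U'}
    {K : SimpleGraph W} {K' : SimpleGraph W'} (h : IsMinorOf H K) (h' : IsMinorOf H' K') :
    IsMinorOf (H ⊕g H') (K ⊕g K') := by
  obtain ⟨f, f1, f2, f3⟩ := h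
  obtain ⟨g, g1, g2, g3⟩ := h'
  refine ⟨Sum.elim (fun u => Sum.inl '' f u) (fun u => Sum.inr '' g u), ?_, ?_, ?_⟩
  · rintro (u | u) <;> rw [connected_induce_iff_reachable] <;> constructor
    · exact ((connected_induce_iff_reachable.1 (f1 u)).1).image _
    · rintro _ ⟨a, ha, rfl⟩ _ ⟨b, hb, rfl⟩
      exact ((connected_induce_iff_reachable.1 (f1 u)).2 a ha b hb).map
        (⟨fun x => ⟨Sum.inl x, Set.mem_image_of_mem _ x.2⟩, fun h => h⟩ :
          K.induce (f u) →g (K ⊕g K').induce (Sum.inl '' f u))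
    · exact ((connected_induce_iff_reachable.1 (g1 u)).1).image _
    · rintro _ ⟨a, ha, rfl⟩ _ ⟨b, hb, rfl⟩
      exact ((connected_induce_iff_reachable.1 (g1 u)).2 a ha b hb).map
        (⟨fun x => ⟨Sum.inr x, Set.mem_image_of_mem _ x.2⟩, fun h => h⟩ :
          K'.induce (g u) →g (K ⊕g K').induce (Sum.inr '' g u))
  · rintro (u | u) (w | w) huw
    · exact (Set.disjoint_image_iff Sum.inl_injective).2 (f2 fun h => huw (h ▸ rfl))
    · rw [Set.disjoint_left]; rintro _ ⟨a, _, rfl⟩ ⟨b, _, hb⟩; cases hb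
    · rw [Set.disjoint_left]; rintro _ ⟨a, _, rfl⟩ ⟨b, _, hb⟩; cases hb
    · exact (Set.disjoint_image_iff Sum.inr_injective).2 (g2 fun h => huw (h ▸ rfl))
  · rintro (u | u) (w | w) huw
    · obtain ⟨a, ha, b, hb, hab⟩ := f3 huw
      exact ⟨_, ⟨a, ha, rfl⟩, _, ⟨b, hb, rfl⟩, hab⟩
    · simp at huw
    · simp at huw
    · obtain ⟨a, ha, b, hb, hab⟩ := g3 huw
      exact ⟨_, ⟨a, ha, rfl⟩, _, ⟨b, hb, rfl⟩, hab⟩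

lemma isMinorOf_of_induce_sum {V : Type} {G : SimpleGraph V} {m n : ℕ} {D D' : Set V}
    (hD : Disjoint D D') {H : SimpleGraph (Fin m)} {H' : SimpleGraph (Fin n)}
    {K : SimpleGraph (Fin (m + n))} (h : IsMinorOf H (G.induce D)) (h' : IsMinorOf H' (G.induce D'))
    (hK : (∀ a b, K.Adj (Fin.castAdd n a) (Fin.castAdd n b) → H.Adj a b) ∧
      (∀ a b, K.Adj (Fin.natAdd m a) (Fin.natAdd m b) → H'.Adj a b) ∧
      ∀ a b, ¬ K.Adj (Fin.castAdd n a) (Fin.natAdd m b)) : IsMinorOf K G := by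
  have hK' : ∀ a b, K.Adj (finSumFinEquiv a) (finSumFinEquiv b) → (H ⊕g H').Adj a b := by
    rintro (a | a) (b | b) hab
    · exact hK.1 a b hab
    · exact (hK.2.2 a b hab).elim
    · exact (hK.2.2 b a hab.symm).elim
    · exact hK.2.1 a b hab
  refine (IsMinorOf.of_injective _ finSumFinEquiv.symm.injective
    fun a b hab => hK' _ _ (by simpa using hab)).trans ((h.sum h').trans ?_)
  refine IsMinorOf.of_injective (Sum.elim Subtype.val Subtype.val) ?_ ?_
  · exact Subtype.val_injective.sumElim Subtype.val_injective fun a b hab =>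
      Set.disjoint_left.1 hD a.2 (hab ▸ b.2)
  · rintro (u | u) (w | w) huw
    · exact huw
    · simp at huw
    · simp at huw
    · exact huw

end DiamondButterfly

namespace Critical

variable {V : Type} {G : SimpleGraph V}

lemma orientable_compl_pair (hG : Critical G) {u v : V} (huv : G.Adj u v)
    (hcom : ∀ w, G.Adj u w → ¬ G.Adj v w) : Orientable G {u, v}ᶜ := by
  obtain ⟨y, hyv, f, hf⟩ := hG.contract_edge u v huv
  by_cases hyu : y = u
  · subst hyu
    refine ⟨f, fun a ha b hb hab => ?_⟩
    simp only [Set.mem_compl_iff, Set.mem_insert_iff, Set.mem_singleton_iff, not_or] at ha hb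
    exact hf a b ha.2 ha.1 hb.2 hb.1 hab.ne (Or.inl hab)
  · refine (hG.not_orientable y (orientable_of_contract huv hcom (f := f) (Ne.symm hyu) ?_)).elim
    exact fun a ha b hb hav hbv hab h => hf a b hav ha hbv hb hab h

theorem orientable_of_disjoint [Finite V] (hG : Critical G) {D D' : Set V} (hD : Disjoint D D')
    (h : ¬ Orientable G D) : Orientable G D' := by
  by_contra h'
  rw [← orientable_induce_univ] at h h'
  have h1 : ¬ IsMinorOf O1 G := hG.not_minor ⟨8, O1⟩ (by simp [OList])
  have h2 : ¬ IsMinorOf O2 G := hG.not_minor ⟨10, O2⟩ (by simp [OList])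
  have h3 : ¬ IsMinorOf O3 G := hG.not_minor ⟨9, O3⟩ (by simp [OList])
  rcases diamond_or_butterfly_of_not_orientable _ _ _ le_rfl h with hd | hd <;>
    rcases diamond_or_butterfly_of_not_orientable _ _ _ le_rfl h' with hd' | hd'
  · exact h1 (isMinorOf_of_induce_sum hD hd hd' (by unfold O1; decide))
  · exact h3 (isMinorOf_of_induce_sum hD hd hd' (by unfold O3; decide))
  · exact h3 (isMinorOf_of_induce_sum hD.symm hd' hd (by unfold O3; decide))
  · exact h2 (isMinorOf_of_induce_sum hD hd hd' (by unfold O2; decide))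

end Critical

section Whitney

variable {V : Type} {G : SimpleGraph V}

lemma exists_walk_meeting_once (X : Set V) {a b : V} (p : G.Walk a b) :
    (∀ x ∈ p.support, x ∉ X) ∨ ∃ z ∈ X, ∃ q : G.Walk z b, q.support ⊆ p.support ∧
      ∀ x ∈ q.support, x ∈ X → x = z := by
  induction p with
  | @nil u =>
    by_cases hu : u ∈ X
    · exact Or.inr ⟨u, hu, Walk.nil, fun x hx => hx, fun x hx _ => by simpa using hx⟩
    · left; simpa using hu
  | @cons u v w h p ih =>
    rcases ih with ih | ⟨z, hz, q, hq, hq'⟩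
    · by_cases hu : u ∈ X
      · refine Or.inr ⟨u, hu, Walk.cons h p, fun x hx => hx, fun x hx hxX => ?_⟩
        rw [Walk.support_cons, List.mem_cons] at hx
        exact hx.resolve_right fun hx => ih x hx hxX
      · left
        intro x hx
        rw [Walk.support_cons, List.mem_cons] at hx
        rcases hx with rfl | hx
        · exact hu
        · exact ih x hx
    · exact Or.inr ⟨z, hz, q, fun x hx => by
        rw [Walk.support_cons]; exact List.mem_cons_of_mem _ (hq hx), hq'⟩

/-- There are two distinct internally disjoint paths from `u` to `v`. -/
def TwoPaths (G : SimpleGraph V) (u v : V) : Prop :=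
  ∃ P Q : G.Walk u v, P.IsPath ∧ Q.IsPath ∧ P ≠ Q ∧
    ∀ x, x ∈ P.support → x ∈ Q.support → x = u ∨ x = v

lemma exists_walk_avoiding {v : V} (h : (G.induce {v}ᶜ).Preconnected) {a b : V} (ha : a ≠ v)
    (hb : b ≠ v) : ∃ p : G.Walk a b, v ∉ p.support := by
  obtain ⟨p⟩ := h ⟨a, ha⟩ ⟨b, hb⟩
  refine ⟨p.map (Embedding.induce _).toHom, ?_⟩
  intro hv
  replace hv : v ∈ (p.map (Embedding.induce _).toHom).support := hv
  rw [Walk.support_map, List.mem_map] at hv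
  obtain ⟨x, -, hx⟩ := hv
  exact x.2 hx

lemma twoPaths_of_adj (hc : ∀ c, (G.induce {c}ᶜ).Preconnected) {u v w : V} (huv : G.Adj u v)
    (hwu : w ≠ u) (hwv : w ≠ v) : TwoPaths G u v := by
  classical
  obtain ⟨p, hp⟩ := exists_walk_avoiding (hc u) huv.ne' hwu
  have hnil : ¬ p.Nil := Walk.not_nil_of_ne (Ne.symm hwv)
  have h1 : G.Adj v p.snd := p.adj_snd hnil
  have h2 : p.snd ≠ u := fun h => hp (h ▸ p.getVert_mem_support 1)
  obtain ⟨q, hq⟩ := exists_walk_avoiding (hc v) huv.ne h1.ne'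
  have hqb : v ∉ q.bypass.support := fun h => hq (q.support_bypass_subset_support h)
  refine ⟨q.bypass.concat h1.symm, Walk.cons huv Walk.nil,
    (q.bypass_isPath).concat hqb h1.symm, by simp [huv.ne], ?_, ?_⟩
  · intro h
    have : p.snd ∈ (Walk.cons huv Walk.nil).support := by
      rw [← h]; simp [Walk.support_concat]
    simp [h2, h1.ne'] at this
  · intro x _ hx
    simpa using hx

lemma twoPaths_aux {u v w z : V} {P Q : G.Walk u v} (hP : P.IsPath) (hQ : Q.IsPath)
    (hd : ∀ x, x ∈ P.support → x ∈ Q.support → x = u ∨ x = v) (hvw : G.Adj v w) (hwu : w ≠ u)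
    (hz : z ∈ P.support) (R : G.Walk z w) (hR : R.IsPath) (hvR : v ∉ R.support)
    (hR' : ∀ x ∈ R.support, x ∈ P.support ∨ x ∈ Q.support → x = z) : TwoPaths G u w := by
  classical
  have hzv : z ≠ v := by rintro rfl; exact hvR R.start_mem_support
  have hvP : v ∉ (P.takeUntil z hz).support := by
    intro hv
    exact Walk.endpoint_notMem_support_takeUntil hP hz hzv.symm hv
  have hsub : ∀ x ∈ (P.takeUntil z hz).support, x ∈ P.support := fun x hx =>
    P.support_takeUntil_subset_support hz hx
  have hwQ : w ∉ Q.support := by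
    intro hw
    have h1 : w = z := hR' w R.end_mem_support (Or.inr hw)
    subst h1
    rcases hd w hz hw with h | h
    · exact hwu h
    · exact hzv h
  refine ⟨(P.takeUntil z hz).append R, Q.concat hvw, ?_, hQ.concat hwQ hvw, ?_, ?_⟩
  · rw [Walk.isPath_def, Walk.support_append, List.nodup_append']
    refine ⟨(hP.takeUntil hz).support_nodup, hR.support_nodup.sublist (List.tail_sublist _), ?_⟩
    intro x hx hx'
    have h1 := hR' x (List.mem_of_mem_tail hx') (Or.inl (hsub x hx))
    subst h1
    have := hR.support_nodup
    rw [← Walk.cons_tail_support] at this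
    exact (List.nodup_cons.1 this).1 hx'
  · intro h
    have : v ∈ ((P.takeUntil z hz).append R).support := by
      rw [h]; simp [Walk.support_concat]
    rw [Walk.mem_support_append_iff] at this
    exact this.elim hvP hvR
  · intro x hx hx'
    rw [Walk.support_concat, List.mem_append, List.mem_singleton] at hx'
    rcases hx' with hx' | rfl
    · rw [Walk.mem_support_append_iff] at hx
      left
      rcases hx with hx | hx
      · refine (hd x (hsub x hx) hx').resolve_right ?_
        rintro rfl
        exact hvP hx
      · have h1 := hR' x hx (Or.inr hx')
        subst h1
        exact (hd x hz hx').resolve_right hzv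
    · exact Or.inr rfl

lemma TwoPaths.step (hc : ∀ c, (G.induce {c}ᶜ).Preconnected) {u v w : V} (h : TwoPaths G u v)
    (huv : u ≠ v) (hvw : G.Adj v w) (hwu : w ≠ u) : TwoPaths G u w := by
  classical
  obtain ⟨P, Q, hP, hQ, -, hd⟩ := h
  obtain ⟨p, hp⟩ := exists_walk_avoiding (hc v) huv hvw.ne'
  rcases exists_walk_meeting_once {x | x ∈ P.support ∨ x ∈ Q.support} p with h | ⟨z, hz, R, h1, h2⟩
  · exact (h u p.start_mem_support (Or.inl P.start_mem_support)).elim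
  have hv : v ∉ R.bypass.support := fun h => hp (h1 (R.support_bypass_subset_support h))
  have h3 : ∀ x ∈ R.bypass.support, x ∈ P.support ∨ x ∈ Q.support → x = z := fun x hx hx' =>
    h2 x (R.support_bypass_subset_support hx) hx'
  rcases hz with hz | hz
  · exact twoPaths_aux hP hQ hd hvw hwu hz _ R.bypass_isPath hv h3
  · exact twoPaths_aux hQ hP (fun x hx hx' => hd x hx' hx) hvw hwu hz _ R.bypass_isPath hv
      fun x hx hx' => h3 x hx hx'.symm

theorem kConnected_two_of_preconnected (hG : G.Preconnected)
    (hc : ∀ c, (G.induce {c}ᶜ).Preconnected) (h3 : ∀ u v : V, ∃ w, w ≠ u ∧ w ≠ v) :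
    KConnected 2 G := by
  classical
  have key : ∀ u a b (p : G.Walk a b), u ∉ p.support → TwoPaths G u a → TwoPaths G u b := by
    intro u a b p
    induction p with
    | nil => exact fun _ h => h
    | @cons x y z hxy p ih =>
      intro hu h
      rw [Walk.support_cons, List.mem_cons, not_or] at hu
      exact ih hu.2 (h.step hc hu.1 hxy fun h => hu.2 (h ▸ p.start_mem_support))
  intro u v huv
  obtain ⟨p, hp⟩ := (hG u v).exists_isPath
  have hT : TwoPaths G u v := by
    cases p with
    | nil => exact (huv rfl).elim
    | @cons _ y _ huy p =>
      rw [Walk.cons_isPath_iff] at hp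
      obtain ⟨w, h1, h2⟩ := h3 u y
      exact key u y v p hp.2 (twoPaths_of_adj hc huy h1 h2)
  obtain ⟨P, Q, hP, hQ, hne, hd⟩ := hT
  refine ⟨![P, Q], ?_, ?_, ?_⟩
  · intro i j hij
    fin_cases i <;> fin_cases j <;> simp_all
  · intro i
    fin_cases i <;> simpa
  · intro i j hij x
    fin_cases i <;> fin_cases j
    · simp at hij
    · exact fun h h' => hd x h h'
    · exact fun h h' => hd x h' h
    · simp at hij

/-- A graph with at least three vertices that is not biconnected has a separation of order at most
one. -/
theorem exists_separation (h : ¬ KConnected 2 G) (h3 : ∀ u v : V, ∃ w, w ≠ u ∧ w ≠ v) :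
    ∃ C A B : Set V, C.Subsingleton ∧ A.Nonempty ∧ B.Nonempty ∧ (∀ x, x ∈ A ∨ x ∈ B ∨ x ∈ C) ∧
      (∀ x, x ∈ A → x ∉ B ∧ x ∉ C) ∧ (∀ x, x ∈ B → x ∉ C) ∧
        ∀ a ∈ A, ∀ b ∈ B, ¬ G.Adj a b := by
  by_cases hG : G.Preconnected
  · by_cases hc : ∀ c, (G.induce {c}ᶜ).Preconnected
    · exact (h (kConnected_two_of_preconnected hG hc h3)).elim
    · simp only [not_forall, Preconnected] at hc
      obtain ⟨c, a, b, hab⟩ := hc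
      refine ⟨{c}, {x | ∃ h : x ∈ ({c}ᶜ : Set V), ¬ (G.induce {c}ᶜ).Reachable ⟨x, h⟩ b},
        {x | ∃ h : x ∈ ({c}ᶜ : Set V), (G.induce {c}ᶜ).Reachable ⟨x, h⟩ b},
        Set.subsingleton_singleton, ⟨a, a.2, hab⟩, ⟨b, b.2, Reachable.refl _⟩, fun x => ?_,
        fun x hx => ⟨fun hx' => hx.2 hx'.2, hx.1⟩, fun x hx => hx.1, ?_⟩
      · by_cases hx : x = c
        · exact Or.inr (Or.inr hx)
        · by_cases hr : (G.induce {c}ᶜ).Reachable ⟨x, hx⟩ b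
          · exact Or.inr (Or.inl ⟨hx, hr⟩)
          · exact Or.inl ⟨hx, hr⟩
      · rintro x ⟨hx, hx'⟩ y ⟨hy, hy'⟩ hxy
        have : (G.induce {c}ᶜ).Adj ⟨x, hx⟩ ⟨y, hy⟩ := hxy
        exact hx' (this.reachable.trans hy')
  · simp only [not_forall, Preconnected] at hG
    obtain ⟨a, b, hab⟩ := hG
    refine ⟨∅, {x | ¬ G.Reachable x b}, {x | G.Reachable x b}, Set.subsingleton_empty, ⟨a, hab⟩,
      ⟨b, Reachable.refl _⟩, fun x => ?_, fun x hx => ⟨hx, fun h => h⟩, fun x _ h => h, ?_⟩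
    · by_cases hr : G.Reachable x b
      · exact Or.inr (Or.inl hr)
      · exact Or.inl hr
    · exact fun x hx y hy hxy => hx (hxy.reachable.trans hy)

end Whitney

namespace Critical

variable {V : Type} {G : SimpleGraph V}

lemma exists_adj (hG : Critical G) (v : V) : ∃ w, G.Adj v w := by
  by_contra! h
  obtain ⟨y, hy, ho⟩ := hG.delete_vertex v
  exact hG.not_orientable y ((ho.insert_leaf (v := v) (w := v) fun b _ hb => (h b hb).elim).mono
    fun x hx => by by_cases x = v <;> simp_all)

lemma exists_adj_ne (hG : Critical G) (v w : V) : ∃ u, G.Adj v u ∧ u ≠ w := by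
  by_contra! h
  obtain ⟨y, hy, ho⟩ := hG.delete_vertex v
  exact hG.not_orientable y ((ho.insert_leaf (v := v) (w := w) fun b _ hb => h b hb).mono
    fun x hx => by by_cases x = v <;> simp_all)

lemma orientable_of_partition {A B : Set V} (hA : Orientable G A) (hB : Orientable G B)
    (hAB : ∀ a ∈ A, ∀ b ∈ B, ¬ G.Adj a b) : Orientable G (A ∪ B) := by
  classical
  obtain ⟨f, hf⟩ := hA
  obtain ⟨g, hg⟩ := hB
  by_cases hdis : Disjoint A B
  · refine ⟨fun a => if a ∈ A then f a else g a, ?_⟩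
    have hB : ∀ b ∈ B, b ∉ A := fun b hb hb' => Set.disjoint_left.1 hdis hb' hb
    rintro a (ha | ha) b (hb | hb) hab
    · simpa [ha, hb] using hf a ha b hb hab
    · exact (hAB a ha b hb hab).elim
    · exact (hAB b hb a ha hab.symm).elim
    · simpa [hB a ha, hB b hb] using hg a ha b hb hab
  · refine ⟨fun a => if a ∈ A then f a else g a, ?_⟩
    rintro a (ha | ha) b (hb | hb) hab
    · simpa [ha, hb] using hf a ha b hb hab
    · exact (hAB a ha b hb hab).elim
    · exact (hAB b hb a ha hab.symm).elim
    · have h1 : a ∉ A := fun h => hAB a h b hb hab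
      have h2 : b ∉ A := fun h => hAB b h a ha hab.symm
      simpa [h1, h2] using hg a ha b hb hab

lemma not_disconnected [Finite V] (hG : Critical G) {A B : Set V} (hA : A.Nonempty)
    (hB : B.Nonempty) (hAB : ∀ x, x ∈ A ∨ x ∈ B) (hdis : ∀ x ∈ A, x ∉ B)
    (hadj : ∀ a ∈ A, ∀ b ∈ B, ¬ G.Adj a b) : False := by
  classical
  wlog hBo : Orientable G B generalizing A B
  · exact this hB hA (fun x => (hAB x).symm) (fun x hx hx' => hdis x hx' hx)
      (fun a ha b hb hab => hadj b hb a ha hab.symm)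
      (hG.orientable_of_disjoint (Set.disjoint_left.2 fun x hx hx' => hdis x hx' hx) hBo)
  obtain ⟨g, hg⟩ := hBo
  obtain ⟨b, hb⟩ := hB
  obtain ⟨w, hw⟩ := hG.exists_adj b
  have hwB : w ∈ B := (hAB w).resolve_left fun h => hadj w h b hb hw.symm
  let G' : SimpleGraph V :=
    { Adj := fun x y => G.Adj x y ∧ ¬ (x ∈ B ∧ y ∈ B)
      symm := ⟨fun x y h => ⟨h.1.symm, fun h' => h.2 h'.symm⟩⟩
      loopless := ⟨fun x h => h.1.ne rfl⟩ }
  have hlt : G' < G := by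
    refine lt_of_le_of_ne (fun x y h => h.1) fun h => ?_
    have : G'.Adj b w := h ▸ hw
    exact this.2 ⟨hb, hwB⟩
  obtain ⟨y, f, hf⟩ := hG.of_lt G' hlt
  refine hG.not_orientable y ⟨fun x => if x ∈ B then g x else f x, fun p hp q hq hpq => ?_⟩
  by_cases hpB : p ∈ B
  · have hqB : q ∈ B := (hAB q).resolve_left fun h => hadj q h p hpB hpq.symm
    simpa [hpB, hqB] using hg p hpB q hqB hpq
  · have hqB : q ∉ B := fun hqB => hadj p ((hAB p).resolve_right hpB) q hqB hpq
    simpa [hpB, hqB] using hf p hp q hq ⟨hpq, fun h => hpB h.1⟩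

lemma exists_pendant_of_cutvertex [Finite V] (hG : Critical G) {A B : Set V} {c : V}
    (hA : ¬ Orientable G A) (hB : B.Nonempty) (hAB : ∀ x, x ∈ A ∨ x ∈ B ∨ x = c)
    (hAc : ∀ x ∈ A, x ∉ B ∧ x ≠ c) (hBc : ∀ x ∈ B, x ≠ c)
    (hadj : ∀ a ∈ A, ∀ b ∈ B, ¬ G.Adj a b) :
    ∃ c t₁ t₂, G.Adj c t₁ ∧ G.Adj c t₂ ∧ G.Adj t₁ t₂ ∧ (∀ b, G.Adj t₁ b → b = c ∨ b = t₂) ∧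
      (∀ b, G.Adj t₂ b → b = c ∨ b = t₁) ∧ ¬ Orientable G {c, t₁, t₂}ᶜ := by
  classical
  have hcB : ∃ t ∈ B, G.Adj c t := by
    by_contra! hc
    refine hG.not_disconnected (A := A ∪ {c}) (B := B) ⟨c, by simp⟩ hB (fun x => ?_) ?_ ?_
    · rcases hAB x with h | h | h <;> simp [h]
    · rintro x (hx | hx)
      · exact (hAc x hx).1
      · exact fun h => hBc x h hx
    · rintro a (ha | ha) b hb hab
      · exact hadj a ha b hb hab
      · rw [Set.mem_singleton_iff] at ha
        subst ha
        exact hc b hb hab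
  obtain ⟨t, htB, hct⟩ := hcB
  have hcom : ∃ s, G.Adj c s ∧ G.Adj t s := by
    by_contra! h
    refine hA ((hG.orientable_compl_pair hct h).mono fun x hx => ?_)
    simp only [Set.mem_compl_iff, Set.mem_insert_iff, Set.mem_singleton_iff, not_or]
    exact ⟨(hAc x hx).2, by rintro rfl; exact (hAc x hx).1 htB⟩
  obtain ⟨s, hcs, hts⟩ := hcom
  have hsB : s ∈ B := by
    rcases hAB s with h | h | h
    · exact (hadj s h t htB hts.symm).elim
    · exact h
    · exact (hcs.ne h.symm).elim
  have hBo : Orientable G (insert c B) := by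
    refine hG.orientable_of_disjoint ?_ hA
    rw [Set.disjoint_left]
    rintro x hx (rfl | hx')
    · exact (hAc x hx).2 rfl
    · exact (hAc x hx).1 hx'
  obtain ⟨g, hg⟩ := hBo
  let T : Set V := {c, t, s}
  let G' : SimpleGraph V :=
    { Adj := fun x y => G.Adj x y ∧ ((x ∉ B ∧ y ∉ B) ∨ (x ∈ T ∧ y ∈ T))
      symm := ⟨fun x y h => ⟨h.1.symm, h.2.imp And.symm And.symm⟩⟩
      loopless := ⟨fun x h => h.1.ne rfl⟩ }
  have hle : G' ≤ G := fun x y h => h.1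
  have hGG : ∀ x y, G.Adj x y → (x ∉ B ∧ y ∉ B) ∨ (x ∈ T ∧ y ∈ T) := by
    by_contra hno
    have hlt : G' < G := by
      refine lt_of_le_of_ne hle fun h => hno fun x y hxy => ?_
      have : G'.Adj x y := h ▸ hxy
      exact this.2
    obtain ⟨y, f, hf⟩ := hG.of_lt G' hlt
    by_cases hyA : y ∈ A
    · have hTy : ∀ x ∈ T, x ∈ ({y}ᶜ : Set V) := by
        rintro x (rfl | rfl | rfl) h
        · exact (hAc _ hyA).2 h.symm
        · exact (hAc _ hyA).1 (h ▸ htB)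
        · exact (hAc _ hyA).1 (h ▸ hsB)
      have e1 := hf c (hTy c (by simp [T])) t (hTy t (by simp [T])) ⟨hct, Or.inr (by simp [T])⟩
      have e2 := hf c (hTy c (by simp [T])) s (hTy s (by simp [T])) ⟨hcs, Or.inr (by simp [T])⟩
      have e3 := hf t (hTy t (by simp [T])) s (hTy s (by simp [T])) ⟨hts, Or.inr (by simp [T])⟩
      have hfc : f c = t ∨ f c = s := by
        have := hct.ne; have := hcs.ne; have := hts.ne
        grind
      have hfB : f c ∈ B := by rcases hfc with h | h <;> rw [h] <;> assumption
      refine hG.not_orientable y ⟨fun x => if x ∈ A then f x else g x, fun p hp q hq hpq => ?_⟩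
      have hnB : ∀ x, x ∈ A → x ∉ B := fun x hx => (hAc x hx).1
      have hcB' : c ∉ B := fun h => hBc c h rfl
      have hcA : c ∉ A := fun h => (hAc c h).2 rfl
      by_cases hpA : p ∈ A <;> by_cases hqA : q ∈ A
      · simpa [hpA, hqA] using hf p hp q hq ⟨hpq, Or.inl ⟨hnB p hpA, hnB q hqA⟩⟩
      · have hqc : q = c := by
          rcases hAB q with h | h | h
          · exact (hqA h).elim
          · exact (hadj p hpA q h hpq).elim
          · exact h
        subst hqc
        left
        simp only [if_pos hpA]
        refine (hf p hp q hq ⟨hpq, Or.inl ⟨hnB p hpA, hcB'⟩⟩).resolve_right ?_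
        rintro h
        exact hnB p hpA (h ▸ hfB)
      · have hqc : p = c := by
          rcases hAB p with h | h | h
          · exact (hpA h).elim
          · exact (hadj q hqA p h hpq.symm).elim
          · exact h
        subst hqc
        right
        simp only [if_pos hqA]
        refine (hf p hp q hq ⟨hpq, Or.inl ⟨hcB', hnB q hqA⟩⟩).resolve_left ?_
        rintro h
        exact hnB q hqA (h ▸ hfB)
      · have : ∀ x, x ∉ A → x ∈ insert c B := by
          intro x hx
          rcases hAB x with h | h | h
          · exact (hx h).elim
          · exact Or.inr h
          · exact Or.inl h
        simpa [hpA, hqA] using hg p (this p hpA) q (this q hqA) hpq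
    · refine hA ⟨f, fun p hp q hq hpq => hf p ?_ q ?_
        ⟨hpq, Or.inl ⟨(hAc p hp).1, (hAc q hq).1⟩⟩⟩
      · rintro rfl; exact hyA hp
      · rintro rfl; exact hyA hq
  refine ⟨c, t, s, hct, hcs, hts, fun b hb => ?_, fun b hb => ?_, fun h => hA (h.mono ?_)⟩
  · rcases hGG t b hb with h | ⟨-, h | h | h⟩
    · exact (h.1 htB).elim
    · exact Or.inl h
    · exact (hb.ne h.symm).elim
    · exact Or.inr h
  · rcases hGG s b hb with h | ⟨-, h | h | h⟩
    · exact (h.1 hsB).elim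
    · exact Or.inl h
    · exact Or.inr h
    · exact (hb.ne h.symm).elim
  · rintro x hx (rfl | rfl | rfl)
    · exact (hAc _ hx).2 rfl
    · exact (hAc _ hx).1 htB
    · exact (hAc _ hx).1 hsB

/-- A critical graph that is not biconnected has a pendant triangle. -/
theorem exists_pendant [Finite V] (hG : Critical G) (h : ¬ KConnected 2 G) :
    ∃ c t₁ t₂, G.Adj c t₁ ∧ G.Adj c t₂ ∧ G.Adj t₁ t₂ ∧ (∀ b, G.Adj t₁ b → b = c ∨ b = t₂) ∧
      (∀ b, G.Adj t₂ b → b = c ∨ b = t₁) ∧ ¬ Orientable G {c, t₁, t₂}ᶜ := by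
  have h3 : ∀ u v : V, ∃ w, w ≠ u ∧ w ≠ v := by
    by_contra! h3
    obtain ⟨u, v, h3⟩ := h3
    refine hG.not_orientable u ⟨id, fun a ha b hb hab => ?_⟩
    exact (hab.ne ((h3 a ha).trans (h3 b hb).symm)).elim
  obtain ⟨C, A, B, hC, hA, hB, hABC, hA', hB', hadj⟩ := exists_separation h h3
  rcases hC.eq_empty_or_singleton with rfl | ⟨c, rfl⟩
  · exact (hG.not_disconnected hA hB (fun x => by simpa using hABC x) (fun x hx => (hA' x hx).1)
      hadj).elim
  · by_cases hAo : Orientable G A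
    · have hBo : ¬ Orientable G B := fun hBo => hG.not_orientable c
        ((orientable_of_partition hAo hBo hadj).mono fun x hx => by
          rcases hABC x with h | h | h
          · exact Or.inl h
          · exact Or.inr h
          · exact (hx h).elim)
      exact hG.exists_pendant_of_cutvertex hBo hA
        (fun x => by rcases hABC x with h | h | h <;> simp_all)
        (fun x hx => ⟨fun hx' => (hA' x hx').1 hx, hB' x hx⟩) (fun x hx => (hA' x hx).2)
        (fun a ha b hb hab => hadj b hb a ha hab.symm)
    · exact hG.exists_pendant_of_cutvertex hAo hB
        (fun x => by rcases hABC x with h | h | h <;> simp_all)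
        hA' hB' hadj

end Critical

/-- The triangle `c t₁ t₂` is attached to the rest of the graph only at `c`. -/
structure PendantTriangle {V : Type} (G : SimpleGraph V) (c t₁ t₂ : V) : Prop where
  left : G.Adj c t₁
  right : G.Adj c t₂
  top : G.Adj t₁ t₂
  nbr_left : ∀ b, G.Adj t₁ b → b = c ∨ b = t₂
  nbr_right : ∀ b, G.Adj t₂ b → b = c ∨ b = t₁

/-- The trajectory `p` of the attachment vertex of a pendant triangle under an orientation `f` of
the graph minus an apex `x` and the triangle tips: a path `p 0, …, p (N - 1)` closing up at
`p k`. -/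
structure Trajectory {V : Type} (G : SimpleGraph V) (t₁ t₂ x : V) (f : V → V) (p : ℕ → V)
    (N k : ℕ) : Prop where
  pendant : PendantTriangle G (p 0) t₁ t₂
  ne_left : x ≠ t₁
  ne_right : x ≠ t₂
  orients : Orients G {x, t₁, t₂}ᶜ f
  step : ∀ n, f (p n) = p (n + 1)
  notMem : ∀ n, p n ≠ x ∧ p n ≠ t₁ ∧ p n ≠ t₂
  adj : ∀ n, G.Adj (p n) (p (n + 1))
  closes : p N = p k
  le : k + 3 ≤ N
  inj : ∀ i < N, ∀ j < N, p i = p j → i = j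

section

variable {V : Type} {G : SimpleGraph V}

theorem Critical.exists_trajectory [Finite V] (hG : Critical G) {c t₁ t₂ : V}
    (hT : PendantTriangle G c t₁ t₂) (hno : ¬ Orientable G {c, t₁, t₂}ᶜ) :
    ∃ x f p N k, Trajectory G t₁ t₂ x f p N k := by
  classical
  have hct1 := hT.left
  have hct2 := hT.right
  have ht := hT.top
  let G' : SimpleGraph V :=
    { Adj := fun a b => G.Adj a b ∧ ¬ (a = t₁ ∧ b = t₂ ∨ a = t₂ ∧ b = t₁)
      symm := ⟨fun a b h => ⟨h.1.symm, by have := h.2; tauto⟩⟩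
      loopless := ⟨fun a h => h.1.ne rfl⟩ }
  have hlt : G' < G := by
    refine lt_of_le_of_ne (fun a b h => h.1) fun h => ?_
    have : G'.Adj t₁ t₂ := h ▸ ht
    exact this.2 (Or.inl ⟨rfl, rfl⟩)
  obtain ⟨x, f, hf⟩ := hG.of_lt G' hlt
  have hx : x ≠ c ∧ x ≠ t₁ ∧ x ≠ t₂ := by
    have h : x ∈ ({c, t₁, t₂} : Set V) → False := by
      intro hx
      refine hno ⟨f, fun a ha b hb hab => hf a ?_ b ?_ ⟨hab, ?_⟩⟩
      · rintro rfl; exact ha hx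
      · rintro rfl; exact hb hx
      · rintro (⟨rfl, -⟩ | ⟨rfl, -⟩) <;> exact ha (by simp)
    simpa using h
  obtain ⟨hxc, hx1, hx2⟩ := hx
  have hfo : Orients G {x, t₁, t₂}ᶜ f := by
    intro a ha b hb hab
    simp only [Set.mem_compl_iff, Set.mem_insert_iff, Set.mem_singleton_iff, not_or] at ha hb
    exact hf a ha.1 b hb.1 ⟨hab, by tauto⟩
  have hlive : ∀ n, ¬ Dead G {x, t₁, t₂}ᶜ f (f^[n] c) := by
    intro n hn
    obtain ⟨g, hg, hgc⟩ := hfo.exists_fixed n c hn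
    refine hG.not_orientable x ⟨fun v => if v = c then t₁ else if v = t₁ then t₂ else
      if v = t₂ then c else g v, fun a ha b hb hab => ?_⟩
    have h1 := hg a
    have h2 := hg b
    have h3 := hT.nbr_left
    have h4 := hT.nbr_right
    have h5 := hab.symm
    have h6 := hab.ne
    simp only [Set.mem_compl_iff, Set.mem_insert_iff, Set.mem_singleton_iff] at *
    grind
  simp only [Dead, Classical.not_imp] at hlive
  let p : ℕ → V := fun n => f^[n] c
  have hp : ∀ n, f (p n) = p (n + 1) := fun n => (Function.iterate_succ_apply' f n c).symm
  have hadj : ∀ n, G.Adj (p n) (p (n + 1)) := fun n => hp n ▸ (hlive n).2.2.1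
  have hne2 : ∀ n, p (n + 2) ≠ p n := by
    intro n
    have := (hlive n).2.2.2
    rwa [← hp, ← hp]
  have hex : ∃ n, ∃ k < n, p n = p k := by
    obtain ⟨i, j, hij, h⟩ := Finite.exists_ne_map_eq_of_infinite p
    rcases lt_or_gt_of_ne hij with hlt | hlt
    · exact ⟨j, i, hlt, h.symm⟩
    · exact ⟨i, j, hlt, h⟩
  obtain ⟨k, hkN, hNk⟩ := Nat.find_spec hex
  refine ⟨x, f, p, Nat.find hex, k, hT, hx1, hx2, hfo, hp, fun n => ?_, hadj, hNk, ?_, ?_⟩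
  · have := (hlive n).1
    simpa only [Set.mem_compl_iff, Set.mem_insert_iff, Set.mem_singleton_iff, not_or] using this
  · have h1 : Nat.find hex ≠ k + 1 := fun h => (hadj k).ne (by rw [← hNk, h])
    have h2 : Nat.find hex ≠ k + 2 := fun h => hne2 k (by rw [← hNk, h])
    omega
  · intro i hi j hj hij
    by_contra hne
    rcases lt_or_gt_of_ne hne with hlt | hlt
    · exact Nat.find_min hex hj ⟨i, hlt, hij.symm⟩
    · exact Nat.find_min hex hi ⟨j, hlt, hij⟩

namespace Trajectory

variable {t₁ t₂ x : V} {f : V → V} {p : ℕ → V} {N k : ℕ}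

lemma adj_iff (h : Trajectory G t₁ t₂ x f p N k) {i j : ℕ} (hi : i < N) (hj : j < N) :
    G.Adj (p i) (p j) ↔ i + 1 = j ∨ j + 1 = i ∨ (i = k ∧ j + 1 = N) ∨ (j = k ∧ i + 1 = N) := by
  have hle := h.le
  have key : ∀ i < N, ∀ j < N, f (p i) = p j → i + 1 = j ∨ (j = k ∧ i + 1 = N) := by
    intro i hi j hj hij
    rw [h.step] at hij
    by_cases hiN : i + 1 < N
    · exact Or.inl (h.inj _ hiN _ hj hij)
    · have : i + 1 = N := by omega
      rw [this, h.closes] at hij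
      exact Or.inr ⟨(h.inj _ (by omega) _ hj hij).symm, this⟩
  constructor
  · intro hij
    rcases h.orients (p i) (by simpa using h.notMem i) (p j) (by simpa using h.notMem j) hij
      with h1 | h1
    · have := key i hi j hj h1; tauto
    · have := key j hj i hi h1; tauto
  · rintro (rfl | rfl | ⟨rfl, h1⟩ | ⟨rfl, h1⟩)
    · exact h.adj _
    · exact (h.adj _).symm
    · have := h.adj j
      rw [h1, h.closes] at this
      exact this.symm
    · have := h.adj i
      rwa [h1, h.closes] at this

/-- The vertices of the trajectory together with the pendant triangle are not orientable. -/
lemma not_orientable (h : Trajectory G t₁ t₂ x f p N k) {D : Set V} (h1 : t₁ ∈ D) (h2 : t₂ ∈ D)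
    (hp : ∀ i < N, p i ∈ D) : ¬ Orientable G D := by
  rintro ⟨g, hg⟩
  have hle := h.le
  have hT := h.pendant
  have ht1 : ∀ i, p i ≠ t₁ := fun i => (h.notMem i).2.1
  have ht2 : ∀ i, p i ≠ t₂ := fun i => (h.notMem i).2.2
  have hg0 : g (p 0) = t₁ ∨ g (p 0) = t₂ := by
    have e1 := hg _ (hp 0 (by omega)) _ h1 hT.left
    have e2 := hg _ (hp 0 (by omega)) _ h2 hT.right
    have e3 := hg _ h1 _ h2 hT.top
    have := hT.top.ne
    have := ht1 0
    have := ht2 0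
    grind
  have hback : ∀ i, i + 1 < N → g (p (i + 1)) = p i := by
    intro i
    induction i with
    | zero =>
      intro hi
      refine (hg _ (hp 0 (by omega)) _ (hp 1 hi) (h.adj 0)).resolve_left ?_
      rcases hg0 with h0 | h0 <;> rw [h0]
      · exact (ht1 1).symm
      · exact (ht2 1).symm
    | succ i ih =>
      intro hi
      refine (hg _ (hp (i + 1) (by omega)) _ (hp _ hi) (h.adj (i + 1))).resolve_left ?_
      rw [ih (by omega)]
      intro hc
      have := h.inj _ (by omega) _ hi hc
      omega
  obtain ⟨m, rfl⟩ : ∃ m, N = m + 2 := ⟨N - 2, by omega⟩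
  have hlast : G.Adj (p (m + 1)) (p k) := (h.adj_iff (by omega) (by omega)).2 (by omega)
  rcases hg _ (hp _ (by omega)) _ (hp k (by omega)) hlast with h3 | h3
  · rw [hback m (by omega)] at h3
    have := h.inj _ (by omega) _ (by omega) h3
    omega
  · rcases k with - | k
    · rcases hg0 with h0 | h0 <;> rw [h0] at h3
      · exact ht1 _ h3.symm
      · exact ht2 _ h3.symm
    · rw [hback k (by omega)] at h3
      have := h.inj _ (by omega) _ (by omega) h3
      omega

end Trajectory

end

/-- The vertex `d` has exactly the two neighbours `x` and `v`, which are adjacent. -/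
structure IsDoubler {V : Type} (G : SimpleGraph V) (x d v : V) : Prop where
  adj : G.Adj x v
  nbr : ∀ b, G.Adj d b ↔ b = x ∨ b = v

namespace Trajectory

variable {V : Type} {G : SimpleGraph V} {t₁ t₂ x : V} {f : V → V} {p : ℕ → V} {N k : ℕ}

/-- The vertices off the apex, the pendant triangle and the trajectory. -/
def outer (_ : Trajectory G t₁ t₂ x f p N k) : Set V :=
  {v | v ≠ x ∧ v ≠ t₁ ∧ v ≠ t₂ ∧ ∀ i < N, v ≠ p i}

lemma cover (h : Trajectory G t₁ t₂ x f p N k) (v : V) :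
    v = x ∨ v = t₁ ∨ v = t₂ ∨ (∃ i < N, v = p i) ∨ v ∈ h.outer := by
  by_cases h1 : ∃ i < N, v = p i
  · exact Or.inr (Or.inr (Or.inr (Or.inl h1)))
  · have : v ∈ h.outer ↔ v ≠ x ∧ v ≠ t₁ ∧ v ≠ t₂ ∧ ∀ i < N, v ≠ p i := Iff.rfl
    push Not at h1
    tauto

lemma orientable_outer [Finite V] (h : Trajectory G t₁ t₂ x f p N k) (hG : Critical G) :
    Orientable G (insert x h.outer) := by
  refine hG.orientable_of_disjoint (D := {v | v = t₁ ∨ v = t₂ ∨ ∃ i < N, v = p i}) ?_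
    (h.not_orientable (Or.inl rfl) (Or.inr (Or.inl rfl))
      fun i hi => Or.inr (Or.inr ⟨i, hi, rfl⟩))
  rw [Set.disjoint_left]
  rintro v hv (rfl | hv')
  · rcases hv with hv | hv | ⟨i, -, hv⟩
    · exact h.ne_left hv
    · exact h.ne_right hv
    · exact (h.notMem i).1 hv.symm
  · rcases hv with hv | hv | ⟨i, hi, hv⟩
    · exact hv'.2.1 hv
    · exact hv'.2.2.1 hv
    · exact hv'.2.2.2 i hi hv

lemma orient_eq (h : Trajectory G t₁ t₂ x f p N k) {w : V} (hw : w ∈ h.outer) {i : ℕ}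
    (hi : i < N) (hadj : G.Adj w (p i)) : f w = p i := by
  have hw' := hw
  obtain ⟨h1, h2, h3, h4⟩ := hw
  refine (h.orients w (by simp [h1, h2, h3]) (p i) (by simpa using h.notMem i)
    hadj).resolve_right ?_
  rw [h.step]
  by_cases hiN : i + 1 < N
  · exact (h4 _ hiN).symm
  · have : i + 1 = N := by omega
    rw [this, h.closes]
    exact (h4 k (by have := h.le; omega)).symm

lemma orient_outer (h : Trajectory G t₁ t₂ x f p N k) {u v : V} (hu : u ∈ h.outer)
    (hv : v ∈ h.outer) (huv : G.Adj u v) : f u = v ∨ f v = u :=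
  h.orients u (by simp [hu.1, hu.2.1, hu.2.2.1]) v (by simp [hv.1, hv.2.1, hv.2.2.1]) huv

lemma not_adj_tips (h : Trajectory G t₁ t₂ x f p N k) {v : V} (hv : v ∈ insert x h.outer) :
    ¬ G.Adj v t₁ ∧ ¬ G.Adj v t₂ := by
  have h0 : v ≠ t₁ ∧ v ≠ t₂ ∧ v ≠ p 0 := by
    rcases hv with rfl | hv
    · exact ⟨h.ne_left, h.ne_right, (h.notMem 0).1.symm⟩
    · exact ⟨hv.2.1, hv.2.2.1, hv.2.2.2 0 (by have := h.le; omega)⟩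
  constructor
  · intro hadj
    have := h.pendant.nbr_left _ hadj.symm
    tauto
  · intro hadj
    have := h.pendant.nbr_right _ hadj.symm
    tauto

lemma exists_common [Finite V] (h : Trajectory G t₁ t₂ x f p N k) (hG : Critical G) {u v : V}
    (hu : u ∈ h.outer) (hv : v ∈ insert x h.outer) (huv : G.Adj u v) :
    ∃ z, G.Adj u z ∧ G.Adj v z ∧ z ≠ t₁ ∧ z ≠ t₂ := by
  by_contra hno
  have hcom : ∀ w, G.Adj u w → ¬ G.Adj v w := by
    intro w h1 h2
    refine hno ⟨w, h1, h2, ?_, ?_⟩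
    · rintro rfl; exact (h.not_adj_tips hv).1 h2
    · rintro rfl; exact (h.not_adj_tips hv).2 h2
  refine h.not_orientable (D := {u, v}ᶜ) ?_ ?_ ?_ (hG.orientable_compl_pair huv hcom)
  · rintro (h1 | h1)
    · exact hu.2.1 h1.symm
    · rcases hv with hv | hv
      · exact h.ne_left (hv.symm.trans (Eq.symm h1))
      · exact hv.2.1 (Eq.symm h1)
  · rintro (h1 | h1)
    · exact hu.2.2.1 h1.symm
    · rcases hv with hv | hv
      · exact h.ne_right (hv.symm.trans (Eq.symm h1))
      · exact hv.2.2.1 (Eq.symm h1)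
  · rintro i hi (h1 | h1)
    · exact hu.2.2.2 i hi h1.symm
    · rcases hv with hv | hv
      · exact (h.notMem i).1 (Eq.trans h1 hv)
      · exact hv.2.2.2 i hi (Eq.symm h1)

lemma no_outer_triangle [Finite V] (h : Trajectory G t₁ t₂ x f p N k) (hG : Critical G)
    {u v z : V} (hu : u ∈ h.outer) (hv : v ∈ h.outer) (hz : z ∈ h.outer) (huv : G.Adj u v)
    (huz : G.Adj u z) (hvz : G.Adj v z) : False := by
  obtain ⟨g, hg⟩ := h.orientable_outer hG
  have key : ∀ u v z : V, u ∈ h.outer → v ∈ h.outer → z ∈ h.outer → G.Adj u v →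
      G.Adj u z → G.Adj v z → ∀ b, G.Adj u b → b = v ∨ b = z := by
    intro u v z hu hv hz huv huz hvz b hub
    by_contra hb
    push Not at hb
    have hfu : f u = v ∨ f u = z := by
      have e1 := h.orient_outer hu hv huv
      have e2 := h.orient_outer hu hz huz
      have e3 := h.orient_outer hv hz hvz
      have := huv.ne
      have := huz.ne
      have := hvz.ne
      grind
    have hY : ∀ i < N, ¬ G.Adj u (p i) := by
      intro i hi hadj
      have := h.orient_eq hu hi hadj
      have := hv.2.2.2 i hi
      have := hz.2.2.2 i hi
      grind
    have hmem : ∀ b, G.Adj u b → b ∈ insert x h.outer := by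
      intro b hub
      have ht := h.not_adj_tips (Set.mem_insert_of_mem x hu)
      rcases h.cover b with rfl | rfl | rfl | ⟨i, hi, rfl⟩ | hb
      · exact Or.inl rfl
      · exact absurd hub ht.1
      · exact absurd hub ht.2
      · exact absurd hub (hY i hi)
      · exact Or.inr hb
    obtain ⟨e, hue, hbe, -⟩ := h.exists_common hG hu (hmem b hub) hub
    have hu' : u ∈ insert x h.outer := Or.inr hu
    have g1 := hg u hu' v (Or.inr hv) huv
    have g2 := hg u hu' z (Or.inr hz) huz
    have g3 := hg v (Or.inr hv) z (Or.inr hz) hvz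
    have g4 := hg u hu' b (hmem b hub) hub
    have g5 := hg u hu' e (hmem e hue) hue
    have g6 := hg b (hmem b hub) e (hmem e hue) hbe
    have := huv.ne
    have := huz.ne
    have := hvz.ne
    have := hub.ne
    have := hue.ne
    have := hbe.ne
    grind
  have k1 := key u v z hu hv hz huv huz hvz
  have k2 := key v u z hv hu hz huv.symm hvz huz
  have k3 := key z u v hz hu hv huz.symm hvz.symm huv
  refine hG.not_disconnected (A := {u, v, z}) (B := {u, v, z}ᶜ) ⟨u, by simp⟩
    ⟨t₁, by simpa using ⟨hu.2.1.symm, hv.2.1.symm, hz.2.1.symm⟩⟩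
    (fun y => em _) (fun y hy hy' => hy' hy) ?_
  rintro a (rfl | rfl | rfl) b hb hab
  · have := k1 b hab
    simp only [Set.mem_compl_iff, Set.mem_insert_iff, Set.mem_singleton_iff] at hb; tauto
  · have := k2 b hab
    simp only [Set.mem_compl_iff, Set.mem_insert_iff, Set.mem_singleton_iff] at hb; tauto
  · have := k3 b hab
    simp only [Set.mem_compl_iff, Set.mem_insert_iff, Set.mem_singleton_iff] at hb; tauto

lemma adj_apex_of_adj [Finite V] (h : Trajectory G t₁ t₂ x f p N k) (hG : Critical G)
    {u v : V} (hu : u ∈ h.outer) (hv : v ∈ h.outer) (huv : G.Adj u v) :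
    G.Adj u x ∧ G.Adj v x := by
  obtain ⟨z, huz, hvz, h1, h2⟩ := h.exists_common hG hu (Or.inr hv) huv
  rcases h.cover z with rfl | rfl | rfl | ⟨i, hi, rfl⟩ | hz
  · exact ⟨huz, hvz⟩
  · exact absurd rfl h1
  · exact absurd rfl h2
  · have e1 := h.orient_eq hu hi huz
    have e2 := h.orient_eq hv hi hvz
    have e3 := h.orient_outer hu hv huv
    have := hu.2.2.2 i hi
    have := hv.2.2.2 i hi
    grind
  · exact (h.no_outer_triangle hG hu hv hz huv huz hvz).elim

lemma adj_apex [Finite V] (h : Trajectory G t₁ t₂ x f p N k) (hG : Critical G)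
    {w : V} (hw : w ∈ h.outer) : G.Adj w x := by
  obtain ⟨a, ha⟩ := hG.exists_adj w
  obtain ⟨b, hb, hba⟩ := hG.exists_adj_ne w a
  have ht := h.not_adj_tips (Set.mem_insert_of_mem x hw)
  rcases h.cover a with rfl | rfl | rfl | ⟨i, hi, rfl⟩ | ha'
  · exact ha
  · exact absurd ha ht.1
  · exact absurd ha ht.2
  · rcases h.cover b with rfl | rfl | rfl | ⟨j, hj, rfl⟩ | hb'
    · exact hb
    · exact absurd hb ht.1
    · exact absurd hb ht.2
    · exact absurd ((h.orient_eq hw hj hb).symm.trans (h.orient_eq hw hi ha)) hba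
    · exact (h.adj_apex_of_adj hG hw hb' hb).1
  · exact (h.adj_apex_of_adj hG hw ha' ha).1

lemma outer_edge_unique [Finite V] (h : Trajectory G t₁ t₂ x f p N k) (hG : Critical G)
    {u v a b : V} (hu : u ∈ h.outer) (hv : v ∈ h.outer) (ha : a ∈ h.outer) (hb : b ∈ h.outer)
    (huv : G.Adj u v) (hab : G.Adj a b) : a = u ∧ b = v ∨ a = v ∧ b = u := by
  obtain ⟨g, hg⟩ := h.orientable_outer hG
  have hx : x ∈ insert x h.outer := Or.inl rfl
  have g1 := hg u (Or.inr hu) x hx (h.adj_apex hG hu)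
  have g2 := hg v (Or.inr hv) x hx (h.adj_apex hG hv)
  have g3 := hg a (Or.inr ha) x hx (h.adj_apex hG ha)
  have g4 := hg b (Or.inr hb) x hx (h.adj_apex hG hb)
  have g5 := hg u (Or.inr hu) v (Or.inr hv) huv
  have g6 := hg a (Or.inr ha) b (Or.inr hb) hab
  have := huv.ne
  have := hab.ne
  have := hu.1
  have := hv.1
  have := ha.1
  have := hb.1
  grind

lemma isDoubler [Finite V] (h : Trajectory G t₁ t₂ x f p N k) (hG : Critical G)
    {w : V} (hw : w ∈ h.outer) (hno : ∀ u ∈ h.outer, ¬ G.Adj w u) :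
    ∃ i < N, IsDoubler G x w (p i) := by
  have hwx := h.adj_apex hG hw
  have ht := h.not_adj_tips (Set.mem_insert_of_mem x hw)
  have key : ∀ b, G.Adj w b → b = x ∨ ∃ i < N, b = p i := by
    intro b hb
    rcases h.cover b with rfl | rfl | rfl | hb' | hb'
    · exact Or.inl rfl
    · exact absurd hb ht.1
    · exact absurd hb ht.2
    · exact Or.inr hb'
    · exact absurd hb (hno b hb')
  obtain ⟨z, hwz, hxz, -⟩ := h.exists_common hG hw (Or.inl rfl) hwx
  obtain rfl | ⟨i, hi, rfl⟩ := key z hwz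
  · exact absurd rfl hxz.ne
  refine ⟨i, hi, hxz, fun b => ⟨fun hb => ?_, ?_⟩⟩
  · rcases key b hb with rfl | ⟨j, hj, rfl⟩
    · exact Or.inl rfl
    · exact Or.inr ((h.orient_eq hw hj hb).symm.trans (h.orient_eq hw hi hwz))
  · rintro (rfl | rfl)
    · exact hwx
    · exact hwz

end Trajectory

/-- The structure of an obstruction that is not biconnected: the tadpole `e 0, …, e (N - 1)` with
closing vertex `e k`, a pendant triangle on `e 0` with tips `e N` and `e (N + 1)`, the apex
`e (N + 2)`, possibly one triangle `e (N + 2), e (N + 3), e (N + 4)` at the apex, and doublers. -/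
structure Config {V : Type} (G : SimpleGraph V) (e : ℕ → V) (N k M : ℕ) : Prop where
  crit : Critical G
  le : k + 3 ≤ N
  size : M = N + 3 ∨ M = N + 5
  inj : ∀ i < M, ∀ j < M, e i = e j → i = j
  cyc : ∀ i < N, ∀ j < N, G.Adj (e i) (e j) ↔
    i + 1 = j ∨ j + 1 = i ∨ (i = k ∧ j + 1 = N) ∨ (j = k ∧ i + 1 = N)
  nbr_left : ∀ b, G.Adj (e N) b ↔ b = e 0 ∨ b = e (N + 1)
  nbr_right : ∀ b, G.Adj (e (N + 1)) b ↔ b = e 0 ∨ b = e N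
  nbr_s : M = N + 5 → ∀ b, G.Adj (e (N + 3)) b ↔ b = e (N + 2) ∨ b = e (N + 4)
  adj_q : M = N + 5 → G.Adj (e (N + 4)) (e (N + 2))
  nbr_q : M = N + 5 → ∀ b, G.Adj (e (N + 4)) b → b = e (N + 2) ∨ b = e (N + 3) ∨ ∃ i < N, b = e i
  unique_q : M = N + 5 → ∀ i < N, ∀ j < N, G.Adj (e (N + 4)) (e i) → G.Adj (e (N + 4)) (e j) →
    i = j
  cover : ∀ v, (∃ i < M, v = e i) ∨ ∃ i < N, IsDoubler G (e (N + 2)) v (e i)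

theorem Trajectory.exists_config {V : Type} [Finite V] {G : SimpleGraph V} {t₁ t₂ x : V}
    {f : V → V} {p : ℕ → V} {N k : ℕ} (h : Trajectory G t₁ t₂ x f p N k) (hG : Critical G) :
    ∃ e M, Config G e N k M := by
  classical
  have hle := h.le
  have hT := h.pendant
  have ht12 := hT.top.ne
  have n1 : ∀ b, G.Adj t₁ b ↔ b = p 0 ∨ b = t₂ := fun b =>
    ⟨hT.nbr_left b, by rintro (rfl | rfl); exacts [hT.left.symm, hT.top]⟩
  have n2 : ∀ b, G.Adj t₂ b ↔ b = p 0 ∨ b = t₁ := fun b =>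
    ⟨hT.nbr_right b, by rintro (rfl | rfl); exacts [hT.right.symm, hT.top.symm]⟩
  by_cases hpair : ∃ s ∈ h.outer, ∃ q ∈ h.outer, G.Adj s q ∧ f s = q
  · obtain ⟨s, hs, q, hq, hsq, hfs⟩ := hpair
    have hsx := h.adj_apex hG hs
    have hqx := h.adj_apex hG hq
    have hs' := hs
    have hq' := hq
    obtain ⟨s1, s2, s3, s4⟩ := hs'
    obtain ⟨q1, q2, q3, q4⟩ := hq'
    have ns : ∀ b, G.Adj s b → b = x ∨ b = q := by
      intro b hb
      have ht := h.not_adj_tips (Set.mem_insert_of_mem x hs)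
      rcases h.cover b with rfl | rfl | rfl | ⟨i, hi, rfl⟩ | hb'
      · exact Or.inl rfl
      · exact absurd hb ht.1
      · exact absurd hb ht.2
      · exact absurd ((h.orient_eq hs hi hb).symm.trans hfs).symm (q4 i hi)
      · have := h.outer_edge_unique hG hs hq hs hb' hsq hb
        have := hsq.ne
        grind
    have nq : ∀ b, G.Adj q b → b = x ∨ b = s ∨ ∃ i < N, b = p i := by
      intro b hb
      have ht := h.not_adj_tips (Set.mem_insert_of_mem x hq)
      rcases h.cover b with rfl | rfl | rfl | hb' | hb'
      · exact Or.inl rfl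
      · exact absurd hb ht.1
      · exact absurd hb ht.2
      · exact Or.inr (Or.inr hb')
      · have := h.outer_edge_unique hG hs hq hq hb' hsq hb
        have := hsq.ne
        grind
    obtain ⟨e, he, eN, eN1, eN2, eN3, eN4⟩ : ∃ e : ℕ → V, (∀ i < N, e i = p i) ∧ e N = t₁ ∧
        e (N + 1) = t₂ ∧ e (N + 2) = x ∧ e (N + 3) = s ∧ e (N + 4) = q :=
      ⟨fun i => if i < N then p i else if i = N then t₁ else if i = N + 1 then t₂ else
        if i = N + 2 then x else if i = N + 3 then s else q,
        fun i hi => by simp [hi], by simp, by simp, by simp, by simp, by simp⟩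
    have e0 := he 0 (by omega)
    refine ⟨e, N + 5, hG, hle, Or.inr rfl, ?_, ?_, ?_, ?_, ?_, ?_, ?_, ?_, ?_⟩
    · have key : ∀ i < N + 5, (i < N ∧ e i = p i) ∨ i = N ∨ i = N + 1 ∨ i = N + 2 ∨ i = N + 3 ∨
          i = N + 4 := fun i hi => by
            rcases lt_or_ge i N with h1 | h1
            · exact Or.inl ⟨h1, he i h1⟩
            · omega
      have := h.ne_left
      have := h.ne_right
      have := hsq.ne
      have hn := h.notMem
      have hinj := h.inj
      intro i hi j hj hij
      rcases key i hi with ⟨hi', hi''⟩ | rfl | rfl | rfl | rfl | rfl <;>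
        rcases key j hj with ⟨hj', hj''⟩ | rfl | rfl | rfl | rfl | rfl <;> grind
    · intro i hi j hj
      rw [he i hi, he j hj, h.adj_iff hi hj]
    · intro b; rw [eN, eN1, e0, n1]
    · intro b; rw [eN, eN1, e0, n2]
    · intro _ b
      rw [eN3, eN2, eN4]
      refine ⟨ns b, ?_⟩
      rintro (rfl | rfl)
      · exact hsx
      · exact hsq
    · intro _; rw [eN4, eN2]; exact hqx
    · intro _ b hb
      rw [eN4] at hb
      rw [eN2, eN3]
      rcases nq b hb with h1 | h1 | ⟨i, hi, h1⟩
      · exact Or.inl h1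
      · exact Or.inr (Or.inl h1)
      · exact Or.inr (Or.inr ⟨i, hi, h1.trans (he i hi).symm⟩)
    · intro _ i hi j hj h1 h2
      rw [eN4, he i hi] at h1
      rw [eN4, he j hj] at h2
      exact h.inj i hi j hj ((h.orient_eq hq hi h1).symm.trans (h.orient_eq hq hj h2))
    · intro v
      rw [eN2]
      rcases h.cover v with rfl | rfl | rfl | ⟨i, hi, rfl⟩ | hv
      · exact Or.inl ⟨N + 2, by omega, eN2.symm⟩
      · exact Or.inl ⟨N, by omega, eN.symm⟩
      · exact Or.inl ⟨N + 1, by omega, eN1.symm⟩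
      · exact Or.inl ⟨i, by omega, (he i hi).symm⟩
      · by_cases hvs : v = s
        · exact Or.inl ⟨N + 3, by omega, by rw [eN3, hvs]⟩
        by_cases hvq : v = q
        · exact Or.inl ⟨N + 4, by omega, by rw [eN4, hvq]⟩
        obtain ⟨i, hi, hd⟩ := h.isDoubler hG hv fun u hu huv => by
          have := h.outer_edge_unique hG hs hq hv hu hsq huv
          tauto
        exact Or.inr ⟨i, hi, by rwa [he i hi]⟩
  · have hno : ∀ v ∈ h.outer, ∀ u ∈ h.outer, ¬ G.Adj v u := by
      intro v hv u hu huv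
      rcases h.orient_outer hv hu huv with h1 | h1
      · exact hpair ⟨v, hv, u, hu, huv, h1⟩
      · exact hpair ⟨u, hu, v, hv, huv.symm, h1⟩
    obtain ⟨e, he, eN, eN1, eN2⟩ : ∃ e : ℕ → V, (∀ i < N, e i = p i) ∧ e N = t₁ ∧
        e (N + 1) = t₂ ∧ e (N + 2) = x :=
      ⟨fun i => if i < N then p i else if i = N then t₁ else if i = N + 1 then t₂ else x,
        fun i hi => by simp [hi], by simp, by simp, by simp⟩
    have e0 := he 0 (by omega)
    refine ⟨e, N + 3, hG, hle, Or.inl rfl, ?_, ?_, ?_, ?_, by omega, by omega, by omega, by omega,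
      ?_⟩
    · have key : ∀ i < N + 3, (i < N ∧ e i = p i) ∨ i = N ∨ i = N + 1 ∨ i = N + 2 :=
        fun i hi => by
            rcases lt_or_ge i N with h1 | h1
            · exact Or.inl ⟨h1, he i h1⟩
            · omega
      have := h.ne_left
      have := h.ne_right
      have hn := h.notMem
      have hinj := h.inj
      intro i hi j hj hij
      rcases key i hi with ⟨hi', hi''⟩ | rfl | rfl | rfl <;>
        rcases key j hj with ⟨hj', hj''⟩ | rfl | rfl | rfl <;> grind
    · intro i hi j hj
      rw [he i hi, he j hj, h.adj_iff hi hj]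
    · intro b; rw [eN, eN1, e0, n1]
    · intro b; rw [eN, eN1, e0, n2]
    · intro v
      rw [eN2]
      rcases h.cover v with rfl | rfl | rfl | ⟨i, hi, rfl⟩ | hv
      · exact Or.inl ⟨N + 2, by omega, eN2.symm⟩
      · exact Or.inl ⟨N, by omega, eN.symm⟩
      · exact Or.inl ⟨N + 1, by omega, eN1.symm⟩
      · exact Or.inl ⟨i, by omega, (he i hi).symm⟩
      · obtain ⟨i, hi, hd⟩ := h.isDoubler hG hv (hno v hv)
        exact Or.inr ⟨i, hi, by rwa [he i hi]⟩

namespace Config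

variable {V : Type} {G : SimpleGraph V} {e : ℕ → V} {N k M : ℕ}

lemma adj_tadpole (h : Config G e N k M) {i j : ℕ} (hi : i < N) (hj : j < N)
    (hij : i + 1 = j ∨ j + 1 = i ∨ (i = k ∧ j + 1 = N) ∨ (j = k ∧ i + 1 = N)) :
    G.Adj (e i) (e j) :=
  (h.cyc i hi j hj).2 hij

lemma adj_tips (h : Config G e N k M) {i j : ℕ} (hi : i = N) (hj : j = N + 1) :
    G.Adj (e i) (e j) :=
  hi ▸ (h.nbr_left _).2 (Or.inr (by rw [hj]))

lemma adj_tip_base (h : Config G e N k M) {i j : ℕ} (hi : N ≤ i ∧ i ≤ N + 1) (hj : j = 0) :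
    G.Adj (e i) (e j) := by
  obtain rfl | rfl : i = N ∨ i = N + 1 := by omega
  · exact (h.nbr_left _).2 (Or.inl (by rw [hj]))
  · exact (h.nbr_right _).2 (Or.inl (by rw [hj]))

lemma adj_apex_triangle (h : Config G e N k M) {i j : ℕ} (hi : N + 2 ≤ i) (hiM : i < M)
    (hj : N + 2 ≤ j) (hjM : j < M) (hij : i ≠ j) : G.Adj (e i) (e j) := by
  have hsize := h.size
  have hM : M = N + 5 := by omega
  have h1 := h.adj_q hM
  have h2 := (h.nbr_s hM _).2 (Or.inl rfl)
  have h3 := (h.nbr_s hM _).2 (Or.inr rfl)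
  have hi : i = N + 2 ∨ i = N + 3 ∨ i = N + 4 := by omega
  have hj : j = N + 2 ∨ j = N + 3 ∨ j = N + 4 := by omega
  rcases hi with rfl | rfl | rfl <;> rcases hj with rfl | rfl | rfl <;>
    first | omega | assumption | (symm; assumption)

lemma connected_interval (h : Config G e N k M) {a b : ℕ} (hab : a < b) (hbM : b ≤ M)
    (hb : b ≤ N ∨ (N ≤ a ∧ b ≤ N + 2) ∨ N + 2 ≤ a) :
    (G.induce {v | ∃ i, a ≤ i ∧ i < b ∧ v = e i}).Connected := by
  have hsize := h.size
  rw [connected_induce_iff_reachable]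
  have hmem : ∀ i, a ≤ i → i < b → e i ∈ {v | ∃ i, a ≤ i ∧ i < b ∧ v = e i} :=
    fun i h1 h2 => ⟨i, h1, h2, rfl⟩
  have key : ∀ i (h1 : a ≤ i) (h2 : i < b),
      (G.induce {v | ∃ i, a ≤ i ∧ i < b ∧ v = e i}).Reachable ⟨e a, hmem a le_rfl hab⟩
        ⟨e i, hmem i h1 h2⟩ := by
    intro i h1
    induction i, h1 using Nat.le_induction with
    | base => exact fun _ => Reachable.refl _
    | succ i hi ih =>
      intro h2
      refine (ih (by omega)).trans (Adj.reachable ?_)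
      by_cases h1 : i + 1 < N
      · exact h.adj_tadpole (by omega) h1 (Or.inl rfl)
      by_cases h2 : i + 1 = N + 1
      · exact h.adj_tips (by omega) h2
      · exact h.adj_apex_triangle (by omega) (by omega) (by omega) (by omega) (by omega)
  refine ⟨⟨e a, hmem a le_rfl hab⟩, ?_⟩
  rintro _ ⟨i, hi, hi', rfl⟩ _ ⟨j, hj, hj', rfl⟩
  exact (key i hi hi').symm.trans (key j hj hj')

/-- A minor model all of whose branch sets are intervals of the enumeration `e`. -/
lemma isMinorOf_of_intervals (h : Config G e N k M) {n : ℕ} {E : List (ℕ × ℕ)}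
    (L W : List (ℕ × ℕ)) (hL : L.length = n := by rfl)
    (h1 : ∀ p ∈ L, p.1 < p.2 ∧ p.2 ≤ M ∧
        (p.2 ≤ N ∨ (N ≤ p.1 ∧ p.2 ≤ N + 2) ∨ N + 2 ≤ p.1) := by
      simp only [List.forall_mem_cons, List.not_mem_nil, false_imp_iff, implies_true, and_true]
      omega)
    (h2 : L.Pairwise (fun p q => p.2 ≤ q.1 ∨ q.2 ≤ p.1) := by
      simp only [List.pairwise_cons, List.forall_mem_cons, List.not_mem_nil, false_imp_iff,
        implies_true, and_true, List.Pairwise.nil]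
      omega)
    (h3 : List.Forall₂ (fun q w => (L.getD q.1 (0, 0)).1 ≤ w.1 ∧ w.1 < (L.getD q.1 (0, 0)).2 ∧
        (L.getD q.2 (0, 0)).1 ≤ w.2 ∧ w.2 < (L.getD q.2 (0, 0)).2 ∧
        G.Adj (e w.1) (e w.2)) E W := by
      simp only [List.forall₂_cons, List.forall₂_nil_left_iff, List.getD_cons_zero,
        List.getD_cons_succ, and_true]
      and_intros <;> first
      | assumption
      | exact Config.adj_tip_base (by assumption) (by omega) (by omega)
      | exact Config.adj_tips (by assumption) (by omega) (by omega)
      | exact Config.adj_apex_triangle (by assumption) (by omega) (by omega) (by omega) (by omega)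
          (by omega)
      | exact Config.adj_tadpole (by assumption) (by omega) (by omega) (by omega)
      | omega) :
    IsMinorOf (mkGraph n E) G := by
  subst hL
  have h3' : ∀ a b : Fin L.length, ((a : ℕ), (b : ℕ)) ∈ E → ∃ i j, L[a].1 ≤ i ∧ i < L[a].2 ∧
      L[b].1 ≤ j ∧ j < L[b].2 ∧ G.Adj (e i) (e j) := by
    intro a b hab
    obtain ⟨hlen, hget⟩ := List.forall₂_iff_get.1 h3
    obtain ⟨i, hi, hE⟩ := List.getElem_of_mem hab
    have hw := hget i hi (hlen ▸ hi)
    simp only [List.get_eq_getElem, hE, List.getD_eq_getElem _ _ a.2,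
      List.getD_eq_getElem _ _ b.2] at hw
    exact ⟨_, _, hw⟩
  refine ⟨fun w => {v | ∃ i, L[w].1 ≤ i ∧ i < L[w].2 ∧ v = e i}, fun w => ?_, ?_, ?_⟩
  · obtain ⟨ha, hb, hc⟩ := h1 L[w] (List.getElem_mem _)
    exact h.connected_interval ha hb hc
  · intro w w' hww
    rw [Set.disjoint_left]
    rintro _ ⟨i, hi, hi', rfl⟩ ⟨j, hj, hj', hij⟩
    have hw := h1 L[w] (List.getElem_mem _)
    have hw' := h1 L[w'] (List.getElem_mem _)
    have := h.inj i (by omega) j (by omega) hij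
    have hp := List.pairwise_iff_getElem.1 h2
    have hne : (w : ℕ) ≠ w' := fun h => hww (Fin.ext h)
    rcases lt_or_gt_of_ne hne with hlt | hlt
    · have := hp w w' w.2 w'.2 hlt
      simp only [Fin.getElem_fin] at *
      omega
    · have := hp w' w w'.2 w.2 hlt
      simp only [Fin.getElem_fin] at *
      omega
  · intro w w' hww
    rw [mkGraph, SimpleGraph.fromRel_adj] at hww
    rcases hww.2 with hE | hE
    · obtain ⟨i, j, a1, a2, a3, a4, hij⟩ := h3' _ _ hE
      exact ⟨e i, ⟨i, a1, a2, rfl⟩, e j, ⟨j, a3, a4, rfl⟩, hij⟩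
    · obtain ⟨i, j, a1, a2, a3, a4, hij⟩ := h3' _ _ hE
      exact ⟨e j, ⟨j, a3, a4, rfl⟩, e i, ⟨i, a1, a2, rfl⟩, hij.symm⟩

/-- The tadpole vertex `e i` has a neighbour in the branch set of the apex. -/
def Touched (_ : Config G e N k M) (i : ℕ) : Prop :=
  ∃ m, N + 2 ≤ m ∧ m < M ∧ G.Adj (e m) (e i)

end Config

namespace Config

variable {V : Type} {G : SimpleGraph V} {e : ℕ → V} {N k M : ℕ}

lemma not_isMinorOf (h : Config G e N k M) {n : ℕ} {H : SimpleGraph (Fin n)}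
    (hH : ⟨n, H⟩ ∈ OList.take 15) : ¬ IsMinorOf H G :=
  h.crit.not_minor ⟨n, H⟩ hH

/-- The cycle through the attachment vertex has three vertices with a neighbour at the apex. -/
lemma not_three_touched (h : Config G e N 0 M) {j : ℕ} (hj : 2 ≤ j ∧ j + 1 < N)
    (t : h.Touched j) (t₁ : h.Touched 1) (t₂ : h.Touched (N - 1)) : False := by
  have hsize := h.size
  obtain ⟨m, hm, hm', a⟩ := t
  obtain ⟨m₁, hm₁, hm₁', a₁⟩ := t₁
  obtain ⟨m₂, hm₂, hm₂', a₂⟩ := t₂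
  exact h.not_isMinorOf (H := O7) (by simp [OList]) <| h.isMinorOf_of_intervals
    [(N, N + 1), (N + 1, N + 2), (N + 2, M), (2, N - 1), (1, 2), (N - 1, N), (0, 1)]
    [(N, N + 1), (N, 0), (N + 1, 0), (m, j), (m₁, 1), (m₂, N - 1), (2, 1), (N - 2, N - 1), (1, 0),
      (N - 1, 0)]

/-- The apex triangle is attached to the cycle through `e 0` at `e j`, and the apex at `e i`. -/
lemma not_adj_q_of_touched (h : Config G e N 0 M) (hM : M = N + 5) {i j : ℕ}
    (hi : 1 ≤ i ∧ i < N) (hj : 1 ≤ j ∧ j < N) (hij : i ≠ j) (a : G.Adj (e (N + 4)) (e j))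
    (t : h.Touched i) : False := by
  obtain ⟨m, hm, hm', b⟩ := t
  have hmq : m = N + 2 := by
    have h1 : m ≠ N + 4 := by rintro rfl; exact hij (h.unique_q hM i hi.2 j hj.2 b a)
    have h2 : m ≠ N + 3 := by
      rintro rfl
      rcases (h.nbr_s hM _).1 b with h2 | h2
      · have := h.inj _ (by omega) _ (by omega) h2; omega
      · have := h.inj _ (by omega) _ (by omega) h2; omega
    omega
  subst hmq
  replace a := a.symm
  replace b := b.symm
  refine h.not_isMinorOf (H := O5) (by simp [OList]) ?_
  rcases lt_or_gt_of_ne hij with hlt | hlt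
  · exact h.isMinorOf_of_intervals
      [(N, N + 1), (N + 1, N + 2), (0, 1), (1, i + 1), (i + 1, N), (N + 2, N + 3),
        (N + 4, N + 5), (N + 3, N + 4)]
      [(N, N + 1), (N, 0), (N + 1, 0), (0, 1), (0, N - 1), (i, i + 1), (i, N + 2), (j, N + 4),
        (N + 2, N + 4), (N + 2, N + 3), (N + 4, N + 3)]
  · exact h.isMinorOf_of_intervals
      [(N, N + 1), (N + 1, N + 2), (0, 1), (j + 1, N), (1, j + 1), (N + 2, N + 3),
        (N + 4, N + 5), (N + 3, N + 4)]
      [(N, N + 1), (N, 0), (N + 1, 0), (0, N - 1), (0, 1), (j + 1, j), (i, N + 2), (j, N + 4),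
        (N + 2, N + 4), (N + 2, N + 3), (N + 4, N + 3)]

lemma not_two_adj_apex (h : Config G e N 0 M) (hM : M = N + 5) {i j : ℕ} (hi : 1 ≤ i)
    (hij : i < j) (hj : j < N) (a : G.Adj (e (N + 2)) (e i)) (b : G.Adj (e (N + 2)) (e j)) :
    False := by
  replace a := a.symm
  replace b := b.symm
  exact h.not_isMinorOf (H := O4) (by simp [OList]) <| h.isMinorOf_of_intervals
    [(N, N + 1), (N + 1, N + 2), (0, 1), (1, i + 1), (i + 1, N), (N + 2, N + 3), (N + 3, N + 4),
      (N + 4, N + 5)]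
    [(N, N + 1), (N, 0), (N + 1, 0), (0, 1), (0, N - 1), (i, i + 1), (i, N + 2), (j, N + 2),
      (N + 2, N + 3), (N + 2, N + 4), (N + 3, N + 4)]

/-- The cycle of a tadpole with a nontrivial tail has two inner vertices adjacent to the apex
branch set. -/
lemma not_two_touched_on_cycle (h : Config G e N k M) (hk : 1 ≤ k) {i j : ℕ} (hi : k < i)
    (hij : i < j) (hj : j < N) (t₀ : h.Touched 0) (t₁ : h.Touched i) (t₂ : h.Touched j) :
    False := by
  have hsize := h.size
  obtain ⟨m, hm, hm', a⟩ := t₀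
  obtain ⟨m₁, hm₁, hm₁', a₁⟩ := t₁
  obtain ⟨m₂, hm₂, hm₂', a₂⟩ := t₂
  replace a₁ := a₁.symm
  replace a₂ := a₂.symm
  exact h.not_isMinorOf (H := O7) (by simp [OList]) <| h.isMinorOf_of_intervals
    [(N, N + 1), (N + 1, N + 2), (k + 1, i + 1), (i + 1, N), (N + 2, M), (k, k + 1), (0, k)]
    [(N, N + 1), (N, 0), (N + 1, 0), (i, i + 1), (i, m₁), (k + 1, k), (j, m₂), (N - 1, k),
      (m, 0), (k, k - 1)]

lemma not_touched_of_long_tail (h : Config G e N k M) {i a b : ℕ}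
    (hab : N = k + 3 ∧ (a = k + 1 ∧ b = k + 2 ∨ a = k + 2 ∧ b = k + 1)) (hi : 1 ≤ i ∧ i < k)
    (t₀ : h.Touched 0) (t₁ : h.Touched i) (t₂ : h.Touched a) : False := by
  have hsize := h.size
  obtain ⟨m, hm, hm', c⟩ := t₀
  obtain ⟨m₁, hm₁, hm₁', c₁⟩ := t₁
  obtain ⟨m₂, hm₂, hm₂', c₂⟩ := t₂
  replace c := c.symm
  replace c₁ := c₁.symm
  obtain ⟨hN, hab⟩ := hab
  rcases hab with hab | hab <;>
    exact h.not_isMinorOf (H := O5) (by simp [OList]) <| h.isMinorOf_of_intervals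
    [(N, N + 1), (N + 1, N + 2), (0, 1), (1, k), (N + 2, M), (k, k + 1), (a, a + 1), (b, b + 1)]
    [(N, N + 1), (N, 0), (N + 1, 0), (0, 1), (0, m), (i, m₁), (k - 1, k), (m₂, a), (k, a), (k, b),
      (a, b)]

lemma not_linked (h : Config G e N k M) (hM : M = N + 5) (hk : 1 ≤ k) {a b m m' : ℕ}
    (hab : N = k + 3 ∧ (a = k + 1 ∧ b = k + 2 ∨ a = k + 2 ∧ b = k + 1))
    (hm : m = N + 2 ∧ m' = N + 4 ∨ m = N + 4 ∧ m' = N + 2) (c₀ : G.Adj (e m) (e 0))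
    (c₁ : G.Adj (e m') (e a)) : False := by
  subst hM
  replace c₁ := c₁.symm
  obtain ⟨hN, hab⟩ := hab
  rcases hab with hab | hab <;> rcases hm with hm | hm <;>
    exact h.not_isMinorOf (H := O11) (by simp [OList]) <| h.isMinorOf_of_intervals
    [(b, b + 1), (k, k + 1), (a, a + 1), (m', m' + 1), (m, m + 1), (N + 3, N + 4), (N, N + 1),
      (N + 1, N + 2), (0, k)]
    [(b, k), (b, a), (k, a), (m', m), (m', N + 3), (m, N + 3), (N, N + 1), (N, 0), (N + 1, 0),
      (a, m'), (k, k - 1), (m, 0)]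

lemma not_linked_tail (h : Config G e N k M) (hM : M = N + 5) (hN : N = k + 3) {i m m' : ℕ}
    (hi : 1 ≤ i ∧ i ≤ k) (hm : m = N + 2 ∧ m' = N + 4 ∨ m = N + 4 ∧ m' = N + 2)
    (c₀ : G.Adj (e m) (e 0)) (c₁ : G.Adj (e m') (e i)) : False := by
  replace c₀ := c₀.symm
  replace c₁ := c₁.symm
  subst hM
  rcases hm with hm | hm <;>
    exact h.not_isMinorOf (H := O12) (by simp [OList]) <| h.isMinorOf_of_intervals
    [(N, N + 1), (N + 1, N + 2), (0, 1), (1, k + 1), (k + 1, k + 2), (k + 2, k + 3), (m', m' + 1),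
      (m, m + 1), (N + 3, N + 4)]
    [(N, N + 1), (N, 0), (N + 1, 0), (k, k + 1), (k, k + 2), (k + 1, k + 2), (m', m),
      (m', N + 3), (m, N + 3), (0, 1), (0, m), (i, m')]

lemma not_adj_apex_of_cycle (h : Config G e N k M) (hM : M = N + 5) (hk : 1 ≤ k) {a b : ℕ}
    (hab : N = k + 3 ∧ (a = k + 1 ∧ b = k + 2 ∨ a = k + 2 ∧ b = k + 1))
    (c₀ : G.Adj (e (N + 2)) (e 0)) (c₁ : G.Adj (e (N + 2)) (e a)) : False := by
  replace c₀ := c₀.symm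
  subst hM
  obtain ⟨hN, hab⟩ := hab
  rcases hab with hab | hab <;>
    exact h.not_isMinorOf (H := O12) (by simp [OList]) <| h.isMinorOf_of_intervals
    [(N, N + 1), (N + 1, N + 2), (0, 1), (N + 2, N + 3), (N + 3, N + 4), (N + 4, N + 5),
      (a, a + 1), (1, k + 1), (b, b + 1)]
    [(N, N + 1), (N, 0), (N + 1, 0), (N + 2, N + 3), (N + 2, N + 4), (N + 3, N + 4), (a, k),
      (a, b), (k, b), (0, N + 2), (0, 1), (N + 2, a)]

lemma not_adj_apex_of_tail (h : Config G e N k M) (hM : M = N + 5) (hN : N = k + 3) {i : ℕ}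
    (hi : 1 ≤ i ∧ i ≤ k) (c₀ : G.Adj (e (N + 2)) (e 0)) (c₁ : G.Adj (e (N + 2)) (e i)) :
    False := by
  replace c₀ := c₀.symm
  replace c₁ := c₁.symm
  subst hM
  exact h.not_isMinorOf (H := O13) (by simp [OList]) <| h.isMinorOf_of_intervals
    [(N, N + 1), (N + 1, N + 2), (0, 1), (1, k + 1), (k + 1, k + 2), (k + 2, k + 3),
      (N + 3, N + 4), (N + 4, N + 5), (N + 2, N + 3)]
    [(N, N + 1), (N, 0), (N + 1, 0), (k, k + 1), (k, k + 2), (k + 1, k + 2), (N + 3, N + 4),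
      (N + 3, N + 2), (N + 4, N + 2), (0, 1), (0, N + 2), (i, N + 2)]

lemma not_three_touched_on_tail (h : Config G e N k M) (hN : N = k + 3) {i : ℕ}
    (hi : 2 ≤ i ∧ i ≤ k) (t₀ : h.Touched 0) (t₁ : h.Touched 1) (t₂ : h.Touched i) : False := by
  have hsize := h.size
  obtain ⟨m, hm, hm', c⟩ := t₀
  obtain ⟨m₁, hm₁, hm₁', c₁⟩ := t₁
  obtain ⟨m₂, hm₂, hm₂', c₂⟩ := t₂
  replace c := c.symm
  replace c₁ := c₁.symm
  exact h.not_isMinorOf (H := O4) (by simp [OList]) <| h.isMinorOf_of_intervals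
    [(N, N + 1), (N + 1, N + 2), (0, 1), (1, 2), (N + 2, M), (2, k + 1), (k + 1, k + 2),
      (k + 2, k + 3)]
    [(N, N + 1), (N, 0), (N + 1, 0), (0, 1), (0, m), (1, m₁), (1, 2), (m₂, i), (k, k + 1),
      (k, k + 2), (k + 1, k + 2)]

end Config

section

variable {V : Type} {G : SimpleGraph V}

lemma Critical.adj_of_nbr (hG : Critical G) {v a b : V} (hv : ∀ u, G.Adj v u → u = a ∨ u = b)
    (hva : G.Adj v a) : G.Adj a b := by
  by_contra hab
  refine hG.not_orientable a ?_
  refine ((hG.orientable_compl_pair hva fun w hw hw' => ?_).insert_leaf (v := v) (w := b)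
    fun u hu hvu => ?_).mono fun u hu => ?_
  · rcases hv w hw with rfl | rfl
    · exact hw'.ne rfl
    · exact hab hw'
  · exact (hv u hvu).resolve_left fun h => hu (Or.inr h)
  · by_cases huv : u = v
    · exact Or.inl huv
    · exact Or.inr fun h => h.elim huv hu

lemma Critical.not_nbr_pendant (hG : Critical G) {u v a b : V} (hT : PendantTriangle G v a b)
    (huv : G.Adj u v) (hv : ∀ w, G.Adj v w → w = u ∨ w = a ∨ w = b) (hua : u ≠ a) (hub : u ≠ b) :
    False := by
  classical
  obtain ⟨g, hg⟩ := hG.orientable_compl_pair huv fun w hw hw' => by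
    rcases hv w hw' with rfl | rfl | rfl
    · exact hw.ne rfl
    · exact (hT.nbr_left u hw.symm).elim huv.ne hub
    · exact (hT.nbr_right u hw.symm).elim huv.ne hua
  refine hG.not_orientable u ⟨fun w => if w = v then a else if w = a then b else
    if w = b then v else g w, fun w hw w' hw' hadj => ?_⟩
  have h1 := hT.nbr_left
  have h2 := hT.nbr_right
  have h3 := hg w
  have h4 := hg w'
  have h5 := hadj.symm
  have h6 := hadj.ne
  simp only [Set.mem_compl_iff, Set.mem_insert_iff, Set.mem_singleton_iff] at *
  grind

end

namespace Config

variable {V : Type} {G : SimpleGraph V} {e : ℕ → V} {N k M : ℕ}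

/-- Some vertex outside the enumeration is a doubler at `e i`. -/
def Doubled (_ : Config G e N k M) (i : ℕ) : Prop :=
  ∃ d, (∀ j < M, d ≠ e j) ∧ IsDoubler G (e (N + 2)) d (e i)

lemma Doubled.adj {h : Config G e N k M} {i : ℕ} (hd : h.Doubled i) :
    G.Adj (e (N + 2)) (e i) :=
  hd.choose_spec.2.adj

lemma touched_of_adj_apex (h : Config G e N k M) {i : ℕ} (hi : G.Adj (e (N + 2)) (e i)) :
    h.Touched i :=
  ⟨N + 2, le_rfl, by have := h.size; omega, hi⟩

/-- The pairs of indices that may be adjacent. -/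
lemma adj_cases (h : Config G e N k M) {i j : ℕ} (hij : i < j) (hj : j < M)
    (hadj : G.Adj (e i) (e j)) :
    (j < N ∧ (i + 1 = j ∨ (i = k ∧ j + 1 = N))) ∨ (i = 0 ∧ (j = N ∨ j = N + 1)) ∨
    (i = N ∧ j = N + 1) ∨ (i < N ∧ j = N + 2 ∧ G.Adj (e (N + 2)) (e i)) ∨
    (M = N + 5 ∧ i < N ∧ j = N + 4 ∧ G.Adj (e (N + 4)) (e i)) ∨ (N + 2 ≤ i ∧ M = N + 5) := by
  have hsize := h.size
  have hle := h.le
  have hN : ∀ j, j < M → i = N → j = 0 ∨ j = N + 1 ∨ ¬ G.Adj (e i) (e j) := by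
    rintro j hj rfl
    by_contra hno
    push Not at hno
    rcases (h.nbr_left _).1 hno.2.2 with h1 | h1
    · exact hno.1 (h.inj j hj 0 (by omega) h1)
    · exact hno.2.1 (h.inj j hj _ (by omega) h1)
  have hN1 : ∀ j, j < M → i = N + 1 → j = 0 ∨ j = N ∨ ¬ G.Adj (e i) (e j) := by
    rintro j hj rfl
    by_contra hno
    push Not at hno
    rcases (h.nbr_right _).1 hno.2.2 with h1 | h1
    · exact hno.1 (h.inj j hj 0 (by omega) h1)
    · exact hno.2.1 (h.inj j hj _ (by omega) h1)
  by_cases hjN : j < N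
  · have := (h.cyc i (by omega) j hjN).1 hadj
    omega
  by_cases hiN : N ≤ i
  · rcases (by omega : i = N ∨ i = N + 1 ∨ N + 2 ≤ i) with hi | hi | hi
    · rcases hN j hj hi with h1 | h1 | h1
      · omega
      · exact Or.inr (Or.inr (Or.inl ⟨hi, h1⟩))
      · exact absurd hadj h1
    · rcases hN1 j hj hi with h1 | h1 | h1
      · omega
      · omega
      · exact absurd hadj h1
    · exact Or.inr (Or.inr (Or.inr (Or.inr (Or.inr ⟨hi, by omega⟩))))
  · have hi : i < N := by omega
    rcases (by omega : j = N ∨ j = N + 1 ∨ j = N + 2 ∨ j = N + 3 ∨ j = N + 4) with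
      rfl | rfl | rfl | rfl | rfl
    · rcases (h.nbr_left _).1 hadj.symm with h1 | h1
      · have := h.inj i (by omega) 0 (by omega) h1; omega
      · have := h.inj i (by omega) _ (by omega) h1; omega
    · rcases (h.nbr_right _).1 hadj.symm with h1 | h1
      · have := h.inj i (by omega) 0 (by omega) h1; omega
      · have := h.inj i (by omega) _ (by omega) h1; omega
    · exact Or.inr (Or.inr (Or.inr (Or.inl ⟨hi, rfl, hadj.symm⟩)))
    · rcases (h.nbr_s (by omega) _).1 hadj.symm with h1 | h1
      · have := h.inj i (by omega) _ (by omega) h1; omega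
      · have := h.inj i (by omega) _ (by omega) h1; omega
    · exact Or.inr (Or.inr (Or.inr (Or.inr (Or.inl ⟨by omega, hi, rfl, hadj.symm⟩))))

lemma nbr_of_not_touched (h : Config G e N k M) {i : ℕ} (hi : i < N) (ht : ¬ h.Touched i) {b : V}
    (hb : G.Adj (e i) b) : (∃ j < N, b = e j ∧
      (i + 1 = j ∨ j + 1 = i ∨ (i = k ∧ j + 1 = N) ∨ (j = k ∧ i + 1 = N))) ∨
      (i = 0 ∧ (b = e N ∨ b = e (N + 1))) := by
  have hsize := h.size
  rcases h.cover b with ⟨j, hj, rfl⟩ | ⟨j, hj, hd⟩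
  · have hjN : j < N + 2 := by
      by_contra hj'
      exact ht ⟨j, by omega, hj, hb.symm⟩
    by_cases hjN' : j < N
    · exact Or.inl ⟨j, hjN', rfl, (h.cyc i hi j hjN').1 hb⟩
    · have := h.adj_cases (by omega) hj hb
      obtain rfl | rfl : j = N ∨ j = N + 1 := by omega
      · exact Or.inr ⟨by omega, Or.inl rfl⟩
      · exact Or.inr ⟨by omega, Or.inr rfl⟩
  · rcases (hd.nbr _).1 hb.symm with h1 | h1
    · have := h.inj i (by omega) _ (by omega) h1; omega
    · have := h.inj i (by omega) _ (by omega) h1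
      subst this
      exact absurd (h.touched_of_adj_apex hd.adj) ht

lemma touched_or_triangle (h : Config G e N k M) {i : ℕ} (hi : 1 ≤ i ∧ i < N) (hik : i ≠ k) :
    h.Touched i ∨ N = k + 3 ∧ k < i := by
  by_contra! hno
  obtain ⟨ht, hno⟩ := hno
  have hle := h.le
  obtain ⟨j, hj⟩ : ∃ j, i + 1 < N ∧ j = i + 1 ∨ i + 1 = N ∧ j = k := by
    by_cases h1 : i + 1 < N
    · exact ⟨i + 1, Or.inl ⟨h1, rfl⟩⟩
    · exact ⟨k, Or.inr ⟨by omega, rfl⟩⟩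
  have hadj := h.crit.adj_of_nbr (v := e i) (a := e (i - 1)) (b := e j) (fun b hb => by
    rcases h.nbr_of_not_touched hi.2 ht hb with ⟨l, hl, rfl, hl'⟩ | ⟨h1, -⟩
    · obtain rfl | rfl : l = i - 1 ∨ l = j := by omega
      · exact Or.inl rfl
      · exact Or.inr rfl
    · omega) (h.adj_tadpole (by omega) (by omega) (by omega))
  have := (h.cyc _ (by omega) _ (by omega)).1 hadj
  omega

lemma pendant_tips (h : Config G e N k M) : PendantTriangle G (e 0) (e N) (e (N + 1)) where
  left := ((h.nbr_left _).2 (Or.inl rfl)).symm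
  right := ((h.nbr_right _).2 (Or.inl rfl)).symm
  top := (h.nbr_left _).2 (Or.inr rfl)
  nbr_left b := (h.nbr_left b).1
  nbr_right b := (h.nbr_right b).1

lemma touched_zero (h : Config G e N k M) (hk : 1 ≤ k) : h.Touched 0 := by
  have hsize := h.size
  have hle := h.le
  by_contra ht
  refine h.crit.not_nbr_pendant (u := e 1) h.pendant_tips
    (h.adj_tadpole (by omega) (by omega) (by omega)) (fun w hw => ?_) (fun h1 => ?_) fun h1 => ?_
  · rcases h.nbr_of_not_touched (by omega) ht hw with ⟨l, hl, rfl, hl'⟩ | ⟨-, h1⟩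
    · obtain rfl : l = 1 := by omega
      exact Or.inl rfl
    · exact Or.inr h1
  · have := h.inj 1 (by omega) _ (by omega) h1; omega
  · have := h.inj 1 (by omega) _ (by omega) h1; omega

lemma touched_root (h : Config G e N k M) (hk : 1 ≤ k) (hN : N = k + 3)
    (t₁ : ¬ h.Touched (k + 1)) (t₂ : ¬ h.Touched (k + 2)) : h.Touched k := by
  have hsize := h.size
  by_contra ht
  have hT : PendantTriangle G (e k) (e (k + 1)) (e (k + 2)) := by
    refine ⟨h.adj_tadpole (by omega) (by omega) (by omega),
      h.adj_tadpole (by omega) (by omega) (by omega),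
      h.adj_tadpole (by omega) (by omega) (by omega), fun b hb => ?_, fun b hb => ?_⟩
    · rcases h.nbr_of_not_touched (by omega) t₁ hb with ⟨l, hl, rfl, hl'⟩ | ⟨h1, -⟩
      · obtain rfl | rfl : l = k ∨ l = k + 2 := by omega
        · exact Or.inl rfl
        · exact Or.inr rfl
      · omega
    · rcases h.nbr_of_not_touched (by omega) t₂ hb with ⟨l, hl, rfl, hl'⟩ | ⟨h1, -⟩
      · obtain rfl | rfl : l = k ∨ l = k + 1 := by omega
        · exact Or.inl rfl
        · exact Or.inr rfl
      · omega
  refine h.crit.not_nbr_pendant (u := e (k - 1)) hT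
    (h.adj_tadpole (by omega) (by omega) (by omega)) (fun w hw => ?_) (fun h1 => ?_) fun h1 => ?_
  · rcases h.nbr_of_not_touched (by omega) ht hw with ⟨l, hl, rfl, hl'⟩ | ⟨h1, -⟩
    · obtain rfl | rfl | rfl : l = k - 1 ∨ l = k + 1 ∨ l = k + 2 := by omega
      · exact Or.inl rfl
      · exact Or.inr (Or.inl rfl)
      · exact Or.inr (Or.inr rfl)
    · omega
  · have := h.inj _ (by omega) _ (by omega) h1; omega
  · have := h.inj _ (by omega) _ (by omega) h1; omega

lemma adj_q_or_adj_apex_of_touched (h : Config G e N k M) {i : ℕ} (hi : i < N)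
    (ht : h.Touched i) : G.Adj (e (N + 2)) (e i) ∨ M = N + 5 ∧ G.Adj (e (N + 4)) (e i) := by
  have hsize := h.size
  obtain ⟨m, hm, hm', hadj⟩ := ht
  have := h.adj_cases (by omega) hm' hadj.symm
  have h3 : m = N + 2 ∨ m = N + 4 := by omega
  rcases h3 with rfl | rfl
  · exact Or.inl hadj
  · exact Or.inr ⟨by omega, hadj⟩

end Config

namespace Config

variable {V : Type} {G : SimpleGraph V} {e : ℕ → V} {N k M : ℕ}

/-- The indices `i < j` may belong to adjacent vertices, when `X` and `Q` are lists of indices of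
non-neighbours of `e (N + 2)` and `e (N + 4)`. -/
def MaybeAdj (N k : ℕ) (X Q : List ℕ) (i j : ℕ) : Prop :=
  (j < N ∧ (i + 1 = j ∨ (i = k ∧ j + 1 = N))) ∨ (i = 0 ∧ (j = N ∨ j = N + 1)) ∨
    (i = N ∧ j = N + 1) ∨ (i < N ∧ j = N + 2 ∧ i ∉ X) ∨
    (i < N ∧ j = N + 4 ∧ i ∉ Q) ∨ N + 2 ≤ i

instance (N k : ℕ) (X Q : List ℕ) (i j : ℕ) : Decidable (MaybeAdj N k X Q i j) :=
  inferInstanceAs (Decidable (_ ∨ _))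

/-- An orientation of `G - e m`, given by an association list `L` on indices. The lists `X` and `Q`
contain indices of non-neighbours of the two attachment vertices of the apex triangle, `D` contains
indices without a doubler, and `U` contains indices oriented towards their only doubler. -/
lemma false_of_orientation (h : Config G e N k M) (m : ℕ) (L : List (ℕ × ℕ)) (X Q D U : List ℕ)
    (hX : ∀ i ∈ X, ¬ G.Adj (e (N + 2)) (e i))
    (hQ : ∀ i ∈ Q, ¬ G.Adj (e (N + 4)) (e i))
    (hD : ∀ i ∈ D, ¬ h.Doubled i)
    (hU : ∀ i ∈ U, ∀ d d', (∀ j < M, d ≠ e j) → (∀ j < M, d' ≠ e j) →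
      IsDoubler G (e (N + 2)) d (e i) → IsDoubler G (e (N + 2)) d' (e i) → d = d')
    (h1 : ∀ i < N, i = m ∨ i ∈ X ∨ i ∈ D ∨ (i ∈ U ∧ M ≤ (L.lookup i).getD 0) := by decide)
    (h2 : ∀ j < M, ∀ i < j, i ≠ m ∧ j ≠ m ∧ MaybeAdj N k X Q i j →
      (L.lookup i).getD 0 = j ∨ (L.lookup j).getD 0 = i := by decide) : False := by
  classical
  have hsize := h.size
  obtain ⟨τ, hτ⟩ : ∃ τ : ℕ → ℕ, ∀ i, τ i = (L.lookup i).getD 0 := ⟨_, fun _ => rfl⟩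
  simp only [← hτ] at h1 h2
  have hg : ∀ i, ∃ b, (τ i < M → b = e (τ i)) ∧ (i < N → i ≠ m → ∀ d, (∀ j < M, d ≠ e j) →
      IsDoubler G (e (N + 2)) d (e i) → b = d) := by
    intro i
    by_cases hi : i < N ∧ i ≠ m ∧ h.Doubled i
    · obtain ⟨hi, him, hd⟩ := hi
      rcases h1 i hi with h3 | h3 | h3 | h3
      · exact absurd h3 him
      · exact absurd hd.adj (hX i h3)
      · exact absurd hd (hD i h3)
      · obtain ⟨d, hd, hd'⟩ := hd
        exact ⟨d, fun h4 => by omega, fun _ _ d' h4 h5 => hU i h3.1 d d' hd h4 hd' h5⟩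
    · exact ⟨e (τ i), fun _ => rfl, fun h3 h4 d h5 h6 => absurd ⟨h3, h4, d, h5, h6⟩ hi⟩
  choose g hg using hg
  obtain ⟨f, hf, hf'⟩ : ∃ f : V → V, (∀ i < M, f (e i) = g i) ∧
      ∀ v, (∀ j < M, v ≠ e j) → f v = e (N + 2) := by
    refine ⟨fun v => if hv : ∃ j < M, v = e j then g hv.choose else e (N + 2), fun i hi => ?_,
      fun v hv => dif_neg fun ⟨j, hj, hj'⟩ => hv j hj hj'⟩
    have hex : ∃ j < M, e i = e j := ⟨i, hi, rfl⟩
    dsimp only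
    rw [dif_pos hex, ← h.inj i hi _ hex.choose_spec.1 hex.choose_spec.2]
  have key : ∀ j < M, ∀ i < j, i ≠ m → j ≠ m → G.Adj (e i) (e j) →
      f (e i) = e j ∨ f (e j) = e i := by
    intro j hj i hij hi' hj' hadj
    have h3 : τ i = j ∨ τ j = i := by
      refine h2 j hj i hij ⟨hi', hj', ?_⟩
      rcases h.adj_cases hij hj hadj with h3 | h3 | h3 | ⟨h5, h3, h4⟩ | ⟨-, h5, h3, h4⟩ | h3
      · exact Or.inl h3
      · exact Or.inr (Or.inl h3)
      · exact Or.inr (Or.inr (Or.inl h3))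
      · exact Or.inr (Or.inr (Or.inr (Or.inl ⟨h5, h3, fun h6 => hX i h6 h4⟩)))
      · exact Or.inr (Or.inr (Or.inr (Or.inr (Or.inl ⟨h5, h3, fun h6 => hQ i h6 h4⟩))))
      · exact Or.inr (Or.inr (Or.inr (Or.inr (Or.inr h3.1))))
    rw [hf i (by omega), hf j hj]
    rcases h3 with h3 | h3
    · exact Or.inl (by rw [(hg i).1 (by omega), h3])
    · exact Or.inr (by rw [(hg j).1 (by omega), h3])
  have key' : ∀ a b, a ≠ e m → G.Adj a b → (∀ j < M, b ≠ e j) → f a = b ∨ f b = a := by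
    intro a b ha hadj hb
    rcases h.cover b with ⟨j, hj, rfl⟩ | ⟨i, hi, hd⟩
    · exact absurd rfl (hb j hj)
    · rcases (hd.nbr a).1 hadj.symm with rfl | rfl
      · exact Or.inr (hf' b hb)
      · refine Or.inl ?_
        rw [hf i (by omega)]
        exact (hg i).2 hi (fun h3 => ha (by rw [h3])) b hb hd
  refine h.crit.not_orientable (e m) ⟨f, fun a ha b hb hadj => ?_⟩
  simp only [Set.mem_compl_iff, Set.mem_singleton_iff] at ha hb
  by_cases hb' : ∀ j < M, b ≠ e j
  · exact key' a b ha hadj hb'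
  by_cases ha' : ∀ j < M, a ≠ e j
  · exact (key' b a hb hadj.symm ha').symm
  push Not at ha' hb'
  obtain ⟨i, hi, rfl⟩ := ha'
  obtain ⟨j, hj, rfl⟩ := hb'
  have him : i ≠ m := by rintro rfl; exact ha rfl
  have hjm : j ≠ m := by rintro rfl; exact hb rfl
  rcases lt_trichotomy i j with h3 | rfl | h3
  · exact key j hj i h3 him hjm hadj
  · exact absurd rfl hadj.ne
  · exact (key i hi j h3 hjm him hadj.symm).symm

/-- A subgraph on enumerated vertices and doublers: the index `M + r` stands for the `r`-th member
of `D`, which is a doubler at the vertex whose index is the `r`-th member of `I`. -/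
lemma isMinorOf_of_indices (h : Config G e N k M) {n : ℕ} {E : List (ℕ × ℕ)}
    (L X Q I : List ℕ) (D : List V)
    (hX : ∀ i ∈ X, G.Adj (e (N + 2)) (e i))
    (hQ : ∀ i ∈ Q, G.Adj (e (N + 4)) (e i))
    (hD : List.Forall₂ (fun i d => (∀ j < M, d ≠ e j) ∧ IsDoubler G (e (N + 2)) d (e i)) I D)
    (hD' : D.Nodup)
    (h0 : L.length = n := by decide) (h1 : L.Nodup := by decide)
    (h2 : ∀ i ∈ L, i < M + I.length := by decide)
    (h3 : ∀ q ∈ E, ∃ p ∈ [(L.getD q.1 0, L.getD q.2 0), (L.getD q.2 0, L.getD q.1 0)],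
      (p.2 < N ∧ (p.1 + 1 = p.2 ∨ (p.1 = k ∧ p.2 + 1 = N))) ∨
      (p.1 = 0 ∧ (p.2 = N ∨ p.2 = N + 1)) ∨ (p.1 = N ∧ p.2 = N + 1) ∨
      (p.2 = N + 2 ∧ p.1 < N ∧ (p.1 ∈ X ∨ p.1 ∈ I)) ∨ (p.2 = N + 4 ∧ p.2 < M ∧ p.1 < N ∧ p.1 ∈ Q) ∨
      (N + 2 ≤ p.1 ∧ p.1 < p.2 ∧ p.2 < M) ∨ (p.1 = N + 2 ∧ M ≤ p.2 ∧ p.2 < M + I.length) ∨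
      (p.1 < N ∧ M ≤ p.2 ∧ I[p.2 - M]? = some p.1) := by decide) :
    IsMinorOf (mkGraph n E) G := by
  classical
  subst h0
  have hsize := h.size
  have hle := h.le
  have hlen := hD.length_eq
  have hget : ∀ r (hr : r < I.length), (∀ j < M, D[r] ≠ e j) ∧
      IsDoubler G (e (N + 2)) (D[r]) (e I[r]) := fun r hr =>
    (List.forall₂_iff_get.1 hD).2 r hr (hlen ▸ hr)
  obtain ⟨v, hv, hv'⟩ : ∃ v : ℕ → V, (∀ i < M, v i = e i) ∧
      ∀ r (hr : r < I.length), v (M + r) = D[r] := by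
    refine ⟨fun i => if hi : M ≤ i ∧ i < M + I.length then D[i - M] else e i,
      fun i hi => dif_neg (by omega), fun r hr => ?_⟩
    dsimp only
    rw [dif_pos ⟨by omega, by omega⟩]
    congr 1
    omega
  have hinj : ∀ i < M + I.length, ∀ j < M + I.length, v i = v j → i = j := by
    intro i hi j hj hij
    rcases lt_or_ge i M with h4 | h4 <;> rcases lt_or_ge j M with h5 | h5
    · rw [hv i h4, hv j h5] at hij
      exact h.inj i h4 j h5 hij
    · obtain ⟨r, rfl⟩ := Nat.exists_eq_add_of_le h5
      rw [hv i h4, hv' r (by omega)] at hij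
      exact absurd hij.symm ((hget r (by omega)).1 i h4)
    · obtain ⟨r, rfl⟩ := Nat.exists_eq_add_of_le h4
      rw [hv j h5, hv' r (by omega)] at hij
      exact absurd hij ((hget r (by omega)).1 j h5)
    · obtain ⟨r, rfl⟩ := Nat.exists_eq_add_of_le h4
      obtain ⟨s, rfl⟩ := Nat.exists_eq_add_of_le h5
      rw [hv' r (by omega), hv' s (by omega)] at hij
      rw [(hD'.getElem_inj_iff).1 hij]
  have hadj : ∀ i j,
      (j < N ∧ (i + 1 = j ∨ (i = k ∧ j + 1 = N))) ∨
      (i = 0 ∧ (j = N ∨ j = N + 1)) ∨ (i = N ∧ j = N + 1) ∨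
      (j = N + 2 ∧ i < N ∧ (i ∈ X ∨ i ∈ I)) ∨ (j = N + 4 ∧ j < M ∧ i < N ∧ i ∈ Q) ∨
      (N + 2 ≤ i ∧ i < j ∧ j < M) ∨ (i = N + 2 ∧ M ≤ j ∧ j < M + I.length) ∨
      (i < N ∧ M ≤ j ∧ I[j - M]? = some i) → G.Adj (v i) (v j) := by
    rintro i j (h4 | h4 | h4 | ⟨rfl, h4, h5⟩ | ⟨rfl, h4, h5, h6⟩ | h4 | ⟨rfl, h4, h5⟩ | ⟨h4, h5, h6⟩)
    · rw [hv i (by omega), hv j (by omega)]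
      exact h.adj_tadpole (by omega) (by omega) (by omega)
    · rw [hv i (by omega), hv j (by omega)]
      exact (h.adj_tip_base (by omega) h4.1).symm
    · rw [hv i (by omega), hv j (by omega)]
      exact h.adj_tips h4.1 h4.2
    · rw [hv i (by omega), hv _ (by omega)]
      refine SimpleGraph.Adj.symm ?_
      rcases h5 with h5 | h5
      · exact hX i h5
      · obtain ⟨r, hr, rfl⟩ := List.getElem_of_mem h5
        exact (hget r hr).2.adj
    · rw [hv i (by omega), hv _ h4]
      exact (hQ i h6).symm
    · rw [hv i (by omega), hv j (by omega)]
      exact h.adj_apex_triangle (by omega) (by omega) (by omega) (by omega) (by omega)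
    · obtain ⟨r, rfl⟩ := Nat.exists_eq_add_of_le h4
      rw [hv _ (by omega), hv' r (by omega)]
      exact (((hget r (by omega)).2.nbr _).2 (Or.inl rfl)).symm
    · obtain ⟨r, rfl⟩ := Nat.exists_eq_add_of_le h5
      rw [Nat.add_sub_cancel_left] at h6
      obtain ⟨hr, rfl⟩ := List.getElem?_eq_some_iff.1 h6
      rw [hv _ (by omega), hv' r hr]
      exact (((hget r hr).2.nbr _).2 (Or.inr rfl)).symm
  have hE : ∀ a b : Fin L.length, ((a : ℕ), (b : ℕ)) ∈ E → G.Adj (v L[a]) (v L[b]) := by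
    intro a b hab
    obtain ⟨p, hp, hp'⟩ := h3 _ hab
    rw [List.getD_eq_getElem _ _ a.2, List.getD_eq_getElem _ _ b.2] at hp
    simp only [List.mem_cons, List.not_mem_nil, or_false] at hp
    rcases hp with rfl | rfl
    · exact hadj _ _ hp'
    · exact (hadj _ _ hp').symm
  refine IsMinorOf.of_injective (fun a : Fin L.length => v L[a]) (fun a b hab => ?_) fun a b hab => ?_
  · have h4 := hinj _ (h2 _ (List.getElem_mem a.2)) _ (h2 _ (List.getElem_mem b.2)) hab
    exact Fin.ext ((h1.getElem_inj_iff).1 h4)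
  · rw [mkGraph, SimpleGraph.fromRel_adj] at hab
    rcases hab.2 with h4 | h4
    · exact hE _ _ h4
    · exact (hE _ _ h4).symm

end Config

namespace Config

variable {V : Type} {G : SimpleGraph V} {e : ℕ → V} {N k M : ℕ}

lemma not_adj_apex_of_not_touched (h : Config G e N k M) {i : ℕ} (ht : ¬ h.Touched i) :
    ¬ G.Adj (e (N + 2)) (e i) :=
  fun h1 => ht (h.touched_of_adj_apex h1)

lemma not_adj_q_of_not_touched (h : Config G e N k M) (hM : M = N + 5) {i : ℕ}
    (ht : ¬ h.Touched i) : ¬ G.Adj (e (N + 4)) (e i) :=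
  fun h1 => ht ⟨N + 4, by omega, by omega, h1⟩

lemma doublers_ne (h : Config G e N k M) {i j : ℕ} (hi : i < N) (hj : j < N) (hij : i ≠ j)
    {d d' : V} (hd : IsDoubler G (e (N + 2)) d (e i)) (hd' : IsDoubler G (e (N + 2)) d' (e j)) :
    d ≠ d' := by
  rintro rfl
  have hsize := h.size
  rcases (hd'.nbr _).1 ((hd.nbr _).2 (Or.inr rfl)) with h1 | h1
  · have := h.inj i (by omega) _ (by omega) h1; omega
  · exact hij (h.inj i (by omega) _ (by omega) h1)

/-- Here `e a` is a doubled vertex of the triangle `e 0, e a, e b`. -/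
lemma not_doubled_of_adj_apex (h : Config G e N 0 M) (hM : M = N + 3) (hN : N = 3) {a b : ℕ}
    (hab : a = 1 ∧ b = 2 ∨ a = 2 ∧ b = 1) (hb : G.Adj (e (N + 2)) (e b)) : ¬ h.Doubled a := by
  rintro ⟨d, hd⟩
  subst hN hM
  by_cases hc : G.Adj (e (3 + 2)) (e 0)
  · refine h.not_isMinorOf (H := O8) (by simp [OList]) ?_
    rcases hab with ⟨rfl, rfl⟩ | ⟨rfl, rfl⟩
    · exact h.isMinorOf_of_indices [3, 4, 0, 2, 1, 5, 6] [0, 2] [] [1] [d] (by simp [hb, hc])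
        (by simp) (by simpa using hd) (by simp)
    · exact h.isMinorOf_of_indices [3, 4, 0, 1, 2, 5, 6] [0, 1] [] [2] [d] (by simp [hb, hc])
        (by simp) (by simpa using hd) (by simp)
  by_cases hdb : h.Doubled b
  · obtain ⟨d', hd'⟩ := hdb
    have hne := h.doublers_ne (by omega) (by omega) (by omega) hd.2 hd'.2
    refine h.not_isMinorOf (H := O6) (by simp [OList]) ?_
    rcases hab with ⟨rfl, rfl⟩ | ⟨rfl, rfl⟩
    · exact h.isMinorOf_of_indices [3, 4, 0, 1, 2, 5, 6, 7] [] [] [1, 2] [d, d'] (by simp)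
        (by simp) (.cons hd (.cons hd' .nil)) (by simp [hne])
    · exact h.isMinorOf_of_indices [3, 4, 0, 2, 1, 5, 6, 7] [] [] [2, 1] [d, d'] (by simp)
        (by simp) (.cons hd (.cons hd' .nil)) (by simp [hne])
  · rcases hab with ⟨rfl, rfl⟩ | ⟨rfl, rfl⟩
    · exact h.false_of_orientation 1 [(0, 3), (3, 4), (4, 0), (2, 0), (5, 2)] [0] [] [2] []
        (by simpa using hc) (by simp) (by simpa using hdb) (by simp)
    · exact h.false_of_orientation 2 [(0, 3), (3, 4), (4, 0), (1, 0), (5, 1)] [0] [] [1] []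
        (by simpa using hc) (by simp) (by simpa using hdb) (by simp)

lemma touched_of_triangle (h : Config G e N 0 M) (hM : M = N + 3) (hN : N = 3) {a b : ℕ}
    (hab : a = 1 ∧ b = 2 ∨ a = 2 ∧ b = 1) (ha : h.Touched a) : h.Touched b := by
  by_contra hb
  replace hb := h.not_adj_apex_of_not_touched hb
  subst hN hM
  obtain ⟨d, hd⟩ : h.Doubled 0 := by
    by_contra hc
    rcases hab with ⟨rfl, rfl⟩ | ⟨rfl, rfl⟩
    · exact h.false_of_orientation 1 [(0, 3), (3, 4), (4, 0), (2, 0), (5, 0)] [2] [] [0] []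
        (by simpa using hb) (by simp) (by simpa using hc) (by simp)
    · exact h.false_of_orientation 2 [(0, 3), (3, 4), (4, 0), (1, 0), (5, 0)] [1] [] [0] []
        (by simpa using hb) (by simp) (by simpa using hc) (by simp)
  obtain ⟨d₁, d₂, hd₁, hd₂, hne⟩ : ∃ d₁ d₂, ((∀ j < 3 + 3, d₁ ≠ e j) ∧
      IsDoubler G (e (3 + 2)) d₁ (e a)) ∧ ((∀ j < 3 + 3, d₂ ≠ e j) ∧
      IsDoubler G (e (3 + 2)) d₂ (e a)) ∧ d₁ ≠ d₂ := by
    by_contra! hno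
    have hU : ∀ i ∈ [a], ∀ d d', (∀ j < 3 + 3, d ≠ e j) → (∀ j < 3 + 3, d' ≠ e j) →
      IsDoubler G (e (3 + 2)) d (e i) → IsDoubler G (e (3 + 2)) d' (e i) → d = d' :=
      List.forall_mem_singleton.2 fun d d' h1 h2 h3 h4 => hno d d' ⟨h1, h3⟩ ⟨h2, h4⟩
    rcases hab with ⟨rfl, rfl⟩ | ⟨rfl, rfl⟩
    · exact h.false_of_orientation 0 [(3, 4), (2, 1), (1, 6), (5, 1)] [2] [] [] [1]
        (by simpa using hb) (by simp) (by simp) hU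
    · exact h.false_of_orientation 0 [(3, 4), (1, 2), (2, 6), (5, 2)] [1] [] [] [2]
        (by simpa using hb) (by simp) (by simp) hU
  have hne₁ := h.doublers_ne (by omega) (by omega) (by omega) hd₁.2 hd.2
  have hne₂ := h.doublers_ne (by omega) (by omega) (by omega) hd₂.2 hd.2
  refine h.not_isMinorOf (H := O9) (by simp [OList]) ?_
  rcases hab with ⟨rfl, rfl⟩ | ⟨rfl, rfl⟩
  · exact h.isMinorOf_of_indices [3, 4, 0, 1, 5, 6, 8, 2, 7] [] [] [1, 1, 0] [d₁, d₂, d] (by simp)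
      (by simp) (.cons hd₁ (.cons hd₂ (.cons hd .nil))) (by simp [hne, hne₁, hne₂])
  · exact h.isMinorOf_of_indices [3, 4, 0, 2, 5, 6, 8, 1, 7] [] [] [2, 2, 0] [d₁, d₂, d] (by simp)
      (by simp) (.cons hd₁ (.cons hd₂ (.cons hd .nil))) (by simp [hne, hne₁, hne₂])

/-- The cycle passes through the attachment vertex, and there is no apex triangle. -/
lemma false_of_cycle (h : Config G e N 0 M) (hM : M = N + 3) : False := by
  have hle := h.le
  by_cases hN : N = 3
  · by_cases h1 : h.Touched 1 ∨ h.Touched 2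
    · have h2 : h.Touched 1 ∧ h.Touched 2 := by
        rcases h1 with h1 | h1
        · exact ⟨h1, h.touched_of_triangle hM hN (Or.inl ⟨rfl, rfl⟩) h1⟩
        · exact ⟨h.touched_of_triangle hM hN (Or.inr ⟨rfl, rfl⟩) h1, h1⟩
      have ha : ∀ i < N, h.Touched i → G.Adj (e (N + 2)) (e i) := fun i hi ht =>
        (h.adj_q_or_adj_apex_of_touched hi ht).resolve_right fun h3 => by omega
      have d₁ := h.not_doubled_of_adj_apex hM hN (Or.inl ⟨rfl, rfl⟩) (ha 2 (by omega) h2.2)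
      have d₂ := h.not_doubled_of_adj_apex hM hN (Or.inr ⟨rfl, rfl⟩) (ha 1 (by omega) h2.1)
      subst hN hM
      exact h.false_of_orientation 0 [(3, 4), (1, 2), (2, 5), (5, 1)] [] [] [1, 2] []
        (by simp) (by simp) (by simp [d₁, d₂]) (by simp)
    · rw [not_or] at h1
      have a₁ := h.not_adj_apex_of_not_touched h1.1
      have a₂ := h.not_adj_apex_of_not_touched h1.2
      subst hN hM
      exact h.false_of_orientation 0 [(3, 4), (1, 2)] [1, 2] [] [] []
        (List.forall_mem_cons.2 ⟨a₁, List.forall_mem_singleton.2 a₂⟩) (by simp) (by simp) (by simp)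
  · have ht : ∀ i, 1 ≤ i → i < N → h.Touched i := fun i h1 h2 =>
      (h.touched_or_triangle ⟨h1, h2⟩ (by omega)).resolve_right fun h3 => by omega
    exact h.not_three_touched (j := 2) (by omega) (ht _ (by omega) (by omega))
      (ht _ (by omega) (by omega)) (ht _ (by omega) (by omega))

/-- The cycle passes through the attachment vertex, and meets the apex triangle at `e a`. -/
lemma not_adj_q (h : Config G e N 0 M) (hM : M = N + 5) {a : ℕ} (ha : 1 ≤ a ∧ a < N) :
    ¬ G.Adj (e (N + 4)) (e a) := by
  intro hq
  have hle := h.le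
  have ht : ∀ i, 1 ≤ i → i < N → i ≠ a → ¬ h.Touched i := fun i h1 h2 h3 h4 =>
    h.not_adj_q_of_touched hM ⟨h1, h2⟩ ha h3 hq h4
  obtain ⟨b, hb, hba⟩ : ∃ b, (b = 1 ∨ b = 2) ∧ b ≠ a := by
    by_cases h1 : a = 1
    · exact ⟨2, by omega, by omega⟩
    · exact ⟨1, by omega, by omega⟩
  have htb := ht b (by omega) (by omega) hba
  have hN : N = 3 := by
    by_contra hN
    rcases h.touched_or_triangle (i := b) (by omega) (by omega) with h1 | h1
    · exact htb h1
    · omega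
  have hqc : ¬ G.Adj (e (N + 4)) (e 0) := fun h1 => by
    have := h.unique_q hM 0 (by omega) a (by omega) h1 hq
    omega
  have hxb := h.not_adj_apex_of_not_touched htb
  have hqb := h.not_adj_q_of_not_touched hM htb
  have hab : a = 1 ∧ b = 2 ∨ a = 2 ∧ b = 1 := by omega
  subst hN hM
  have hxa : G.Adj (e (3 + 2)) (e a) := by
    by_contra hxa
    rcases hab with ⟨rfl, rfl⟩ | ⟨rfl, rfl⟩
    · exact h.false_of_orientation 0 [(3, 4), (2, 1), (1, 7), (7, 6), (6, 5), (5, 7)] [1, 2] [2] []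
        [] (by simp_all) (by simp_all) (by simp) (by simp)
    · exact h.false_of_orientation 0 [(3, 4), (1, 2), (2, 7), (7, 6), (6, 5), (5, 7)] [1, 2] [1] []
        [] (by simp_all) (by simp_all) (by simp) (by simp)
  have hxc : G.Adj (e (3 + 2)) (e 0) := by
    by_contra hxc
    rcases hab with ⟨rfl, rfl⟩ | ⟨rfl, rfl⟩
    · exact h.false_of_orientation 1 [(0, 3), (3, 4), (4, 0), (2, 0), (5, 7), (7, 6), (6, 5)] [0, 2]
        [0, 2] [] [] (by simp_all) (by simp_all) (by simp) (by simp)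
    · exact h.false_of_orientation 2 [(0, 3), (3, 4), (4, 0), (1, 0), (5, 7), (7, 6), (6, 5)] [0, 1]
        [0, 1] [] [] (by simp_all) (by simp_all) (by simp) (by simp)
  refine h.not_isMinorOf (H := O14) (by simp [OList]) ?_
  rcases hab with ⟨rfl, rfl⟩ | ⟨rfl, rfl⟩
  · exact h.isMinorOf_of_indices [2, 0, 1, 7, 5, 6, 3, 4] [0, 1] [1] [] [] (by simp_all)
      (by simp_all) .nil (by simp)
  · exact h.isMinorOf_of_indices [1, 0, 2, 7, 5, 6, 3, 4] [0, 2] [2] [] [] (by simp_all)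
      (by simp_all) .nil (by simp)

/-- The cycle passes through the attachment vertex, and there is an apex triangle. -/
lemma false_of_cycle_of_apex_triangle (h : Config G e N 0 M) (hM : M = N + 5) : False := by
  have hle := h.le
  have hx : ∀ i, 1 ≤ i → i < N → h.Touched i → G.Adj (e (N + 2)) (e i) := fun i h1 h2 ht =>
    (h.adj_q_or_adj_apex_of_touched h2 ht).resolve_right fun h3 => h.not_adj_q hM ⟨h1, h2⟩ h3.2
  have hxx : ∀ i j, 1 ≤ i → i < j → j < N → ¬ (h.Touched i ∧ h.Touched j) :=
    fun i j h1 h2 h3 h4 => h.not_two_adj_apex hM h1 h2 h3 (hx i h1 (by omega) h4.1)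
      (hx j (by omega) h3 h4.2)
  have hN : N = 3 := by
    by_contra hN
    rcases h.touched_or_triangle (i := 1) (by omega) (by omega) with h1 | h1
    · rcases h.touched_or_triangle (i := 2) (by omega) (by omega) with h2 | h2
      · exact hxx 1 2 (by omega) (by omega) (by omega) ⟨h1, h2⟩
      · omega
    · omega
  obtain ⟨a, b, hab, hb⟩ : ∃ a b, (a = 1 ∧ b = 2 ∨ a = 2 ∧ b = 1) ∧ ¬ h.Touched b := by
    by_cases h1 : h.Touched 1
    · exact ⟨1, 2, Or.inl ⟨rfl, rfl⟩, fun h2 => hxx 1 2 (by omega) (by omega) (by omega) ⟨h1, h2⟩⟩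
    · exact ⟨2, 1, Or.inr ⟨rfl, rfl⟩, h1⟩
  have hxb := h.not_adj_apex_of_not_touched hb
  have hqb := h.not_adj_q_of_not_touched hM hb
  have hqa := h.not_adj_q hM (a := a) (by omega)
  subst hN hM
  obtain ⟨d, hd⟩ : h.Doubled a := by
    by_contra hda
    rcases hab with ⟨rfl, rfl⟩ | ⟨rfl, rfl⟩
    · exact h.false_of_orientation 0 [(3, 4), (2, 1), (1, 5), (5, 7), (7, 6), (6, 5)] [2] [1, 2] [1]
        [] (by simp_all) (by simp_all) (by simp_all) (by simp)
    · exact h.false_of_orientation 0 [(3, 4), (1, 2), (2, 5), (5, 7), (7, 6), (6, 5)] [1] [1, 2] [2]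
        [] (by simp_all) (by simp_all) (by simp_all) (by simp)
  by_cases hqc : G.Adj (e (3 + 4)) (e 0)
  · refine h.not_isMinorOf (H := O10) (by simp [OList]) ?_
    rcases hab with ⟨rfl, rfl⟩ | ⟨rfl, rfl⟩
    · exact h.isMinorOf_of_indices [0, 1, 5, 7, 2, 8, 6, 3, 4] [] [0] [1] [d] (by simp)
        (by simpa using hqc) (.cons hd .nil) (by simp)
    · exact h.isMinorOf_of_indices [0, 2, 5, 7, 1, 8, 6, 3, 4] [] [0] [2] [d] (by simp)
        (by simpa using hqc) (.cons hd .nil) (by simp)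
  have hxc : G.Adj (e (3 + 2)) (e 0) := by
    by_contra hxc
    rcases hab with ⟨rfl, rfl⟩ | ⟨rfl, rfl⟩
    · exact h.false_of_orientation 1 [(0, 3), (3, 4), (4, 0), (2, 0), (5, 7), (7, 6), (6, 5)] [0, 2]
        [0, 2] [] [] (by simp_all) (by simp_all) (by simp) (by simp)
    · exact h.false_of_orientation 2 [(0, 3), (3, 4), (4, 0), (1, 0), (5, 7), (7, 6), (6, 5)] [0, 1]
        [0, 1] [] [] (by simp_all) (by simp_all) (by simp) (by simp)
  refine h.not_isMinorOf (H := O15) (by simp [OList]) ?_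
  rcases hab with ⟨rfl, rfl⟩ | ⟨rfl, rfl⟩
  · exact h.isMinorOf_of_indices [3, 4, 0, 2, 1, 8, 5, 6, 7] [0] [] [1] [d] (by simpa using hxc)
      (by simp) (.cons hd .nil) (by simp)
  · exact h.isMinorOf_of_indices [3, 4, 0, 1, 2, 8, 5, 6, 7] [0] [] [2] [d] (by simpa using hxc)
      (by simp) (.cons hd .nil) (by simp)

end Config

namespace Config

variable {V : Type} {G : SimpleGraph V} {e : ℕ → V} {N k M : ℕ}

/-- The tail is the edge `e 0, e 1`, and only the vertex `e a` of the cycle `e 1, e a, e b` other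
than `e 1` may have a neighbour at the apex. -/
lemma false_of_short_tail (h : Config G e N 1 M) (hM : M = N + 3) (hN : N = 4) {a b : ℕ}
    (hab : a = 2 ∧ b = 3 ∨ a = 3 ∧ b = 2) (h0 : G.Adj (e (N + 2)) (e 0))
    (ha : G.Adj (e (N + 2)) (e a)) (hb : ¬ G.Adj (e (N + 2)) (e b)) : False := by
  subst hN hM
  have h₁ : h.Doubled 0 ∨ h.Doubled a := by
    by_contra! hno
    rcases hab with ⟨rfl, rfl⟩ | ⟨rfl, rfl⟩
    · exact h.false_of_orientation 1 [(0, 4), (4, 5), (5, 0), (3, 2), (2, 6), (6, 0)] [3] []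
        [0, 2] [] (by simpa using hb) (by simp) (by simpa using hno) (by simp)
    · exact h.false_of_orientation 1 [(0, 4), (4, 5), (5, 0), (2, 3), (3, 6), (6, 0)] [2] []
        [0, 3] [] (by simpa using hb) (by simp) (by simpa using hno) (by simp)
  have h₂ : G.Adj (e (4 + 2)) (e 1) ∨ h.Doubled a := by
    by_contra! hno
    rcases hab with ⟨rfl, rfl⟩ | ⟨rfl, rfl⟩
    · exact h.false_of_orientation 0 [(4, 5), (6, 2), (2, 3), (3, 1), (1, 2)] [1, 3] []
        [2] [] (by simp_all) (by simp) (by simpa using hno.2) (by simp)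
    · exact h.false_of_orientation 0 [(4, 5), (6, 3), (3, 2), (2, 1), (1, 3)] [1, 2] []
        [3] [] (by simp_all) (by simp) (by simpa using hno.2) (by simp)
  have h₃ : G.Adj (e (4 + 2)) (e 1) ∨ h.Doubled 0 := by
    by_contra! hno
    rcases hab with ⟨rfl, rfl⟩ | ⟨rfl, rfl⟩
    · exact h.false_of_orientation 2 [(0, 4), (4, 5), (5, 0), (3, 1), (1, 0), (6, 0)] [1, 3] []
        [0] [] (by simp_all) (by simp) (by simpa using hno.2) (by simp)
    · exact h.false_of_orientation 3 [(0, 4), (4, 5), (5, 0), (2, 1), (1, 0), (6, 0)] [1, 2] []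
        [0] [] (by simp_all) (by simp) (by simpa using hno.2) (by simp)
  by_cases hr : G.Adj (e (4 + 2)) (e 1)
  · rcases h₁ with ⟨d, hd⟩ | ⟨d, hd⟩
    · refine h.not_isMinorOf (H := O14) (by simp [OList]) ?_
      rcases hab with ⟨rfl, rfl⟩ | ⟨rfl, rfl⟩
      · exact h.isMinorOf_of_indices [7, 0, 6, 2, 1, 3, 4, 5] [1, 2] [] [0] [d] (by simp_all)
          (by simp) (.cons hd .nil) (by simp)
      · exact h.isMinorOf_of_indices [7, 0, 6, 3, 1, 2, 4, 5] [1, 3] [] [0] [d] (by simp_all)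
          (by simp) (.cons hd .nil) (by simp)
    · refine h.not_isMinorOf (H := O6) (by simp [OList]) ?_
      rcases hab with ⟨rfl, rfl⟩ | ⟨rfl, rfl⟩
      · exact h.isMinorOf_of_indices [4, 5, 0, 1, 6, 2, 3, 7] [0, 1] [] [2] [d] (by simp_all)
          (by simp) (.cons hd .nil) (by simp)
      · exact h.isMinorOf_of_indices [4, 5, 0, 1, 6, 3, 2, 7] [0, 1] [] [3] [d] (by simp_all)
          (by simp) (.cons hd .nil) (by simp)
  · obtain ⟨d, hd⟩ := h₂.resolve_left hr
    obtain ⟨d', hd'⟩ := h₃.resolve_left hr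
    have hne := h.doublers_ne (by omega) (by omega) (by omega) hd.2 hd'.2
    refine h.not_isMinorOf (H := O10) (by simp [OList]) ?_
    rcases hab with ⟨rfl, rfl⟩ | ⟨rfl, rfl⟩
    · exact h.isMinorOf_of_indices [0, 6, 2, 1, 8, 7, 3, 4, 5] [] [] [2, 0] [d, d'] (by simp)
        (by simp) (.cons hd (.cons hd' .nil)) (by simp [hne])
    · exact h.isMinorOf_of_indices [0, 6, 3, 1, 8, 7, 2, 4, 5] [] [] [3, 0] [d, d'] (by simp)
        (by simp) (.cons hd (.cons hd' .nil)) (by simp [hne])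

/-- The tail is the edge `e 0, e 1`, and no vertex of the cycle `e 1, e 2, e 3` other than `e 1` is
adjacent to the apex. -/
lemma false_of_short_tail_of_not_adj (h : Config G e N 1 M) (hM : M = N + 3) (hN : N = 4)
    (h₂ : ¬ G.Adj (e (N + 2)) (e 2)) (h₃ : ¬ G.Adj (e (N + 2)) (e 3)) : False := by
  subst hN hM
  have hX : ∀ i ∈ [2, 3], ¬ G.Adj (e (4 + 2)) (e i) := by simp_all
  obtain ⟨d, hd⟩ : h.Doubled 0 := by
    by_contra hno
    exact h.false_of_orientation 1 [(0, 4), (4, 5), (5, 0), (6, 0), (2, 3)] [2, 3] [] [0] [] hX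
      (by simp) (by simpa using hno) (by simp)
  obtain ⟨d', hd'⟩ : h.Doubled 1 := by
    by_contra hno
    exact h.false_of_orientation 0 [(4, 5), (1, 2), (2, 3), (3, 1), (6, 1)] [2, 3] [] [1] [] hX
      (by simp) (by simpa using hno) (by simp)
  have hne := h.doublers_ne (by omega) (by omega) (by omega) hd.2 hd'.2
  exact h.not_isMinorOf (H := O15) (by simp [OList]) <|
    h.isMinorOf_of_indices [2, 3, 1, 8, 6, 7, 0, 4, 5] [] [] [0, 1] [d, d'] (by simp)
      (by simp) (.cons hd (.cons hd' .nil)) (by simp [hne])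

/-- The vertex `e a` of the cycle `e k, e a, e b` has a neighbour at the apex, and `e b` has
none. -/
lemma false_of_touched_triangle (h : Config G e N k M) (hk : 1 ≤ k) {a b : ℕ}
    (hab : N = k + 3 ∧ (a = k + 1 ∧ b = k + 2 ∨ a = k + 2 ∧ b = k + 1)) (ta : h.Touched a)
    (tb : ¬ h.Touched b) : False := by
  have t0 := h.touched_zero hk
  obtain rfl : k = 1 := by
    by_contra hk1
    rcases h.touched_or_triangle (i := 1) (by omega) (by omega) with t1 | t1
    · exact h.not_touched_of_long_tail hab (i := 1) (by omega) t0 t1 ta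
    · omega
  have c0 := h.adj_q_or_adj_apex_of_touched (by omega) t0
  have ca := h.adj_q_or_adj_apex_of_touched (by omega) ta
  rcases h.size with hM | hM
  · exact h.false_of_short_tail hM (a := a) (b := b) (by omega) (by omega)
      (c0.resolve_right fun h1 => by omega) (ca.resolve_right fun h1 => by omega)
      (h.not_adj_apex_of_not_touched tb)
  · rcases c0 with x0 | ⟨-, q0⟩
    · rcases ca with xa | ⟨-, qa⟩
      · exact h.not_adj_apex_of_cycle hM hk hab x0 xa
      · exact h.not_linked hM hk hab (Or.inl ⟨rfl, rfl⟩) x0 qa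
    · rcases ca with xa | ⟨-, qa⟩
      · exact h.not_linked hM hk hab (Or.inr ⟨rfl, rfl⟩) q0 xa
      · have := h.unique_q hM 0 (by omega) a (by omega) q0 qa
        omega

/-- The only vertex on the cycle with a neighbour at the apex is the end of the tail. -/
lemma false_of_pendant_triangle (h : Config G e N k M) (hk : 1 ≤ k) (hN : N = k + 3)
    (t₁ : ¬ h.Touched (k + 1)) (t₂ : ¬ h.Touched (k + 2)) : False := by
  have t0 := h.touched_zero hk
  have tk := h.touched_root hk hN t₁ t₂
  have c0 := h.adj_q_or_adj_apex_of_touched (by omega) t0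
  have ck := h.adj_q_or_adj_apex_of_touched (by omega) tk
  rcases h.size with hM | hM
  · by_cases hk1 : k = 1
    · subst hk1
      exact h.false_of_short_tail_of_not_adj hM hN (h.not_adj_apex_of_not_touched t₁)
        (h.not_adj_apex_of_not_touched t₂)
    · rcases h.touched_or_triangle (i := 1) (by omega) (by omega) with t1 | t1
      · exact h.not_three_touched_on_tail hN (i := k) (by omega) t0 t1 tk
      · omega
  · rcases c0 with x0 | ⟨-, q0⟩
    · rcases ck with xk | ⟨-, qk⟩
      · exact h.not_adj_apex_of_tail hM hN (i := k) (by omega) x0 xk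
      · exact h.not_linked_tail hM hN (i := k) (by omega) (Or.inl ⟨rfl, rfl⟩) x0 qk
    · rcases ck with xk | ⟨-, qk⟩
      · exact h.not_linked_tail hM hN (i := k) (by omega) (Or.inr ⟨rfl, rfl⟩) q0 xk
      · have := h.unique_q hM 0 (by omega) k (by omega) q0 qk
        omega

theorem elim (h : Config G e N k M) : False := by
  have hle := h.le
  rcases Nat.eq_zero_or_pos k with rfl | hk
  · rcases h.size with hM | hM
    · exact h.false_of_cycle hM
    · exact h.false_of_cycle_of_apex_triangle hM
  have t0 := h.touched_zero hk
  have two : ∀ i j, k < i → i < j → j < N → h.Touched i → h.Touched j → False :=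
    fun i j h1 h2 h3 h4 h5 => h.not_two_touched_on_cycle hk h1 h2 h3 t0 h4 h5
  have hN : N = k + 3 := by
    by_contra hN
    have ht : ∀ i, k < i → i < N → h.Touched i := fun i h1 h2 =>
      (h.touched_or_triangle (by omega) (by omega)).resolve_right fun h3 => by omega
    exact two (k + 1) (k + 2) (by omega) (by omega) (by omega) (ht _ (by omega) (by omega))
      (ht _ (by omega) (by omega))
  by_cases t₁ : h.Touched (k + 1)
  · exact h.false_of_touched_triangle hk ⟨hN, Or.inl ⟨rfl, rfl⟩⟩ t₁ fun t₂ =>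
      two (k + 1) (k + 2) (by omega) (by omega) (by omega) t₁ t₂
  by_cases t₂ : h.Touched (k + 2)
  · exact h.false_of_touched_triangle hk ⟨hN, Or.inr ⟨rfl, rfl⟩⟩ t₂ t₁
  · exact h.false_of_pendant_triangle hk hN t₁ t₂

end Config

/-- Every obstruction for apex-pseudoforests not isomorphic to a member of `O`
is biconnected. -/
theorem obstruction_biconnected {V : Type} [Finite V] (G : SimpleGraph V)
    (h1 : ObsApexPseudoforest G) (h2 : ¬ InO G) : KConnected 2 G := by
  by_contra hK
  have hG := h1.critical h2
  obtain ⟨c, t₁, t₂, h3, h4, h5, h6, h7, h8⟩ := hG.exists_pendant hK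
  obtain ⟨x, f, p, N, k, hT⟩ := hG.exists_trajectory ⟨h3, h4, h5, h6, h7⟩ h8
  obtain ⟨e, M, h⟩ := hT.exists_config hG
  exact h.elim
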